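/- arXiv:2210.04444 — 3 statements merged into one kernel-verified Lean document; each statement's English description precedes it below -/
import Mathlib

section
/- Let A be a unital Banach algebra with unit e, let ω be a weight on ℝ, and let f : ℝ → A be strongly measurable with ∫_ℝ ‖f(x)‖ ω(x) dx < ∞. Suppose e + ∫_ℝ f(x) e^{itx} dx is left invertible in A for every t ∈ ℝ. Then there exist a weight ν on ℝ with 1 ≤ ν(x) ≤ ω(x) for all x ∈ ℝ, with ν constant if and only if ω is constant, and a strongly measurable g : ℝ → A with ∫_ℝ ‖g(x)‖ ν(x) dx < ∞, such that f(x) + g(x) + (g ⋆ f)(x) = 0 for almost every x ∈ ℝ, where (g ⋆ f)(x) = ∫_ℝ g(x-t) f(t) dt; that is, 1 + g is a left inverse of 1 + f in the unitization of L¹(ℝ,ν,A). In particular, if ω is admissible, then 1 + f is left invertible in the unitization of L¹(ℝ,ω,A). -/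
open scoped BigOperators
open MeasureTheory

/-- A weight on `ℝ`: a Borel measurable `ω : ℝ → [1,∞)` with `ω(x+y) ≤ ω(x)ω(y)`. -/
def IsWeightR (ω : ℝ → ℝ) : Prop :=
  Measurable ω ∧ (∀ x, 1 ≤ ω x) ∧ ∀ x y, ω (x + y) ≤ ω x * ω y

/-- `ρ₁(ω) = sup{(log ω(x))/x : x < 0}`. -/
noncomputable def rho1R (ω : ℝ → ℝ) : ℝ :=
  sSup {r : ℝ | ∃ x : ℝ, x < 0 ∧ r = Real.log (ω x) / x}

/-- `ρ₂(ω) = inf{(log ω(x))/x : x > 0}`. -/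
noncomputable def rho2R (ω : ℝ → ℝ) : ℝ :=
  sInf {r : ℝ | ∃ x : ℝ, 0 < x ∧ r = Real.log (ω x) / x}

/-- A weight on `ℝ` is admissible if `ρ₁(ω) = ρ₂(ω) = 0`. -/
def IsAdmissibleR (ω : ℝ → ℝ) : Prop := rho1R ω = 0 ∧ rho2R ω = 0

section Aux

open Filter Topology

lemma schur_aux {E : Type*} [NormedAddCommGroup E] [NormedSpace ℂ E] [CompleteSpace E]
    (S : Set (E →L[ℂ] E)) (cv : E →L[ℂ] E →L[ℂ] E) (hcv : ∀ g h, ‖cv g h‖ ≤ ‖g‖ * ‖h‖)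
    (hcvS : ∀ g, cv g ∈ S) (f : E) (hcomm : ∀ P ∈ S, ∀ g, P (cv g f) = cv (P g) f)
    (hf : ¬ ∃ g, g + cv g f = f) :
    ∃ L : Submodule ℂ E, IsClosed (L : Set E) ∧ f ∉ L ∧ (∀ g, g + cv g f ∈ L) ∧
      (∀ P ∈ S, ∀ x ∈ L, P x ∈ L) ∧
      ∀ Q ∈ S, (∀ P ∈ S, ∀ x, Q (P x) = P (Q x)) → ∃ c : ℂ, ∀ h, Q h - c • h ∈ L := by
  set Z : Set (Submodule ℂ E) :=
    {N | f ∉ N ∧ (∀ g, g + cv g f ∈ N) ∧ ∀ P ∈ S, ∀ x ∈ N, P x ∈ N} with hZ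
  have hzorn : ∃ L, Maximal (· ∈ Z) L := by
    have hJ : ((ContinuousLinearMap.id ℂ E + cv.flip f).range : Submodule ℂ E) ∈ Z := by
      refine ⟨?_, ?_, ?_⟩
      · rintro ⟨g, hg⟩
        exact hf ⟨g, by simpa using hg⟩
      · intro g
        exact ⟨g, by simp⟩
      · rintro P hP _ ⟨g, rfl⟩
        exact ⟨P g, by simp [hcomm P hP]⟩
    have hz : ∀ c ⊆ Z, IsChain (· ≤ ·) c → ∀ y ∈ c, ∃ ub ∈ Z, ∀ z ∈ c, z ≤ ub := by
      intro c hc hchain y hy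
      have hne : c.Nonempty := ⟨y, hy⟩
      have key : ∀ z, z ∈ sSup c ↔ ∃ N ∈ c, z ∈ N := fun z =>
        Submodule.mem_sSup_of_directed hne hchain.directedOn
      refine ⟨sSup c, ⟨?_, ?_, ?_⟩, fun z hz => le_sSup hz⟩
      · rw [key]
        rintro ⟨N, hN, h⟩
        exact (hc hN).1 h
      · intro g
        exact (key _).2 ⟨y, hy, (hc hy).2.1 g⟩
      · intro P hP x hx
        obtain ⟨N, hN, h⟩ := (key _).1 hx
        exact (key _).2 ⟨N, hN, (hc hN).2.2 P hP x h⟩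
    obtain ⟨m, -, hm⟩ := zorn_le_nonempty₀ Z hz _ hJ
    exact ⟨m, hm⟩
  obtain ⟨L, ⟨hfL, hJL, hSL⟩, hmax⟩ := hzorn
  -- any invariant submodule above L containing f is everything
  have htop : ∀ N : Submodule ℂ E, L ≤ N → (∀ P ∈ S, ∀ x ∈ N, P x ∈ N) → f ∈ N → N = ⊤ := by
    intro N hLN hN hfN
    rw [eq_top_iff]
    intro x _
    have h1 := hLN (hJL x)
    have h2 := hN (cv x) (hcvS x) f hfN
    simpa using N.sub_mem h1 h2
  have hdich : ∀ N : Submodule ℂ E, L ≤ N → (∀ P ∈ S, ∀ x ∈ N, P x ∈ N) → N = L ∨ N = ⊤ := by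
    intro N hLN hN
    by_cases h : f ∈ N
    · exact Or.inr (htop N hLN hN h)
    · exact Or.inl (le_antisymm (hmax ⟨h, fun g => hLN (hJL g), hN⟩ hLN) hLN)
  have hclosed : IsClosed (L : Set E) := by
    have hcl : L.topologicalClosure = L := by
      have hfc : f ∉ L.topologicalClosure := by
        intro h
        have h' : f ∈ closure (L : Set E) := h
        obtain ⟨n, hn, hd⟩ := Metric.mem_closure_iff.1 h' 1 one_pos
        rw [dist_eq_norm] at hd
        set v : E := n - f with hv
        have hvn : ‖v‖ < 1 := by rw [hv, norm_sub_rev]; exact hd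
        have hC : ‖cv.flip v‖ < 1 := by
          refine lt_of_le_of_lt (ContinuousLinearMap.opNorm_le_bound _ (norm_nonneg v) ?_) hvn
          intro w
          rw [ContinuousLinearMap.flip_apply, mul_comm]
          exact hcv w v
        have hu := isUnit_one_sub_of_norm_lt_one hC
        obtain ⟨U, hU⟩ := hu
        obtain ⟨w, hw⟩ : ∃ w, w - cv w v = v := by
          refine ⟨(U⁻¹ : (E →L[ℂ] E)ˣ).val v, ?_⟩
          have : (U.val * (U⁻¹ : (E →L[ℂ] E)ˣ).val) v = v := by rw [Units.mul_inv]; rfl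
          rw [hU] at this
          simpa using this
        apply hfL
        have e : f = n + cv w n - (w + cv w f) := by
          have h3 : cv w v = cv w n - cv w f := by rw [hv, map_sub]
          have h4 : f = n - v := by rw [hv]; abel
          rw [h3] at hw
          rw [← hw] at h4
          exact h4.trans (by abel)
        rw [e]
        exact L.sub_mem (L.add_mem hn (hSL _ (hcvS w) _ hn)) (hJL w)
      refine (hdich _ L.le_topologicalClosure ?_).resolve_right ?_
      · intro P hP x hx
        have : Set.MapsTo P (L : Set E) L := fun y hy => hSL P hP y hy
        exact (this.closure P.continuous) hx
      · intro h
        exact hfc (h ▸ Submodule.mem_top)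
    rw [← hcl]
    exact L.isClosed_topologicalClosure
  refine ⟨L, hclosed, hfL, hJL, hSL, ?_⟩
  intro Q hQ hcen
  have : IsClosed (L : Set E) := hclosed
  have : Nontrivial (E ⧸ L) := by
    rw [Submodule.Quotient.nontrivial_iff]
    rintro rfl
    exact hfL Submodule.mem_top
  have hle : L ≤ (L.mkQL ∘L Q).ker := by
    intro x hx
    simpa using hSL Q hQ x hx
  let q : (E ⧸ L) →L[ℂ] (E ⧸ L) := L.liftQL (L.mkQL ∘L Q) hle
  obtain ⟨c, hc⟩ := spectrum.nonempty q
  refine ⟨c, ?_⟩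
  by_contra hcon
  -- the two submodules
  let P0 : E →L[ℂ] E := Q - c • ContinuousLinearMap.id ℂ E
  have hP0 : ∀ h, P0 h = Q h - c • h := fun h => by simp [P0]
  have hP0c : ∀ P ∈ S, ∀ x, P (P0 x) = P0 (P x) := by
    intro P hP x
    rw [hP0, hP0, map_sub, map_smul, hcen P hP]
  have hP0L : ∀ x ∈ L, P0 x ∈ L := fun x hx => by
    rw [hP0]; exact L.sub_mem (hSL Q hQ x hx) (L.smul_mem c hx)
  have hN1 : L.comap (P0 : E →ₗ[ℂ] E) = L := by
    refine (hdich _ hP0L ?_).resolve_right ?_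
    · intro P hP x hx
      change P0 (P x) ∈ L
      rw [← hP0c P hP]
      exact hSL P hP _ hx
    · intro h
      apply hcon
      intro x
      rw [← hP0]
      have : x ∈ L.comap (P0 : E →ₗ[ℂ] E) := h ▸ Submodule.mem_top
      exact this
  have hN2 : L ⊔ (P0 : E →ₗ[ℂ] E).range = ⊤ := by
    refine (hdich _ le_sup_left ?_).resolve_left ?_
    · intro P hP x hx
      obtain ⟨y, hy, _, ⟨z, rfl⟩, rfl⟩ := Submodule.mem_sup.1 hx
      rw [map_add]
      refine Submodule.add_mem_sup (hSL P hP y hy) ⟨P z, ?_⟩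
      exact (hP0c P hP z).symm
    · intro h
      apply hcon
      intro x
      rw [← hP0, ← h]
      exact Submodule.mem_sup_right ⟨x, rfl⟩
  have hqmk : ∀ x, (q - c • (1 : (E ⧸ L) →L[ℂ] (E ⧸ L))) (L.mkQ x) = L.mkQ (P0 x) := by
    intro x
    rw [hP0]
    simp [q]
  have hbij : Function.Bijective (q - c • (1 : (E ⧸ L) →L[ℂ] (E ⧸ L))) := by
    constructor
    · rw [injective_iff_map_eq_zero]
      intro a ha
      obtain ⟨x, rfl⟩ := L.mkQ_surjective a
      rw [hqmk] at ha
      have : P0 x ∈ L := by simpa using ha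
      have : x ∈ L.comap (P0 : E →ₗ[ℂ] E) := this
      rw [hN1] at this
      simpa using this
    · intro a
      obtain ⟨x, rfl⟩ := L.mkQ_surjective a
      have hx : x ∈ L ⊔ (P0 : E →ₗ[ℂ] E).range := hN2 ▸ Submodule.mem_top
      obtain ⟨y, hy, _, ⟨z, rfl⟩, rfl⟩ := Submodule.mem_sup.1 hx
      refine ⟨L.mkQ z, ?_⟩
      rw [hqmk, map_add]
      have : L.mkQ y = 0 := by simpa using hy
      rw [this, zero_add]
      rfl
  have hunit : IsUnit (q - c • (1 : (E ⧸ L) →L[ℂ] (E ⧸ L))) := by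
    rw [ContinuousLinearMap.isUnit_iff_bijective]
    exact hbij
  rw [spectrum.mem_iff] at hc
  apply hc
  rw [Algebra.algebraMap_eq_smul_one, ← IsUnit.neg_iff, neg_sub]
  exact hunit

lemma char_aux (χ : ℝ → ℂ) (hc : Continuous χ) (h0 : χ 0 = 1)
    (hadd : ∀ s t, χ (s + t) = χ s * χ t) : ∃ z : ℂ, ∀ s : ℝ, χ s = Complex.exp (z * s) := by
  have hderiv : ∀ b, HasDerivAt (fun b => ∫ x in (0:ℝ)..b, χ x) (χ b) b := fun b =>
    intervalIntegral.integral_hasDerivAt_right (hc.intervalIntegrable _ _)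
      (hc.stronglyMeasurableAtFilter _ _) hc.continuousAt
  obtain ⟨δ, hδ⟩ : ∃ δ : ℝ, (∫ x in (0:ℝ)..δ, χ x) ≠ 0 := by
    by_contra! h
    have h1 := hderiv 0
    have h2 : (fun b => ∫ x in (0:ℝ)..b, χ x) = fun _ => 0 := funext h
    rw [h2] at h1
    have := h1.unique (hasDerivAt_const (0:ℝ) (0:ℂ))
    rw [h0] at this
    exact one_ne_zero this
  set c := ∫ x in (0:ℝ)..δ, χ x with hcdef
  have hrep : ∀ s, χ s = c⁻¹ * ((∫ x in (0:ℝ)..(s + δ), χ x) - ∫ x in (0:ℝ)..s, χ x) := by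
    intro s
    rw [intervalIntegral.integral_interval_sub_left (hc.intervalIntegrable _ _)
      (hc.intervalIntegrable _ _)]
    have : ∫ x in s..(s + δ), χ x = χ s * c := by
      rw [hcdef, ← intervalIntegral.integral_const_mul]
      simp_rw [← hadd]
      rw [intervalIntegral.integral_comp_add_left (fun x => χ x) s]
      simp
    rw [this]
    field_simp
  have hd : ∀ s, HasDerivAt χ (c⁻¹ * (χ (s + δ) - χ s)) s := by
    intro s
    have h1 := ((((hderiv (s + δ)).comp_add_const s δ)).sub (hderiv s)).const_mul c⁻¹
    refine h1.congr_of_eventuallyEq (Eventually.of_forall fun x => ?_)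
    exact hrep x
  set z : ℂ := c⁻¹ * (χ δ - 1) with hz
  have hd' : ∀ s, HasDerivAt χ (z * χ s) s := by
    intro s
    have := hd s
    rw [hadd] at this
    convert this using 1
    rw [hz]; ring
  refine ⟨z, fun s => ?_⟩
  have he : ∀ s : ℝ, HasDerivAt (fun s : ℝ => Complex.exp (-z * s)) (Complex.exp (-z * s) * (-z)) s := by
    intro s
    have h1 : HasDerivAt (fun s : ℝ => -z * (s:ℂ)) (-z) s := by
      simpa using (Complex.ofRealCLM.hasDerivAt (x := s)).const_mul (-z)
    exact h1.cexp
  have hp : ∀ s : ℝ, HasDerivAt (fun s : ℝ => χ s * Complex.exp (-z * s)) 0 s := by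
    intro s
    refine ((hd' s).mul (he s)).congr_deriv ?_
    ring
  have hconst := is_const_of_deriv_eq_zero (f := fun s : ℝ => χ s * Complex.exp (-z * s))
    (fun s => (hp s).differentiableAt) (fun s => (hp s).deriv) s 0
  simp only [h0, Complex.ofReal_zero, mul_zero, Complex.exp_zero, mul_one] at hconst
  have : χ s = χ s * Complex.exp (-z * s) * Complex.exp (z * s) := by
    rw [mul_assoc, ← Complex.exp_add]; simp
  rw [this, hconst, one_mul]

lemma char_bound_aux (ω : ℝ → ℝ) (χ : ℝ → ℂ) (z : ℂ) (hz : ∀ s : ℝ, χ s = Complex.exp (z * s))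
    (hω : IsWeightR ω) (C : ℝ) (hC : ∀ s, ‖χ s‖ ≤ C * ω s)
    (h2 : ∀ ε > 0, ∃ x > 0, Real.log (ω x) ≤ ε * x)
    (h1 : ∀ ε > 0, ∃ x < 0, Real.log (ω x) ≤ -(ε * x)) :
    ∃ t : ℝ, ∀ s : ℝ, χ s = Complex.exp (Complex.I * t * s) := by
  obtain ⟨-, hone, hsub⟩ := hω
  have hpow : ∀ (n : ℕ) x, ω ((n + 1 : ℕ) * x) ≤ ω x ^ (n + 1) := by
    intro n x
    induction n with
    | zero => simp
    | succ k ih =>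
      have e : ((k + 1 + 1 : ℕ) : ℝ) * x = ((k + 1 : ℕ) : ℝ) * x + x := by push_cast; ring
      rw [e, pow_succ]
      exact (hsub _ _).trans (mul_le_mul_of_nonneg_right ih (by linarith [hone x]))
  have hnorm : ∀ s, ‖χ s‖ = Real.exp (z.re * s) := by
    intro s
    rw [hz, Complex.norm_exp]; simp
  have hkey : ∀ x, z.re * x ≤ Real.log (ω x) := by
    intro x
    by_contra! hlt
    set d := z.re * x - Real.log (ω x) with hd
    have hdpos : 0 < d := by linarith
    have hωx : 0 < ω x := by linarith [hone x]
    have hb : ∀ n : ℕ, Real.exp (((n + 1 : ℕ) : ℝ) * d) ≤ C := by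
      intro n
      have a1 := hC ((n + 1 : ℕ) * x)
      rw [hnorm] at a1
      have hCpos : 0 ≤ C := by
        have := hC 0
        rw [hnorm] at this
        by_contra! hneg
        have h3 := hone 0
        have h4 := Real.exp_pos (z.re * 0)
        nlinarith
      have a2 := a1.trans (mul_le_mul_of_nonneg_left (hpow n x) hCpos)
      have a3 : ω x ^ (n + 1) = Real.exp (((n + 1 : ℕ) : ℝ) * Real.log (ω x)) := by
        rw [Real.exp_nat_mul, Real.exp_log hωx]
      rw [a3] at a2
      have a4 : Real.exp (((n + 1 : ℕ) : ℝ) * d) * Real.exp (((n + 1 : ℕ) : ℝ) * Real.log (ω x))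
          = Real.exp (z.re * (((n + 1 : ℕ) : ℝ) * x)) := by
        rw [← Real.exp_add, hd]; congr 1; ring
      rw [← a4] at a2
      exact le_of_mul_le_mul_right a2 (Real.exp_pos _)
    obtain ⟨n, hn⟩ := exists_nat_gt (C / d)
    have h5 := hb n
    have h6 := Real.add_one_le_exp (((n + 1 : ℕ) : ℝ) * d)
    rw [div_lt_iff₀ hdpos] at hn
    push_cast at h5 h6
    nlinarith
  have hre : z.re = 0 := by
    apply le_antisymm
    · refine le_of_forall_pos_le_add fun ε hε => ?_
      obtain ⟨x, hx, hl⟩ := h2 ε hε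
      have := (hkey x).trans hl
      rw [zero_add]
      exact le_of_mul_le_mul_right this hx
    · refine le_of_forall_pos_le_add fun ε hε => ?_
      obtain ⟨x, hx, hl⟩ := h1 ε hε
      have := (hkey x).trans hl
      nlinarith
  refine ⟨z.im, fun s => ?_⟩
  rw [hz]
  congr 2
  apply Complex.ext <;> simp [hre]

lemma weight_nhds_aux {ω : ℝ → ℝ} (hω : IsWeightR ω) :
    ∃ C : ℝ, ∀ᶠ x in 𝓝 (0:ℝ), ω x ≤ C := by
  obtain ⟨hm, hone, hsub⟩ := hω
  let F : ℕ → Set ℝ := fun n => {x | ω x ≤ n ∧ ω (-x) ≤ n}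
  have hF : ∀ n, MeasurableSet (F n) := fun n =>
    (measurableSet_le hm measurable_const).inter
      (measurableSet_le (hm.comp measurable_neg) measurable_const)
  have hU : (⋃ n, F n) = Set.univ := by
    ext x
    simp only [Set.mem_iUnion, Set.mem_univ, iff_true]
    obtain ⟨n, hn⟩ := exists_nat_ge (max (ω x) (ω (-x)))
    exact ⟨n, (le_max_left _ _).trans hn, (le_max_right _ _).trans hn⟩
  obtain ⟨n, hn⟩ : ∃ n, 0 < volume (F n) := by
    by_contra! h
    have : volume (⋃ n, F n) = 0 := by
      rw [measure_iUnion_null_iff]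
      intro n
      exact le_antisymm (h n) bot_le
    rw [hU] at this
    simp at this
  have hst := Measure.sub_mem_nhds_zero_of_addHaar_pos volume (F n) (hF n) hn
  refine ⟨n * n, ?_⟩
  filter_upwards [hst] with x hx
  obtain ⟨a, ha, b, hb, rfl⟩ := Set.mem_sub.1 hx
  rw [sub_eq_add_neg]
  refine (hsub _ _).trans (mul_le_mul ha.1 hb.2 ?_ (Nat.cast_nonneg n))
  linarith [hone (-b)]

/-- the weighted measure -/
noncomputable def wm (ω : ℝ → ℝ) : Measure ℝ := volume.withDensity fun x => ENNReal.ofReal (ω x)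

lemma wm_locallyFinite {ω : ℝ → ℝ} (hω : IsWeightR ω) : IsLocallyFiniteMeasure (wm ω) := by
  constructor
  intro x
  obtain ⟨C, hC⟩ := weight_nhds_aux hω
  obtain ⟨hm, hone, hsub⟩ := hω
  have hev : ∀ᶠ y in 𝓝 x, ω y ≤ C * ω x := by
    have ht : Tendsto (fun y => y - x) (𝓝 x) (𝓝 0) := by
      have : Continuous fun y : ℝ => y - x := by fun_prop
      simpa using this.tendsto x
    filter_upwards [ht.eventually hC] with y hy
    have := hsub (y - x) x
    rw [sub_add_cancel] at this
    exact this.trans (mul_le_mul_of_nonneg_right hy (by linarith [hone x]))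
  obtain ⟨ε, hε, hball⟩ := Metric.eventually_nhds_iff_ball.1 hev
  refine ⟨Metric.ball x ε, Metric.ball_mem_nhds x hε, ?_⟩
  rw [wm, withDensity_apply _ measurableSet_ball]
  calc ∫⁻ a in Metric.ball x ε, ENNReal.ofReal (ω a)
      ≤ ∫⁻ a in Metric.ball x ε, ENNReal.ofReal (C * ω x) :=
        setLIntegral_mono measurable_const fun a ha => ENNReal.ofReal_le_ofReal (hball a ha)
    _ = ENNReal.ofReal (C * ω x) * volume (Metric.ball x ε) := by simp
    _ < ⊤ := ENNReal.mul_lt_top ENNReal.ofReal_lt_top measure_ball_lt_top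

lemma wm_ac {ω : ℝ → ℝ} (hω : IsWeightR ω) : volume ≪ wm ω := by
  apply withDensity_absolutelyContinuous'
  · exact hω.1.ennreal_ofReal.aemeasurable
  · refine Eventually.of_forall fun x => ?_
    have := hω.2.1 x
    simp; linarith

lemma wm_map_le {ω : ℝ → ℝ} (hω : IsWeightR ω) (s : ℝ) :
    (wm ω).map (fun x => x - s) ≤ ENNReal.ofReal (ω s) • wm ω := by
  obtain ⟨hm, hone, hsub⟩ := hω
  refine Measure.le_iff.2 fun B hB => ?_
  have hms : Measurable fun x : ℝ => x - s := by fun_prop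
  rw [Measure.map_apply hms hB, Measure.smul_apply, smul_eq_mul, wm,
    withDensity_apply _ (hms hB), withDensity_apply _ hB, ← lintegral_indicator (hms hB),
    ← lintegral_indicator hB, ← lintegral_const_mul _ (hm.ennreal_ofReal.indicator hB),
    ← lintegral_add_right_eq_self _ s]
  refine lintegral_mono fun x => ?_
  by_cases hx : x ∈ B
  · have hx' : x + s ∈ (fun x => x - s) ⁻¹' B := by simpa using hx
    rw [Set.indicator_of_mem hx', Set.indicator_of_mem hx, ← ENNReal.ofReal_mul (by linarith [hone s])]
    exact ENNReal.ofReal_le_ofReal ((hsub x s).trans (by rw [mul_comm]))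
  · have hx' : x + s ∉ (fun x => x - s) ⁻¹' B := by simpa using hx
    rw [Set.indicator_of_notMem hx']
    exact bot_le

lemma wm_integrable_iff {F : Type*} [NormedAddCommGroup F] {ω : ℝ → ℝ} (hω : IsWeightR ω)
    {g : ℝ → F} (hg : StronglyMeasurable g) :
    Integrable g (wm ω) ↔ Integrable fun x => ‖g x‖ * ω x := by
  rw [← integrable_norm_iff hg.aestronglyMeasurable, wm,
    integrable_withDensity_iff hω.1.ennreal_ofReal (Eventually.of_forall fun x => ENNReal.ofReal_lt_top)]
  have : ∀ x, (ENNReal.ofReal (ω x)).toReal = ω x := fun x =>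
    ENNReal.toReal_ofReal (by linarith [hω.2.1 x])
  simp_rw [this]

lemma wm_integral_norm {F : Type*} [NormedAddCommGroup F] {ω : ℝ → ℝ} (hω : IsWeightR ω)
    (g : ℝ → F) : ∫ x, ‖g x‖ ∂(wm ω) = ∫ x, ‖g x‖ * ω x := by
  rw [wm, integral_withDensity_eq_integral_toReal_smul hω.1.ennreal_ofReal
    (Eventually.of_forall fun x => ENNReal.ofReal_lt_top)]
  have : ∀ x, (ENNReal.ofReal (ω x)).toReal = ω x := fun x =>
    ENNReal.toReal_ofReal (by linarith [hω.2.1 x])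
  simp_rw [this, smul_eq_mul, mul_comm]

set_option linter.unusedSectionVars false

section WeightedOps

variable {A : Type*} [NormedRing A] [NormedAlgebra ℂ A] [CompleteSpace A] [NormOneClass A]
  {ω : ℝ → ℝ}

lemma shift_qmp (hω : IsWeightR ω) (s : ℝ) :
    Measure.QuasiMeasurePreserving (fun x : ℝ => x - s) (wm ω) (wm ω) :=
  ⟨by fun_prop, Measure.absolutelyContinuous_of_le_smul (wm_map_le hω s)⟩

lemma shift_integrable_map (hω : IsWeightR ω) (s : ℝ) {h : ℝ → A} (hh : Integrable h (wm ω)) :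
    Integrable h ((wm ω).map fun x => x - s) :=
  (hh.smul_measure ENNReal.ofReal_ne_top).mono_measure (wm_map_le hω s)

lemma shift_integrable (hω : IsWeightR ω) (s : ℝ) {h : ℝ → A} (hh : Integrable h (wm ω)) :
    Integrable (fun x => h (x - s)) (wm ω) :=
  (shift_integrable_map hω s hh).comp_measurable (by fun_prop)

lemma shift_norm (hω : IsWeightR ω) (s : ℝ) {h : ℝ → A} (hh : Integrable h (wm ω)) :
    ∫ x, ‖h (x - s)‖ ∂(wm ω) ≤ ω s * ∫ x, ‖h x‖ ∂(wm ω) := by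
  have hm : Measurable fun x : ℝ => x - s := by fun_prop
  have e : ∫ x, ‖h (x - s)‖ ∂(wm ω) = ∫ x, ‖h x‖ ∂((wm ω).map fun x => x - s) :=
    (integral_map hm.aemeasurable (shift_integrable_map hω s hh).norm.aestronglyMeasurable).symm
  rw [e]
  refine (integral_mono_measure (wm_map_le hω s) (Eventually.of_forall fun x => norm_nonneg _)
    (hh.norm.smul_measure ENNReal.ofReal_ne_top)).trans ?_
  rw [integral_smul_measure, ENNReal.toReal_ofReal (by linarith [hω.2.1 s]), smul_eq_mul]

/-- translation, as a bare function -/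
noncomputable def wtauFun (hω : IsWeightR ω) (s : ℝ) (h : Lp A 1 (wm ω)) : Lp A 1 (wm ω) :=
  (shift_integrable hω s (L1.integrable_coeFn h)).toL1 (fun x => h (x - s))

lemma wtauFun_coe (hω : IsWeightR ω) (s : ℝ) (h : Lp A 1 (wm ω)) :
    wtauFun hω s h =ᵐ[wm ω] fun x => h (x - s) :=
  Integrable.coeFn_toL1 _

lemma wtauFun_norm (hω : IsWeightR ω) (s : ℝ) (h : Lp A 1 (wm ω)) :
    ‖wtauFun hω s h‖ ≤ ω s * ‖h‖ := by
  rw [wtauFun, L1.norm_of_fun_eq_integral_norm, L1.norm_eq_integral_norm]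
  exact shift_norm hω s (L1.integrable_coeFn h)

lemma wtauFun_add (hω : IsWeightR ω) (s : ℝ) (g h : Lp A 1 (wm ω)) :
    wtauFun hω s (g + h) = wtauFun hω s g + wtauFun hω s h := by
  apply Lp.ext
  filter_upwards [wtauFun_coe hω s (g + h), wtauFun_coe hω s g, wtauFun_coe hω s h,
    Lp.coeFn_add (wtauFun hω s g) (wtauFun hω s h),
    (shift_qmp hω s).ae_eq_comp (Lp.coeFn_add g h)] with x h1 h2 h3 h4 h5
  simp only [Function.comp, Pi.add_apply] at h5
  rw [h1, h4, Pi.add_apply, h2, h3, h5]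

lemma wtauFun_smul (hω : IsWeightR ω) (s : ℝ) (c : ℂ) (h : Lp A 1 (wm ω)) :
    wtauFun hω s (c • h) = c • wtauFun hω s h := by
  apply Lp.ext
  filter_upwards [wtauFun_coe hω s (c • h), wtauFun_coe hω s h,
    Lp.coeFn_smul c (wtauFun hω s h),
    (shift_qmp hω s).ae_eq_comp (Lp.coeFn_smul c h)] with x h1 h2 h3 h4
  simp only [Function.comp, Pi.smul_apply] at h4
  rw [h1, h3, Pi.smul_apply, h2, h4]

/-- translation operator -/
noncomputable def wtau (A : Type*) [NormedRing A] [NormedAlgebra ℂ A] [CompleteSpace A]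
    [NormOneClass A] (hω : IsWeightR ω) (s : ℝ) :
    Lp A 1 (wm ω) →L[ℂ] Lp A 1 (wm ω) :=
  LinearMap.mkContinuous
    { toFun := wtauFun hω s
      map_add' := wtauFun_add hω s
      map_smul' := wtauFun_smul hω s }
    (ω s) (wtauFun_norm hω s)

lemma wtau_coe (hω : IsWeightR ω) (s : ℝ) (h : Lp A 1 (wm ω)) :
    wtau A hω s h =ᵐ[wm ω] fun x => h (x - s) :=
  wtauFun_coe hω s h

lemma wtau_norm (hω : IsWeightR ω) (s : ℝ) (h : Lp A 1 (wm ω)) :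
    ‖wtau A hω s h‖ ≤ ω s * ‖h‖ :=
  wtauFun_norm hω s h

lemma wtau_zero (hω : IsWeightR ω) (h : Lp A 1 (wm ω)) : wtau A hω 0 h = h := by
  apply Lp.ext
  filter_upwards [wtau_coe hω 0 h] with x hx
  rw [hx, sub_zero]

lemma wtau_add (hω : IsWeightR ω) (s t : ℝ) (h : Lp A 1 (wm ω)) :
    wtau A hω (s + t) h = wtau A hω s (wtau A hω t h) := by
  apply Lp.ext
  filter_upwards [wtau_coe hω (s + t) h, wtau_coe hω s (wtau A hω t h),
    (shift_qmp hω s).ae_eq_comp (wtau_coe hω t h)] with x h1 h2 h3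
  rw [h1, h2]
  simp only [Function.comp] at h3
  rw [h3, sub_sub]

lemma wtau_tendsto_zero (hω : IsWeightR ω) (h : Lp A 1 (wm ω)) :
    Tendsto (fun s => wtau A hω s h) (𝓝 0) (𝓝 h) := by
  have := wm_locallyFinite hω
  obtain ⟨C, hC⟩ := weight_nhds_aux hω
  have hC1 : 1 ≤ C := (hω.2.1 0).trans hC.self_of_nhds
  rw [Metric.tendsto_nhds]
  intro ε hε
  set η := ε / (2 * (C + 1)) with hη
  have hηpos : 0 < η := by positivity
  obtain ⟨k, hksupp, hkint, hkc, hki⟩ :=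
    (L1.integrable_coeFn h).exists_hasCompactSupport_integral_sub_le hηpos
  obtain ⟨R, hR⟩ := hksupp.isCompact.isBounded.subset_closedBall 0
  have hfin : (wm ω) (Metric.closedBall 0 (R + 1)) < ⊤ :=
    (isCompact_closedBall 0 (R + 1)).measure_lt_top
  set V := (wm ω).real (Metric.closedBall 0 (R + 1)) with hV
  have hVnn : 0 ≤ V := measureReal_nonneg
  have huc := hksupp.uniformContinuous_of_continuous hkc
  obtain ⟨δ, hδ, hδk⟩ := Metric.uniformContinuous_iff.1 huc (ε / (4 * (V + 1))) (by positivity)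
  filter_upwards [hC, Metric.ball_mem_nhds (0:ℝ) hδ, Metric.ball_mem_nhds (0:ℝ) one_pos]
    with s hs1 hs2 hs3
  simp only [Metric.mem_ball, dist_zero_right, Real.norm_eq_abs] at hs2 hs3
  let K : Lp A 1 (wm ω) := hki.toL1 k
  have hhK : ‖h - K‖ ≤ η := by
    rw [L1.norm_eq_integral_norm]
    refine le_of_eq_of_le (integral_congr_ae ?_) hkint
    filter_upwards [Lp.coeFn_sub h K, hki.coeFn_toL1] with x h1 h2
    rw [h1, Pi.sub_apply, h2]
  have hKs : ‖wtau A hω s K - K‖ ≤ ε / 4 := by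
    rw [L1.norm_eq_integral_norm]
    have e : ∫ x, ‖(wtau A hω s K - K : Lp A 1 (wm ω)) x‖ ∂(wm ω)
        = ∫ x, ‖k (x - s) - k x‖ ∂(wm ω) := by
      apply integral_congr_ae
      filter_upwards [Lp.coeFn_sub (wtau A hω s K) K, hki.coeFn_toL1, wtau_coe hω s K,
        (shift_qmp hω s).ae_eq_comp hki.coeFn_toL1] with x h1 h2 h3 h4
      simp only [Function.comp] at h4
      rw [h1, Pi.sub_apply, h2, h3, h4]
    rw [e]
    have hb : ∀ x, ‖k (x - s) - k x‖ ≤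
        (Metric.closedBall (0:ℝ) (R + 1)).indicator (fun _ => ε / (4 * (V + 1))) x := by
      intro x
      by_cases hx : x ∈ Metric.closedBall (0:ℝ) (R + 1)
      · rw [Set.indicator_of_mem hx, ← dist_eq_norm]
        refine (hδk ?_).le
        rw [Real.dist_eq]
        simpa using hs2
      · rw [Set.indicator_of_notMem hx]
        simp only [Metric.mem_closedBall, dist_zero_right, Real.norm_eq_abs, not_le] at hx
        have z1 : k x = 0 := by
          by_contra hne
          have := hR (subset_tsupport _ hne)
          simp only [Metric.mem_closedBall, dist_zero_right, Real.norm_eq_abs] at this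
          linarith
        have z2 : k (x - s) = 0 := by
          by_contra hne
          have := hR (subset_tsupport _ hne)
          simp only [Metric.mem_closedBall, dist_zero_right, Real.norm_eq_abs] at this
          have := abs_sub_abs_le_abs_sub x s
          linarith
        simp [z1, z2]
    have hind : Integrable ((Metric.closedBall (0:ℝ) (R + 1)).indicator
        (fun _ => ε / (4 * (V + 1)))) (wm ω) :=
      (integrable_indicator_iff measurableSet_closedBall).2 (integrableOn_const hfin.ne)
    refine (integral_mono_of_nonneg (Eventually.of_forall fun x => norm_nonneg _) hind
      (Eventually.of_forall hb)).trans ?_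
    rw [integral_indicator measurableSet_closedBall, setIntegral_const, ← hV, smul_eq_mul,
      mul_div_assoc', div_le_div_iff₀ (by positivity) (by norm_num)]
    nlinarith
  rw [dist_eq_norm]
  have e : wtau A hω s h - h = wtau A hω s (h - K) + (wtau A hω s K - K) - (h - K) := by
    rw [map_sub]; abel
  rw [e]
  have n1 : ‖wtau A hω s (h - K)‖ ≤ C * η :=
    (wtau_norm hω s _).trans (mul_le_mul hs1 hhK (norm_nonneg _) (by linarith))
  have n2 := norm_sub_le (wtau A hω s (h - K) + (wtau A hω s K - K)) (h - K)
  have n3 := norm_add_le (wtau A hω s (h - K)) (wtau A hω s K - K)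
  have n4 : (C + 1) * η = ε / 2 := by rw [hη]; field_simp
  linarith

lemma wtau_continuous (hω : IsWeightR ω) (h : Lp A 1 (wm ω)) :
    Continuous fun s => wtau A hω s h := by
  rw [continuous_iff_continuousAt]
  intro s
  have h1 : Tendsto (fun t => t - s) (𝓝 s) (𝓝 0) := by
    have : Continuous fun y : ℝ => y - s := by fun_prop
    simpa using this.tendsto s
  have h2 := ((wtau A hω s).continuous.tendsto h).comp ((wtau_tendsto_zero hω h).comp h1)
  refine h2.congr fun t => ?_
  simp only [Function.comp]
  rw [← wtau_add]
  congr 2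
  ring

/-- left multiplication -/
noncomputable def wl (A : Type*) [NormedRing A] [NormedAlgebra ℂ A] (ω : ℝ → ℝ) :
    A →L[ℂ] Lp A 1 (wm ω) →L[ℂ] Lp A 1 (wm ω) :=
  (ContinuousLinearMap.mul ℂ A).compLpL₂ 1 (wm ω)

lemma wl_coe (a : A) (h : Lp A 1 (wm ω)) : wl A ω a h =ᵐ[wm ω] fun x => a * h x :=
  ContinuousLinearMap.coeFn_compLp' (ContinuousLinearMap.mul ℂ A a) h

lemma wl_norm (a : A) (h : Lp A 1 (wm ω)) : ‖wl A ω a h‖ ≤ ‖a‖ * ‖h‖ := by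
  refine (ContinuousLinearMap.norm_compLp_le (ContinuousLinearMap.mul ℂ A a) h).trans ?_
  gcongr
  exact ContinuousLinearMap.opNorm_mul_apply_le ℂ A a

lemma wl_mul (a b : A) (h : Lp A 1 (wm ω)) : wl A ω (a * b) h = wl A ω a (wl A ω b h) := by
  apply Lp.ext
  filter_upwards [wl_coe (a * b) h, wl_coe a (wl A ω b h), wl_coe b h] with x h1 h2 h3
  rw [h1, h2, h3, mul_assoc]

lemma wl_one (h : Lp A 1 (wm ω)) : wl A ω 1 h = h := by
  apply Lp.ext
  filter_upwards [wl_coe 1 h] with x h1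
  rw [h1, one_mul]

lemma wl_wtau (hω : IsWeightR ω) (a : A) (s : ℝ) (h : Lp A 1 (wm ω)) :
    wtau A hω s (wl A ω a h) = wl A ω a (wtau A hω s h) := by
  apply Lp.ext
  filter_upwards [wtau_coe hω s (wl A ω a h), wl_coe a (wtau A hω s h), wtau_coe hω s h,
    (shift_qmp hω s).ae_eq_comp (wl_coe a h)] with x h1 h2 h3 h4
  simp only [Function.comp] at h4
  rw [h1, h2, h3, h4]

lemma wcv_integrable (hω : IsWeightR ω) (g h : Lp A 1 (wm ω)) :
    Integrable (fun s => wl A ω (g s) (wtau A hω s h)) ∧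
      ∀ s, ‖wl A ω (g s) (wtau A hω s h)‖ ≤ (‖g s‖ * ω s) * ‖h‖ := by
  have hb : ∀ s, ‖wl A ω (g s) (wtau A hω s h)‖ ≤ (‖g s‖ * ω s) * ‖h‖ := fun s => by
    refine (wl_norm _ _).trans ?_
    rw [mul_assoc]
    exact mul_le_mul_of_nonneg_left (wtau_norm hω s h) (norm_nonneg _)
  refine ⟨?_, hb⟩
  have hgi := (wm_integrable_iff hω (Lp.stronglyMeasurable g)).1 (L1.integrable_coeFn g)
  refine (hgi.mul_const ‖h‖).mono' ?_ (Eventually.of_forall hb)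
  have h1 : StronglyMeasurable fun s => wl A ω (g s) :=
    (wl A ω).continuous.comp_stronglyMeasurable (Lp.stronglyMeasurable g)
  have h2 : StronglyMeasurable fun s => wtau A hω s h :=
    (wtau_continuous hω h).stronglyMeasurable
  exact (isBoundedBilinearMap_apply.continuous.comp_stronglyMeasurable
    (h1.prodMk h2)).aestronglyMeasurable

/-- convolution -/
noncomputable def wcv (A : Type*) [NormedRing A] [NormedAlgebra ℂ A] [CompleteSpace A]
    [NormOneClass A] (hω : IsWeightR ω) :
    Lp A 1 (wm ω) →L[ℂ] Lp A 1 (wm ω) →L[ℂ] Lp A 1 (wm ω) :=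
  LinearMap.mkContinuous₂
    (LinearMap.mk₂ ℂ (fun g h => ∫ s, wl A ω (g s) (wtau A hω s h))
      (fun g g' h => by
        rw [← integral_add (wcv_integrable hω g h).1 (wcv_integrable hω g' h).1]
        apply integral_congr_ae
        filter_upwards [(wm_ac hω).ae_le (Lp.coeFn_add g g')] with s hs
        rw [hs]; simp)
      (fun c g h => by
        rw [← integral_smul]
        apply integral_congr_ae
        filter_upwards [(wm_ac hω).ae_le (Lp.coeFn_smul c g)] with s hs
        rw [hs]; simp)
      (fun g h h' => by
        rw [← integral_add (wcv_integrable hω g h).1 (wcv_integrable hω g h').1]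
        simp)
      (fun c g h => by
        rw [← integral_smul]
        simp))
    1 (fun g h => by
      simp only [LinearMap.mk₂_apply]
      refine (norm_integral_le_of_norm_le (((wm_integrable_iff hω
        (Lp.stronglyMeasurable g)).1 (L1.integrable_coeFn g)).mul_const ‖h‖)
        (Eventually.of_forall (wcv_integrable hω g h).2)).trans ?_
      rw [integral_mul_const, ← wm_integral_norm hω, ← L1.norm_eq_integral_norm, one_mul])

lemma wcv_apply (hω : IsWeightR ω) (g h : Lp A 1 (wm ω)) :
    wcv A hω g h = ∫ s, wl A ω (g s) (wtau A hω s h) := rfl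

lemma wcv_norm (hω : IsWeightR ω) (g h : Lp A 1 (wm ω)) : ‖wcv A hω g h‖ ≤ ‖g‖ * ‖h‖ := by
  rw [wcv_apply]
  refine (norm_integral_le_of_norm_le (((wm_integrable_iff hω
    (Lp.stronglyMeasurable g)).1 (L1.integrable_coeFn g)).mul_const ‖h‖)
    (Eventually.of_forall (wcv_integrable hω g h).2)).trans ?_
  rw [integral_mul_const, ← wm_integral_norm hω, ← L1.norm_eq_integral_norm]

lemma wcv_wl (hω : IsWeightR ω) (a : A) (g h : Lp A 1 (wm ω)) :
    wcv A hω (wl A ω a g) h = wl A ω a (wcv A hω g h) := by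
  rw [wcv_apply, wcv_apply, ← ContinuousLinearMap.integral_comp_comm _ (wcv_integrable hω g h).1]
  apply integral_congr_ae
  filter_upwards [(wm_ac hω).ae_le (wl_coe a g)] with s hs
  rw [hs, wl_mul]

lemma wcv_wtau (hω : IsWeightR ω) (t : ℝ) (g h : Lp A 1 (wm ω)) :
    wcv A hω (wtau A hω t g) h = wtau A hω t (wcv A hω g h) := by
  rw [wcv_apply, wcv_apply, ← ContinuousLinearMap.integral_comp_comm _ (wcv_integrable hω g h).1,
    ← integral_sub_right_eq_self (fun s => wtau A hω t (wl A ω (g s) (wtau A hω s h))) t]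
  apply integral_congr_ae
  filter_upwards [(wm_ac hω).ae_le (wtau_coe hω t g)] with s hs
  rw [hs, wl_wtau, ← wtau_add]
  congr 3
  ring

lemma wcv_wtau_right (hω : IsWeightR ω) (t : ℝ) (g h : Lp A 1 (wm ω)) :
    wcv A hω g (wtau A hω t h) = wtau A hω t (wcv A hω g h) := by
  rw [wcv_apply, wcv_apply, ← ContinuousLinearMap.integral_comp_comm _ (wcv_integrable hω g h).1]
  congr 1
  ext1 s
  rw [wl_wtau, ← wtau_add, ← wtau_add, add_comm]

lemma wcv_assoc (hω : IsWeightR ω) (g h k : Lp A 1 (wm ω)) :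
    wcv A hω (wcv A hω g h) k = wcv A hω g (wcv A hω h k) := by
  have e : wcv A hω (wcv A hω g h) k = (wcv A hω).flip k (wcv A hω g h) := rfl
  rw [e, wcv_apply hω g h, wcv_apply hω g,
    ← ContinuousLinearMap.integral_comp_comm _ (wcv_integrable hω g h).1]
  congr 1
  ext1 s
  rw [ContinuousLinearMap.flip_apply, wcv_wl, wcv_wtau]

lemma wcv_coe (hω : IsWeightR ω) (g h : Lp A 1 (wm ω)) :
    wcv A hω g h =ᵐ[wm ω] fun x => ∫ s, g s * h (x - s) := by
  have := wm_locallyFinite hω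
  have hsm : StronglyMeasurable (fun p : ℝ × ℝ => g p.1 * h (p.2 - p.1)) :=
    ((Lp.stronglyMeasurable g).comp_measurable measurable_fst).mul
      ((Lp.stronglyMeasurable h).comp_measurable (by fun_prop))
  have hInteg : Integrable (fun p : ℝ × ℝ => g p.1 * h (p.2 - p.1)) (volume.prod (wm ω)) := by
    rw [integrable_prod_iff hsm.aestronglyMeasurable]
    constructor
    · refine Eventually.of_forall fun s => ?_
      exact (shift_integrable hω s (L1.integrable_coeFn h)).const_mul (g s)
    · have hgi := (wm_integrable_iff hω (Lp.stronglyMeasurable g)).1 (L1.integrable_coeFn g)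
      refine (hgi.mul_const (∫ x, ‖h x‖ ∂(wm ω))).mono'
        hsm.norm.integral_prod_right.aestronglyMeasurable (Eventually.of_forall fun s => ?_)
      rw [Real.norm_of_nonneg (integral_nonneg fun _ => norm_nonneg _)]
      have hsi := shift_integrable hω s (L1.integrable_coeFn h)
      calc ∫ x, ‖g s * h (x - s)‖ ∂(wm ω) ≤ ∫ x, ‖g s‖ * ‖h (x - s)‖ ∂(wm ω) :=
            integral_mono (hsi.const_mul (g s)).norm (hsi.norm.const_mul _)
              (fun x => norm_mul_le _ _)
        _ = ‖g s‖ * ∫ x, ‖h (x - s)‖ ∂(wm ω) := integral_const_mul _ _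
        _ ≤ ‖g s‖ * (ω s * ∫ x, ‖h x‖ ∂(wm ω)) :=
            mul_le_mul_of_nonneg_left (shift_norm hω s (L1.integrable_coeFn h)) (norm_nonneg _)
        _ = _ := by ring
  apply Integrable.ae_eq_of_forall_setIntegral_eq _ _ (L1.integrable_coeFn _)
  · exact hInteg.integral_prod_right
  · intro B hB hBf
    let Φ : Lp A 1 (wm ω) →L[ℝ] A :=
      LinearMap.mkContinuous
        { toFun := fun k => ∫ x in B, k x ∂(wm ω)
          map_add' := fun k k' => by
            rw [← integral_add (L1.integrable_coeFn k).integrableOn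
              (L1.integrable_coeFn k').integrableOn]
            exact setIntegral_congr_ae hB ((Lp.coeFn_add k k').mono fun x hx _ => hx)
          map_smul' := fun c k => by
            rw [RingHom.id_apply, ← integral_smul]
            exact setIntegral_congr_ae hB ((Lp.coeFn_smul c k).mono fun x hx _ => hx) }
        1 (fun k => by
          simp only [LinearMap.coe_mk, AddHom.coe_mk]
          rw [one_mul, L1.norm_eq_integral_norm]
          refine (norm_integral_le_integral_norm _).trans ?_
          exact setIntegral_le_integral (L1.integrable_coeFn k).norm
            (Eventually.of_forall fun x => norm_nonneg _))
    have hΦ : ∀ k : Lp A 1 (wm ω), Φ k = ∫ x in B, k x ∂(wm ω) := fun k => rfl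
    rw [← hΦ, wcv_apply, ← ContinuousLinearMap.integral_comp_comm _ (wcv_integrable hω g h).1]
    have e1 : ∀ s, Φ (wl A ω (g s) (wtau A hω s h)) = ∫ x in B, g s * h (x - s) ∂(wm ω) := by
      intro s
      rw [hΦ]
      refine setIntegral_congr_ae hB ?_
      filter_upwards [wl_coe (g s) (wtau A hω s h), wtau_coe hω s h] with x h1 h2 _
      rw [h1, h2]
    simp_rw [e1]
    rw [integral_integral_swap]
    have : Integrable (fun p : ℝ × ℝ => g p.1 * h (p.2 - p.1))
        (volume.prod ((wm ω).restrict B)) := by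
      refine hInteg.mono_measure ?_
      exact Measure.prod_mono le_rfl Measure.restrict_le_self
    exact this

end WeightedOps

lemma main_aux {A : Type*} [NormedRing A] [NormedAlgebra ℂ A] [CompleteSpace A] [NormOneClass A]
    (ω : ℝ → ℝ) (hω : IsWeightR ω)
    (h2 : ∀ ε > 0, ∃ x > 0, Real.log (ω x) ≤ ε * x)
    (h1 : ∀ ε > 0, ∃ x < 0, Real.log (ω x) ≤ -(ε * x))
    (f : ℝ → A) (hfm : StronglyMeasurable f)
    (hfi : Integrable fun x => ‖f x‖ * ω x)
    (hinv : ∀ t : ℝ, ∃ u : A,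
      u * (1 + ∫ x : ℝ, Complex.exp (Complex.I * (t : ℂ) * (x : ℂ)) • f x) = 1) :
    ∃ g : ℝ → A, StronglyMeasurable g ∧ (Integrable fun x => ‖g x‖ * ω x) ∧
        ∀ᵐ x : ℝ, f x + g x + (∫ t : ℝ, g (x - t) * f t) = 0 := by
  have hfμ : Integrable f (wm ω) := (wm_integrable_iff hω hfm).2 hfi
  set F : Lp A 1 (wm ω) := hfμ.toL1 f with hF
  have hFf : ∀ᵐ x, F x = f x := (wm_ac hω).ae_le hfμ.coeFn_toL1
  by_cases hex : ∃ g, g + wcv A hω g F = F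
  · obtain ⟨g, hg⟩ := hex
    set G := -g with hG
    have hGF : F + G + wcv A hω G F = 0 := by
      rw [hG, map_neg, ContinuousLinearMap.neg_apply]
      nth_rewrite 1 [← hg]
      abel
    refine ⟨G, Lp.stronglyMeasurable G,
      (wm_integrable_iff hω (Lp.stronglyMeasurable G)).1 (L1.integrable_coeFn G), ?_⟩
    have e0 : ((F + G + wcv A hω G F : Lp A 1 (wm ω)) : ℝ → A) =ᵐ[wm ω] 0 := by
      rw [hGF]; exact Lp.coeFn_zero _ _ _
    filter_upwards [hFf, (wm_ac hω).ae_le e0,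
      (wm_ac hω).ae_le (Lp.coeFn_add (F + G) (wcv A hω G F)),
      (wm_ac hω).ae_le (Lp.coeFn_add F G), (wm_ac hω).ae_le (wcv_coe hω G F)] with x a1 a2 a3 a4 a5
    have e1 : ∫ t : ℝ, G (x - t) * f t = ∫ s, G s * F (x - s) := by
      rw [← integral_sub_left_eq_self (fun s => G s * F (x - s)) volume x]
      apply integral_congr_ae
      filter_upwards [hFf] with t ht
      rw [sub_sub_cancel, ht]
    rw [e1, ← a5, ← a1]
    rw [a3, Pi.add_apply, a4, Pi.add_apply] at a2
    exact a2
  · exfalso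
    let S : Set (Lp A 1 (wm ω) →L[ℂ] Lp A 1 (wm ω)) :=
      Set.range (wtau A hω) ∪ Set.range (wl A ω) ∪ Set.range (wcv A hω)
    have hτS : ∀ s, wtau A hω s ∈ S := fun s => Or.inl (Or.inl ⟨s, rfl⟩)
    have hlS : ∀ a, wl A ω a ∈ S := fun a => Or.inl (Or.inr ⟨a, rfl⟩)
    have hcS : ∀ g, wcv A hω g ∈ S := fun g => Or.inr ⟨g, rfl⟩
    obtain ⟨L, hLc, hFL, hJL, hSL, hschur⟩ := schur_aux S (wcv A hω) (wcv_norm hω) hcS F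
      (by
        rintro P ((⟨s, rfl⟩ | ⟨a, rfl⟩) | ⟨k, rfl⟩) g
        · exact (wcv_wtau hω s g F).symm
        · exact (wcv_wl hω a g F).symm
        · exact (wcv_assoc hω k g F).symm) hex
    have hχ : ∀ s, ∃ c : ℂ, ∀ h, wtau A hω s h - c • h ∈ L := by
      intro s
      refine hschur _ (hτS s) ?_
      rintro P ((⟨t, rfl⟩ | ⟨a, rfl⟩) | ⟨k, rfl⟩) x
      · rw [← wtau_add, ← wtau_add, add_comm]
      · exact wl_wtau hω a s x
      · exact (wcv_wtau_right hω s k x).symm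
    choose χ hχ using hχ
    let mk : Lp A 1 (wm ω) →L[ℂ] (Lp A 1 (wm ω) ⧸ L) := L.mkQL
    have hmk0 : ∀ x, mk x = 0 ↔ x ∈ L := fun x => by simp [mk]
    have hχmk : ∀ s h, mk (wtau A hω s h) = χ s • mk h := by
      intro s h
      rw [← sub_eq_zero, ← map_smul, ← map_sub, hmk0]
      exact hχ s h
    have hF0 : mk F ≠ 0 := fun h => hFL ((hmk0 F).1 h)
    have hχ0 : χ 0 = 1 := by
      have := hχmk 0 F
      rw [wtau_zero] at this
      have h3 : (χ 0 - 1) • mk F = 0 := by rw [sub_smul, one_smul, ← this, sub_self]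
      exact sub_eq_zero.1 ((smul_eq_zero.1 h3).resolve_right hF0)
    have hχadd : ∀ s t, χ (s + t) = χ s * χ t := by
      intro s t
      have := hχmk (s + t) F
      rw [wtau_add, hχmk, hχmk, smul_smul] at this
      exact (smul_left_injective ℂ hF0 this).symm
    have hnF : 0 < ‖mk F‖ := norm_pos_iff.2 hF0
    have hχc : Continuous χ := by
      obtain ⟨φ, -, hφ⟩ := exists_dual_vector ℂ (mk F) hnF.ne'
      have h3 : Continuous fun s => φ (mk (wtau A hω s F)) :=
        φ.continuous.comp (mk.continuous.comp (wtau_continuous hω F))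
      have h4 : χ = fun s => φ (mk (wtau A hω s F)) / ((‖mk F‖ : ℝ) : ℂ) := by
        ext s
        rw [hχmk, map_smul, hφ, smul_eq_mul]
        have : ((‖mk F‖ : ℝ) : ℂ) ≠ 0 := by exact_mod_cast hnF.ne'
        field_simp
        rfl
      rw [h4]
      exact h3.div_const _
    obtain ⟨z, hz⟩ := char_aux χ hχc hχ0 hχadd
    obtain ⟨t, ht⟩ := char_bound_aux ω χ z hz hω (‖F‖ / ‖mk F‖) (by
      intro s
      have e1 : ‖χ s‖ * ‖mk F‖ ≤ ω s * ‖F‖ := by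
        rw [← norm_smul, ← hχmk]
        exact (Submodule.Quotient.norm_mk_le (S := L) (wtau A hω s F)).trans (wtau_norm hω s F)
      rw [div_mul_eq_mul_div, le_div_iff₀ hnF, mul_comm ‖F‖]
      exact e1) h2 h1
    obtain ⟨u, hu⟩ := hinv t
    set v := ∫ x : ℝ, Complex.exp (Complex.I * (t : ℂ) * (x : ℂ)) • f x with hv
    have hfvol : Integrable f := by
      refine hfi.mono' hfm.aestronglyMeasurable (Eventually.of_forall fun x => ?_)
      have := hω.2.1 x
      nlinarith [norm_nonneg (f x)]
    have hvi : Integrable fun x : ℝ => Complex.exp (Complex.I * (t : ℂ) * (x : ℂ)) • f x := by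
      refine hfvol.norm.mono' ?_ (Eventually.of_forall fun x => ?_)
      · have : Continuous fun x : ℝ => Complex.exp (Complex.I * (t : ℂ) * (x : ℂ)) := by fun_prop
        exact this.aestronglyMeasurable.smul hfm.aestronglyMeasurable
      · rw [norm_smul, Complex.norm_exp]
        simp
    have hconv : mk (wcv A hω F F) = mk (wl A ω v F) := by
      have e1 : mk (wl A ω v F) = (mk ∘L (wl A ω).flip F) v := rfl
      rw [e1, hv, ← ContinuousLinearMap.integral_comp_comm _ hvi, wcv_apply,
        ← ContinuousLinearMap.integral_comp_comm _ (wcv_integrable hω F F).1]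
      apply integral_congr_ae
      filter_upwards [hFf] with s hs
      rw [hs, ← wl_wtau, hχmk, ← ht]
      simp
    have hfin : wl A ω (1 + v) F ∈ L := by
      rw [← hmk0, map_add, ContinuousLinearMap.add_apply, wl_one, map_add, ← hconv, ← map_add, hmk0]
      exact hJL F
    have := hSL _ (hlS u) _ hfin
    rw [← wl_mul, hu, wl_one] at this
    exact hFL this

lemma adm_aux {ω : ℝ → ℝ} (hω : IsWeightR ω) (hadm : IsAdmissibleR ω) :
    (∀ ε > 0, ∃ x > 0, Real.log (ω x) ≤ ε * x) ∧
    (∀ ε > 0, ∃ x < 0, Real.log (ω x) ≤ -(ε * x)) := by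
  obtain ⟨hr1, hr2⟩ := hadm
  constructor
  · intro ε hε
    have hne : {r : ℝ | ∃ x : ℝ, 0 < x ∧ r = Real.log (ω x) / x}.Nonempty := ⟨_, 1, one_pos, rfl⟩
    obtain ⟨_, ⟨x, hx, rfl⟩, hlt⟩ := exists_lt_of_csInf_lt hne (lt_of_eq_of_lt hr2 hε)
    exact ⟨x, hx, ((div_lt_iff₀ hx).1 hlt).le⟩
  · intro ε hε
    have hne : {r : ℝ | ∃ x : ℝ, x < 0 ∧ r = Real.log (ω x) / x}.Nonempty :=
      ⟨_, -1, by norm_num, rfl⟩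
    obtain ⟨_, ⟨x, hx, rfl⟩, hlt⟩ := exists_lt_of_lt_csSup hne
      (lt_of_lt_of_eq (neg_lt_zero.2 hε) hr1.symm)
    refine ⟨x, hx, ?_⟩
    rw [lt_div_iff_of_neg hx] at hlt
    linarith

lemma min_aux {ω : ℝ → ℝ} (hω : IsWeightR ω) (K : ℝ) (hK : 1 ≤ K) :
    IsWeightR (fun x => min (ω x) K) ∧
    (∀ ε > 0, ∃ x > 0, Real.log (min (ω x) K) ≤ ε * x) ∧
    (∀ ε > 0, ∃ x < 0, Real.log (min (ω x) K) ≤ -(ε * x)) := by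
  obtain ⟨hm, hone, hsub⟩ := hω
  have hlog : ∀ x, Real.log (min (ω x) K) ≤ Real.log K := fun x =>
    Real.log_le_log (lt_min (by linarith [hone x]) (by linarith)) (min_le_right _ _)
  have hlK : 0 ≤ Real.log K := Real.log_nonneg hK
  refine ⟨⟨hm.min measurable_const, fun x => le_min (hone x) hK, ?_⟩, ?_, ?_⟩
  · intro x y
    have hx := hone x
    have hy := hone y
    have hs := hsub x y
    simp only
    rcases le_total (ω x) K with h | h <;> rcases le_total (ω y) K with h' | h'
    · rw [min_eq_left h, min_eq_left h']
      exact (min_le_left _ _).trans hs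
    · rw [min_eq_right h']
      refine (min_le_right _ _).trans ?_
      nlinarith [le_min hx hK]
    · rw [min_eq_right h]
      refine (min_le_right _ _).trans ?_
      nlinarith [le_min hy hK]
    · rw [min_eq_right h, min_eq_right h']
      refine (min_le_right _ _).trans ?_
      nlinarith
  · intro ε hε
    refine ⟨(Real.log K + 1) / ε, by positivity, (hlog _).trans ?_⟩
    rw [mul_div_cancel₀ _ hε.ne']
    linarith
  · intro ε hε
    refine ⟨-((Real.log K + 1) / ε), by rw [neg_lt_zero]; positivity, (hlog _).trans ?_⟩
    rw [mul_neg, neg_neg, mul_div_cancel₀ _ hε.ne']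
    linarith

end Aux

/-- **Theorem 3 (Bochner–Phillips type, weighted `L¹(ℝ,A)`).** -/
theorem stmt2 {A : Type*} [NormedRing A] [NormedAlgebra ℂ A] [CompleteSpace A] [NormOneClass A]
    (ω : ℝ → ℝ) (hω : IsWeightR ω)
    (f : ℝ → A) (hfm : StronglyMeasurable f)
    (hfi : Integrable fun x => ‖f x‖ * ω x)
    (hinv : ∀ t : ℝ, ∃ u : A,
      u * (1 + ∫ x : ℝ, Complex.exp (Complex.I * (t : ℂ) * (x : ℂ)) • f x) = 1) :
    (∃ (ν : ℝ → ℝ) (g : ℝ → A), IsWeightR ν ∧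
        (∀ x, 1 ≤ ν x ∧ ν x ≤ ω x) ∧
        ((∃ c, ∀ x, ν x = c) ↔ (∃ c, ∀ x, ω x = c)) ∧
        StronglyMeasurable g ∧
        (Integrable fun x => ‖g x‖ * ν x) ∧
        ∀ᵐ x : ℝ, f x + g x + (∫ t : ℝ, g (x - t) * f t) = 0) ∧
      (IsAdmissibleR ω → ∃ g : ℝ → A,
        StronglyMeasurable g ∧
        (Integrable fun x => ‖g x‖ * ω x) ∧
        ∀ᵐ x : ℝ, f x + g x + (∫ t : ℝ, g (x - t) * f t) = 0) := by
  refine ⟨?_, fun hadm => main_aux ω hω (adm_aux hω hadm).1 (adm_aux hω hadm).2 f hfm hfi hinv⟩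
  obtain ⟨K, hK, hiff⟩ : ∃ K : ℝ, 1 ≤ K ∧
      ((∃ c, ∀ x, min (ω x) K = c) ↔ (∃ c, ∀ x, ω x = c)) := by
    by_cases hc : ∃ c, ∀ x, ω x = c
    · obtain ⟨c, hc⟩ := hc
      exact ⟨1, le_rfl, fun _ => ⟨c, hc⟩, fun _ => ⟨min c 1, fun x => by rw [hc]⟩⟩
    · have hne : ∃ x, ω x ≠ ω 0 := by
        by_contra! h
        exact hc ⟨_, h⟩
      obtain ⟨x, hx⟩ := hne
      refine ⟨max (ω x) (ω 0), (hω.2.1 x).trans (le_max_left _ _), ?_, fun h => absurd h hc⟩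
      rintro ⟨c, h⟩
      have a := h x
      have b := h 0
      rw [min_eq_left (le_max_left _ _)] at a
      rw [min_eq_left (le_max_right _ _)] at b
      exact absurd (a.trans b.symm) hx
  obtain ⟨hν, hν2, hν1⟩ := min_aux hω K hK
  have hfν : Integrable fun x => ‖f x‖ * min (ω x) K := by
    refine hfi.mono' (hfm.norm.aestronglyMeasurable.mul hν.1.aestronglyMeasurable)
      (Filter.Eventually.of_forall fun x => ?_)
    have h0 := hν.2.1 x
    simp only at h0
    rw [Real.norm_of_nonneg (mul_nonneg (norm_nonneg _) (by linarith))]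
    exact mul_le_mul_of_nonneg_left (min_le_left _ _) (norm_nonneg _)
  obtain ⟨g, hg1, hg2, hg3⟩ := main_aux (fun x => min (ω x) K) hν hν2 hν1 f hfm hfν hinv
  exact ⟨fun x => min (ω x) K, g, hν, fun x => ⟨hν.2.1 x, min_le_left _ _⟩, hiff, hg1, hg2, hg3⟩
end

section
/- Let 1 < p < ∞ with conjugate index q, let A be a unital Banach algebra with unit e, let ω be an almost monotone algebra weight on ℝ, and let f : ℝ → A be strongly measurable with ∫_ℝ ‖f(x)‖^p ω(x)^p dx < ∞ (so that ∫_ℝ f(x) e^{itx} dx exists by Hölder's inequality, since ∫_ℝ ω^{-q} < ∞). Suppose e + ∫_ℝ f(x) e^{itx} dx is left invertible in A for every t ∈ ℝ. Then there exist an almost monotone algebra weight ν on ℝ with 1 ≤ ν(x) ≤ K ω(x) for all x ∈ ℝ for some K > 0, and a strongly measurable g : ℝ → A with ∫_ℝ ‖g(x)‖^p ν(x)^p dx < ∞, such that f(x) + g(x) + (g ⋆ f)(x) = 0 for almost every x ∈ ℝ, where (g ⋆ f)(x) = ∫_ℝ g(x-t) f(t) dt; that is, 1 + g is a left inverse of 1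 + f in the unitization of L^p(ℝ,ν,A). In particular, if ω is admissible, then 1 + f is left invertible in the unitization of L^p(ℝ,ω,A). -/
open scoped BigOperators
open MeasureTheory

/-- An almost monotone algebra weight on `ℝ` (for conjugate index `q`). -/
def IsAMAWR (q : ℝ) (ω : ℝ → ℝ) : Prop :=
  IsWeightR ω ∧
  (∀ x : ℝ, (∫ t : ℝ, ω t ^ (-q) * ω (x - t) ^ (-q)) ≤ ω x ^ (-q)) ∧
  (Integrable fun x : ℝ => ω x ^ (-q)) ∧
  (rho1R ω = 0 → ∃ K > (0 : ℝ), ∀ x y : ℝ, x ≤ 0 → y ≤ 0 → ω x ≤ K * ω (x + y)) ∧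
  (rho2R ω = 0 → ∃ K > (0 : ℝ), ∀ x y : ℝ, 0 ≤ x → 0 ≤ y → ω x ≤ K * ω (x + y))


section
open MeasureTheory
open Filter Topology

theorem exists_dual_vanish {B : Type*} [NormedAddCommGroup B] [NormedSpace ℂ B]
    (I : Submodule ℂ B) (x : B) (hx : x ∉ closure (I : Set B)) :
    ∃ φ : StrongDual ℂ B, (∀ y ∈ I, φ y = 0) ∧ φ x ≠ 0 := by
  obtain ⟨φ, u, h1, h2⟩ := RCLike.geometric_hahn_banach_closed_point (𝕜 := ℂ)
    (s := closure (I : Set B)) (x := x)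
    (I.restrictScalars ℝ).convex.closure isClosed_closure hx
  have h0 : 0 < u := by
    simpa using h1 0 (subset_closure I.zero_mem)
  have hz : ∀ y ∈ I, φ y = 0 := by
    intro y hy
    by_contra hne
    have := h1 (((2 * u : ℝ) / φ y : ℂ) • y) (subset_closure (I.smul_mem _ hy))
    rw [map_smul, smul_eq_mul, div_mul_cancel₀ _ hne] at this
    simp at this
    linarith
  refine ⟨φ, hz, ?_⟩
  intro h
  rw [h] at h2
  simp at h2
  linarith

theorem left_inv_of_local {B : Type*} [NormedRing B] [NormedAlgebra ℂ B] [CompleteSpace B]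
    (z b : B) (hz : ∀ x, z * x = x * z)
    (hd : Dense {l : ℂ | IsUnit (algebraMap ℂ B l - z)})
    (hloc : ∀ l : ℂ, ∃ u v : B, u * b + v * (algebraMap ℂ B l - z) = 1) :
    ∃ u : B, u * b = 1 := by
  by_contra hcon
  set I : Submodule ℂ B := LinearMap.range (LinearMap.mulRight ℂ b) with hI
  have hxb : ∀ x, x * b ∈ I := fun x => ⟨x, rfl⟩
  have h1 : (1 : B) ∉ closure (I : Set B) := by
    intro h
    rw [Metric.mem_closure_iff] at h
    obtain ⟨y, ⟨x, rfl⟩, hy⟩ := h 1 one_pos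
    rw [dist_eq_norm] at hy
    have hu := isUnit_one_sub_of_norm_lt_one hy
    simp only [sub_sub_cancel] at hu
    obtain ⟨w, hw⟩ := hu
    apply hcon
    refine ⟨(w⁻¹ : Bˣ) * x, ?_⟩
    have : x * b = w := by rw [hw]; rfl
    rw [mul_assoc, this]; simp
  obtain ⟨φ, hφ, hφ1⟩ := exists_dual_vanish I 1 h1
  choose u v huv using hloc
  -- agreement on the resolvent set
  have key : ∀ (l : ℂ) (u' v' : B), IsUnit (algebraMap ℂ B l - z) →
      u' * b + v' * (algebraMap ℂ B l - z) = 1 → φ v' = φ (resolvent z l) := by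
    intro l u' v' hu h
    have hr : (algebraMap ℂ B l - z) * resolvent z l = 1 := Ring.mul_inverse_cancel _ hu
    have hr' : resolvent z l * (algebraMap ℂ B l - z) = 1 := Ring.inverse_mul_cancel _ hu
    have hc : ∀ x, (algebraMap ℂ B l - z) * x = x * (algebraMap ℂ B l - z) := by
      intro x
      rw [sub_mul, mul_sub, hz, Algebra.commutes]
    have hc' : ∀ x, resolvent z l * x = x * resolvent z l := by
      intro x
      calc resolvent z l * x = resolvent z l * x * ((algebraMap ℂ B l - z) * resolvent z l) := by
            rw [hr, mul_one]
        _ = resolvent z l * ((algebraMap ℂ B l - z) * x) * resolvent z l := by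
            rw [hc x]; simp only [mul_assoc]
        _ = x * resolvent z l := by rw [← mul_assoc (resolvent z l), hr', one_mul]
    have : v' = resolvent z l - (resolvent z l * u') * b := by
      calc v' = v' * ((algebraMap ℂ B l - z) * resolvent z l) := by rw [hr, mul_one]
        _ = (1 - u' * b) * resolvent z l := by rw [← h]; noncomm_ring
        _ = _ := by rw [← hc']; noncomm_ring
    rw [this, map_sub, hφ _ (hxb _), sub_zero]
  -- local families
  let w : ℂ → ℂ → B := fun l0 l => Ring.inverse (1 + (l - l0) • v l0) * v l0
  have wprop : ∀ l0 l, IsUnit (1 + (l - l0) • v l0) →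
      ∃ u', u' * b + w l0 l * (algebraMap ℂ B l - z) = 1 := by
    intro l0 l hu
    refine ⟨Ring.inverse (1 + (l - l0) • v l0) * u l0, ?_⟩
    have e : u l0 * b + v l0 * (algebraMap ℂ B l - z) = 1 + (l - l0) • v l0 := by
      have : algebraMap ℂ B l - z = (algebraMap ℂ B l0 - z) + algebraMap ℂ B (l - l0) := by
        rw [map_sub]; abel
      rw [this, mul_add, ← add_assoc, huv, ← Algebra.commutes, Algebra.smul_def]
    simp only [w]
    rw [mul_assoc, mul_assoc, ← mul_add, e]
    exact Ring.inverse_mul_cancel _ hu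
  have wdiff : ∀ l0 l, IsUnit (1 + (l - l0) • v l0) → DifferentiableAt ℂ (w l0) l := by
    intro l0 l hu
    have : DifferentiableAt ℂ (fun l : ℂ => (1 + (l - l0) • v l0 : B)) l := by fun_prop
    have h2 : DifferentiableAt ℂ (Ring.inverse : B → B) (1 + (l - l0) • v l0) := by
      obtain ⟨x, hx⟩ := hu
      rw [← hx]
      exact (hasFDerivAt_ringInverse x).differentiableAt
    exact (h2.comp l this).mul_const _
  have wunit : ∀ l0, ∀ᶠ l in 𝓝 l0, IsUnit (1 + (l - l0) • v l0) := by
    intro l0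
    have hcont : ContinuousAt (fun l : ℂ => (1 + (l - l0) • v l0 : B)) l0 := by fun_prop
    have : {x : B | IsUnit x} ∈ 𝓝 ((fun l : ℂ => (1 + (l - l0) • v l0 : B)) l0) := by
      apply Units.isOpen.mem_nhds
      simp
    exact hcont this
  have wself : ∀ l, w l l = v l := by intro l; simp [w]
  have agree : ∀ l0 l, IsUnit (1 + (l - l0) • v l0) → φ (v l) = φ (w l0 l) := by
    intro l0 l hu
    have hev : ∀ᶠ l' in 𝓝 l, IsUnit (1 + (l' - l0) • v l0) := by
      have hcont : ContinuousAt (fun l : ℂ => (1 + (l - l0) • v l0 : B)) l := by fun_prop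
      exact hcont (Units.isOpen.mem_nhds hu)
    have hfr : ∃ᶠ l' in 𝓝 l, IsUnit (algebraMap ℂ B l' - z) := by
      have := hd l
      exact mem_closure_iff_frequently.mp this
    have hfr2 : ∃ᶠ l' in 𝓝 l, φ (w l l') = φ (w l0 l') := by
      refine (hfr.and_eventually (hev.and (wunit l))).mono ?_
      rintro l' ⟨ha, hb, hc⟩
      obtain ⟨u1, h1⟩ := wprop l0 l' hb
      obtain ⟨u2, h2⟩ := wprop l l' hc
      rw [key l' _ _ ha h1, key l' _ _ ha h2]
    have c1 : Tendsto (fun l' => φ (w l l') - φ (w l0 l')) (𝓝 l) (𝓝 (φ (w l l) - φ (w l0 l))) := by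
      apply Tendsto.sub
      · exact (φ.continuous.continuousAt.comp (wdiff l l (by simp)).continuousAt)
      · exact (φ.continuous.continuousAt.comp (wdiff l0 l hu).continuousAt)
    have hcl : φ (w l l) - φ (w l0 l) ∈ ({0} : Set ℂ) := by
      refine isClosed_singleton.mem_of_frequently_of_tendsto (hfr2.mono ?_) c1
      intro l' h
      simp [h]
    rw [← wself l]
    exact sub_eq_zero.mp hcl
  have hdiff : Differentiable ℂ (fun l => φ (v l)) := by
    intro l0
    have : (fun l => φ (v l)) =ᶠ[𝓝 l0] fun l => φ (w l0 l) :=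
      (wunit l0).mono fun l hl => agree l0 l hl
    refine DifferentiableAt.congr_of_eventuallyEq ?_ this
    exact φ.differentiableAt.comp l0 (wdiff l0 l0 (by simp))
  have hev : ∀ᶠ l in Bornology.cobounded ℂ, IsUnit (algebraMap ℂ B l - z) :=
    (spectrum.eventually_isUnit_resolvent z).mono fun l hl => by
      rwa [← spectrum.isUnit_resolvent] at hl
  have hev2 : ∀ᶠ l in Bornology.cobounded ℂ, φ (v l) = φ (resolvent z l) :=
    hev.mono fun l hl => key l _ _ hl (huv l)
  have ht0 := spectrum.resolvent_tendsto_cobounded (𝕜 := ℂ) z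
  have ht : Tendsto (fun l => φ (v l)) (cocompact ℂ) (𝓝 0) := by
    rw [← Metric.cobounded_eq_cocompact]
    refine Tendsto.congr' (hev2.mono fun l hl => hl.symm) ?_
    simpa [Function.comp_def] using (φ.continuous.tendsto 0).comp ht0
  have hzero : ∀ l, φ (v l) = 0 := fun l => hdiff.apply_eq_of_tendsto_cocompact l ht
  -- asymptotics
  have h3 : ∀ᶠ l in Bornology.cobounded ℂ, φ 1 = - φ (z * resolvent z l) := by
    filter_upwards [hev, hev2] with l ha hb
    have hr : (algebraMap ℂ B l - z) * resolvent z l = 1 := Ring.mul_inverse_cancel _ ha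
    rw [← hr, sub_mul, map_sub, ← Algebra.smul_def, map_smul, ← hb, hzero]
    simp
  have h4 : Tendsto (fun l => - φ (z * resolvent z l)) (Bornology.cobounded ℂ) (𝓝 0) := by
    have : Tendsto (fun l : ℂ => z * resolvent z l) (Bornology.cobounded ℂ) (𝓝 0) := by
      simpa using ht0.const_mul z
    simpa [Function.comp_def] using ((φ.continuous.tendsto 0).comp this).neg
  have h5 : Tendsto (fun _ : ℂ => φ 1) (Bornology.cobounded ℂ) (𝓝 0) :=
    h4.congr' (h3.mono fun l hl => hl.symm)
  exact hφ1 (tendsto_nhds_unique tendsto_const_nhds h5)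
end

section
open MeasureTheory
open Filter Topology
set_option linter.unusedSectionVars false
open scoped ENNReal Convolution

/-- The data of a weight for which the weighted `L^p` space is a Banach algebra. -/
structure WD where
  p : ℝ
  q : ℝ
  ω : ℝ → ℝ
  hpq : p.HolderConjugate q
  meas : Measurable ω
  one_le : ∀ x, 1 ≤ ω x
  conv : ∀ x, ∫⁻ t, ENNReal.ofReal (ω t) ^ (-q) * ENNReal.ofReal (ω (x - t)) ^ (-q)
    ≤ ENNReal.ofReal (ω x) ^ (-q)
  int : ∫⁻ t, ENNReal.ofReal (ω t) ^ (-q) ≠ ⊤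
  subexp : ∀ ε > 0, ∃ C, ∀ x, ω x ≤ C * Real.exp (ε * |x|)

namespace WD

variable (W : WD)

noncomputable def w (x : ℝ) : ℝ≥0∞ := ENNReal.ofReal (W.ω x)

noncomputable def P : ℝ≥0∞ := ENNReal.ofReal W.p

noncomputable def μ : Measure ℝ := volume.withDensity (fun x => W.w x ^ W.p)

theorem w_meas : Measurable W.w := W.meas.ennreal_ofReal

theorem w_ne_zero (x : ℝ) : W.w x ≠ 0 := by
  have := W.one_le x
  simp only [w, ne_eq, ENNReal.ofReal_eq_zero, not_le]
  linarith

theorem w_ne_top (x : ℝ) : W.w x ≠ ⊤ := ENNReal.ofReal_ne_top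

theorem p_pos : 0 < W.p := W.hpq.pos

theorem q_pos : 0 < W.q := W.hpq.symm.pos

theorem P_ne_zero : W.P ≠ 0 := by
  simp [P, W.p_pos]

theorem P_ne_top : W.P ≠ ⊤ := ENNReal.ofReal_ne_top

theorem P_toReal : W.P.toReal = W.p := ENNReal.toReal_ofReal W.p_pos.le

instance fact_P : Fact (1 ≤ W.P) := ⟨by
  rw [P, ← ENNReal.ofReal_one]
  exact ENNReal.ofReal_le_ofReal W.hpq.lt.le⟩

theorem wp_meas : Measurable (fun x => W.w x ^ W.p) := W.w_meas.pow_const _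

theorem ac1 : W.μ ≪ volume := withDensity_absolutelyContinuous _ _

theorem ac2 : volume ≪ W.μ := by
  refine withDensity_absolutelyContinuous' W.wp_meas.aemeasurable ?_
  filter_upwards with x
  simp [ENNReal.rpow_eq_zero_iff, W.w_ne_zero, W.w_ne_top]

theorem lintegral_mu (F : ℝ → ℝ≥0∞) : ∫⁻ x, F x ∂W.μ = ∫⁻ x, W.w x ^ W.p * F x := by
  rw [μ, lintegral_withDensity_eq_lintegral_mul_non_measurable _ W.wp_meas]
  · rfl
  · filter_upwards with x
    exact ENNReal.rpow_lt_top_of_nonneg W.p_pos.le (W.w_ne_top x)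

theorem conv_bound {F G : ℝ → ℝ≥0∞} (hF : AEMeasurable F) (hG : AEMeasurable G) :
    ∫⁻ x, ((∫⁻ t, F t * G (x - t)) * W.w x) ^ W.p ≤
      (∫⁻ x, (F x * W.w x) ^ W.p) * ∫⁻ x, (G x * W.w x) ^ W.p := by
  have hw := W.w_meas
  set F1 : ℝ → ℝ≥0∞ := fun x => F x * W.w x with hF1
  set G1 : ℝ → ℝ≥0∞ := fun x => G x * W.w x with hG1
  have mF1 : AEMeasurable F1 := hF.mul hw.aemeasurable
  have mG1 : AEMeasurable G1 := hG.mul hw.aemeasurable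
  have qmp : ∀ x : ℝ, Measure.QuasiMeasurePreserving (fun t : ℝ => x - t) volume volume :=
    fun x => quasiMeasurePreserving_sub_left volume x
  have pt : ∀ x, ((∫⁻ t, F t * G (x - t)) * W.w x) ^ W.p ≤
      ∫⁻ t, F1 t ^ W.p * G1 (x - t) ^ W.p := by
    intro x
    have e1 : ∀ t, F t * G (x - t) =
        (F1 t * G1 (x - t)) * ((W.w t)⁻¹ * (W.w (x - t))⁻¹) := by
      intro t
      simp only [hF1, hG1]
      calc F t * G (x - t) = F t * G (x - t) * ((W.w t * (W.w t)⁻¹) *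
            (W.w (x - t) * (W.w (x - t))⁻¹)) := by
            rw [ENNReal.mul_inv_cancel (W.w_ne_zero _) (W.w_ne_top _),
              ENNReal.mul_inv_cancel (W.w_ne_zero _) (W.w_ne_top _)]
            simp
        _ = _ := by ring
    have h1 : ∫⁻ t, F t * G (x - t) ≤
        (∫⁻ t, F1 t ^ W.p * G1 (x - t) ^ W.p) ^ (1 / W.p) * (W.w x)⁻¹ := by
      calc ∫⁻ t, F t * G (x - t)
          = ∫⁻ t, ((fun t => F1 t * G1 (x - t)) * (fun t => (W.w t)⁻¹ * (W.w (x - t))⁻¹)) t := by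
            apply lintegral_congr; intro t; exact e1 t
        _ ≤ _ := ENNReal.lintegral_mul_le_Lp_mul_Lq volume W.hpq
            (mF1.mul (mG1.comp_quasiMeasurePreserving (qmp x)))
            ((hw.inv.mul ((hw.comp (measurable_const.sub measurable_id)).inv)).aemeasurable)
        _ ≤ _ := by
            gcongr ?_ * ?_
            · apply le_of_eq
              congr 1
              apply lintegral_congr; intro t
              exact ENNReal.mul_rpow_of_nonneg _ _ W.p_pos.le
            · calc (∫⁻ t, ((W.w t)⁻¹ * (W.w (x - t))⁻¹) ^ W.q) ^ (1 / W.q)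
                  ≤ (W.w x ^ (-W.q)) ^ (1 / W.q) := by
                    have hq := W.q_pos
                    gcongr
                    refine le_trans (le_of_eq ?_) (W.conv x)
                    apply lintegral_congr; intro t
                    rw [ENNReal.mul_rpow_of_nonneg _ _ hq.le, ENNReal.inv_rpow, ENNReal.inv_rpow,
                      ← ENNReal.rpow_neg, ← ENNReal.rpow_neg]
                    rfl
                _ = (W.w x)⁻¹ := by
                    rw [← ENNReal.rpow_mul, neg_mul, mul_one_div_cancel W.q_pos.ne',
                      ENNReal.rpow_neg_one]
    calc ((∫⁻ t, F t * G (x - t)) * W.w x) ^ W.p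
        ≤ ((∫⁻ t, F1 t ^ W.p * G1 (x - t) ^ W.p) ^ (1 / W.p) * (W.w x)⁻¹ * W.w x) ^ W.p := by
          have := W.p_pos
          gcongr
      _ = _ := by
          rw [mul_assoc, ENNReal.inv_mul_cancel (W.w_ne_zero _) (W.w_ne_top _), mul_one,
            ← ENNReal.rpow_mul, one_div_mul_cancel W.p_pos.ne', ENNReal.rpow_one]
  calc _ ≤ ∫⁻ x, ∫⁻ t, F1 t ^ W.p * G1 (x - t) ^ W.p := lintegral_mono pt
    _ = ∫⁻ t, ∫⁻ x, F1 t ^ W.p * G1 (x - t) ^ W.p := by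
      apply lintegral_lintegral_swap
      have a1 : AEMeasurable (fun z : ℝ × ℝ => F1 z.2 ^ W.p) (volume.prod volume) :=
        (mF1.pow_const _).comp_quasiMeasurePreserving Measure.quasiMeasurePreserving_snd
      have a2 : AEMeasurable (fun z : ℝ × ℝ => G1 (z.1 - z.2) ^ W.p) (volume.prod volume) :=
        (mG1.pow_const _).comp_quasiMeasurePreserving
          (quasiMeasurePreserving_sub volume volume)
      exact a1.mul a2
    _ = ∫⁻ t, F1 t ^ W.p * ∫⁻ x, G1 x ^ W.p := by
      apply lintegral_congr; intro t
      rw [lintegral_const_mul'']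
      · congr 1
        exact lintegral_sub_right_eq_self (fun x => G1 x ^ W.p) t
      · exact (mG1.pow_const _).comp_quasiMeasurePreserving
          (measurePreserving_sub_right volume t).quasiMeasurePreserving
    _ = _ := by
      rw [lintegral_mul_const'' _ (mF1.pow_const _)]

theorem L1_bound {F : ℝ → ℝ≥0∞} (hF : AEMeasurable F) :
    ∫⁻ x, F x ≤ (∫⁻ x, (F x * W.w x) ^ W.p) ^ (1 / W.p) *
      (∫⁻ x, W.w x ^ (-W.q)) ^ (1 / W.q) := by
  have hw := W.w_meas
  calc ∫⁻ x, F x = ∫⁻ x, ((fun x => F x * W.w x) * (fun x => (W.w x)⁻¹)) x := by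
        apply lintegral_congr; intro t
        simp only [Pi.mul_apply]
        rw [mul_assoc, ENNReal.mul_inv_cancel (W.w_ne_zero _) (W.w_ne_top _), mul_one]
    _ ≤ _ := ENNReal.lintegral_mul_le_Lp_mul_Lq volume W.hpq (hF.mul hw.aemeasurable)
        hw.inv.aemeasurable
    _ = _ := by
      congr 2
      apply lintegral_congr; intro t
      rw [ENNReal.inv_rpow, ← ENNReal.rpow_neg]

/-- the constant in Hölder's inequality -/
noncomputable def cH : ℝ≥0∞ := (∫⁻ x, W.w x ^ (-W.q)) ^ (1 / W.q)

theorem cH_ne_top : W.cH ≠ ⊤ :=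
  ENNReal.rpow_ne_top_of_nonneg (by have := W.q_pos; positivity) W.int

section
variable {A : Type*} [NormedRing A] [NormedAlgebra ℂ A] [CompleteSpace A]

theorem eLpNorm_eq (f : ℝ → A) :
    eLpNorm f W.P W.μ = (∫⁻ x, (‖f x‖ₑ * W.w x) ^ W.p) ^ (1 / W.p) := by
  rw [eLpNorm_eq_lintegral_rpow_enorm_toReal W.P_ne_zero W.P_ne_top, P_toReal, lintegral_mu]
  congr 1
  apply lintegral_congr; intro x
  rw [ENNReal.mul_rpow_of_nonneg _ _ W.p_pos.le, mul_comm]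

theorem aesm_iff {f : ℝ → A} : AEStronglyMeasurable f W.μ ↔ AEStronglyMeasurable f volume :=
  ⟨fun h => h.mono_ac W.ac2, fun h => h.mono_ac W.ac1⟩

theorem memLp_integrable {f : ℝ → A} (hf : MemLp f W.P W.μ) : Integrable f := by
  refine ⟨W.aesm_iff.mp hf.1, ?_⟩
  have hm : AEMeasurable (fun x => ‖f x‖ₑ) volume := (W.aesm_iff.mp hf.1).enorm
  have := W.L1_bound hm
  rw [← eLpNorm_eq] at this
  exact lt_of_le_of_lt this (ENNReal.mul_lt_top hf.2 W.cH_ne_top.lt_top)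

theorem lintegral_enorm_le {f : ℝ → A} (hf : MemLp f W.P W.μ) :
    ∫⁻ x, ‖f x‖ₑ ≤ eLpNorm f W.P W.μ * W.cH := by
  have hm : AEMeasurable (fun x => ‖f x‖ₑ) volume := (W.aesm_iff.mp hf.1).enorm
  have := W.L1_bound hm
  rwa [← eLpNorm_eq] at this

/-- convolution -/
noncomputable def cv (f g : ℝ → A) : ℝ → A := f ⋆[ContinuousLinearMap.mul ℝ A, volume] g

theorem eLpNorm_cv_le {f g : ℝ → A} (hf : MemLp f W.P W.μ) (hg : MemLp g W.P W.μ) :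
    eLpNorm (cv f g) W.P W.μ ≤ eLpNorm f W.P W.μ * eLpNorm g W.P W.μ := by
  have hfm : AEMeasurable (fun x => ‖f x‖ₑ) volume := (W.aesm_iff.mp hf.1).enorm
  have hgm : AEMeasurable (fun x => ‖g x‖ₑ) volume := (W.aesm_iff.mp hg.1).enorm
  have hp := W.p_pos
  rw [eLpNorm_eq, eLpNorm_eq, eLpNorm_eq, ← ENNReal.mul_rpow_of_nonneg _ _ (by positivity)]
  gcongr
  refine le_trans (lintegral_mono fun x => ?_) (W.conv_bound hfm hgm)
  dsimp only
  gcongr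
  calc ‖cv f g x‖ₑ ≤ ∫⁻ t, ‖f t * g (x - t)‖ₑ := enorm_integral_le_lintegral_enorm _
    _ ≤ _ := by
      apply lintegral_mono; intro t
      simp only [enorm_eq_nnnorm]
      exact_mod_cast nnnorm_mul_le _ _

theorem memLp_cv {f g : ℝ → A} (hf : MemLp f W.P W.μ) (hg : MemLp g W.P W.μ) :
    MemLp (cv f g) W.P W.μ := by
  refine ⟨W.aesm_iff.mpr ?_, lt_of_le_of_lt (W.eLpNorm_cv_le hf hg) (ENNReal.mul_lt_top hf.2 hg.2)⟩
  exact ((W.memLp_integrable hf).integrable_convolution _ (W.memLp_integrable hg)).1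

theorem cv_congr {f g f' g' : ℝ → A} (hf : f =ᵐ[volume] f') (hg : g =ᵐ[volume] g') :
    cv f g = cv f' g' := convolution_congr _ hf hg

theorem ae_exists {f g : ℝ → A} (hf : Integrable f) (hg : Integrable g) :
    ∀ᵐ x, Integrable (fun t => f t * g (x - t)) :=
  hf.ae_convolution_exists (ContinuousLinearMap.mul ℝ A) hg

theorem cv_assoc {f g h : ℝ → A} (hf : Integrable f) (hg : Integrable g) (hh : Integrable h) :
    cv (cv f g) h =ᵐ[volume] cv f (cv g h) := by
  have h1 := hf.ae_convolution_exists (ContinuousLinearMap.mul ℝ A) hg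
  have h2 := hg.norm.ae_convolution_exists (ContinuousLinearMap.mul ℝ ℝ) hh.norm
  have h3 := hf.norm.ae_convolution_exists (ContinuousLinearMap.mul ℝ ℝ)
    (hg.norm.integrable_convolution (ContinuousLinearMap.mul ℝ ℝ) hh.norm)
  filter_upwards [h3] with x hx
  exact convolution_assoc _ _ _ _ (fun x y z => mul_assoc x y z) hf.1 hg.1 hh.1 h1 h2 hx

theorem cv_add {f g h : ℝ → A} (hf : Integrable f) (hg : Integrable g) (hh : Integrable h) :
    cv f (g + h) =ᵐ[volume] cv f g + cv f h := by
  filter_upwards [hf.ae_convolution_exists (ContinuousLinearMap.mul ℝ A) hg,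
    hf.ae_convolution_exists (ContinuousLinearMap.mul ℝ A) hh] with x h1 h2
  exact h1.distrib_add h2

theorem add_cv {f g h : ℝ → A} (hf : Integrable f) (hg : Integrable g) (hh : Integrable h) :
    cv (f + g) h =ᵐ[volume] cv f h + cv g h := by
  filter_upwards [hf.ae_convolution_exists (ContinuousLinearMap.mul ℝ A) hh,
    hg.ae_convolution_exists (ContinuousLinearMap.mul ℝ A) hh] with x h1 h2
  exact h1.add_distrib h2

theorem smul_cv (c : ℂ) (f g : ℝ → A) : cv (c • f) g = c • cv f g := by
  ext x
  simp only [cv, convolution_def, Pi.smul_apply, ContinuousLinearMap.mul_apply']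
  rw [← integral_smul]
  simp

theorem cv_smul (c : ℂ) (f g : ℝ → A) : cv f (c • g) = c • cv f g := by
  ext x
  simp only [cv, convolution_def, Pi.smul_apply, ContinuousLinearMap.mul_apply']
  rw [← integral_smul]
  simp

end

/-- The weighted `L^p` space as a Banach algebra. -/
def EE (W : WD) (A : Type*) [NormedRing A] : Type _ := Lp A W.P W.μ

section
variable (A : Type*) [NormedRing A] [NormedAlgebra ℂ A] [CompleteSpace A]

noncomputable instance : NormedAddCommGroup (W.EE A) :=
  inferInstanceAs (NormedAddCommGroup (Lp A W.P W.μ))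

noncomputable instance : NormedSpace ℂ (W.EE A) :=
  inferInstanceAs (NormedSpace ℂ (Lp A W.P W.μ))

instance : CompleteSpace (W.EE A) :=
  inferInstanceAs (CompleteSpace (Lp A W.P W.μ))

variable {A}

/-- function underlying an element -/
noncomputable def fn (f : W.EE A) : ℝ → A := (show Lp A W.P W.μ from f : ℝ → A)

noncomputable def mkE (f : ℝ → A) (hf : MemLp f W.P W.μ) : W.EE A := hf.toLp f

variable {W}

theorem memLp_fn (f : W.EE A) : MemLp (W.fn f) W.P W.μ := Lp.memLp (show Lp A W.P W.μ from f)

theorem fn_mk (f : ℝ → A) (hf : MemLp f W.P W.μ) : W.fn (W.mkE f hf) =ᵐ[volume] f :=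
  W.ac2.ae_le hf.coeFn_toLp

theorem EE_ext {f g : W.EE A} (h : W.fn f =ᵐ[volume] W.fn g) : f = g :=
  Lp.ext (W.ac1.ae_le h)

theorem fn_add (f g : W.EE A) : W.fn (f + g) =ᵐ[volume] W.fn f + W.fn g :=
  W.ac2.ae_le (Lp.coeFn_add (show Lp A W.P W.μ from f) g)

theorem fn_sub (f g : W.EE A) : W.fn (f - g) =ᵐ[volume] W.fn f - W.fn g :=
  W.ac2.ae_le (Lp.coeFn_sub (show Lp A W.P W.μ from f) g)

theorem fn_smul (c : ℂ) (f : W.EE A) : W.fn (c • f) =ᵐ[volume] c • W.fn f :=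
  W.ac2.ae_le (Lp.coeFn_smul c (show Lp A W.P W.μ from f))

theorem fn_zero : W.fn (0 : W.EE A) =ᵐ[volume] 0 :=
  W.ac2.ae_le (Lp.coeFn_zero A W.P W.μ)

theorem norm_def' (f : W.EE A) : ‖f‖ = (eLpNorm (W.fn f) W.P W.μ).toReal :=
  Lp.norm_def (show Lp A W.P W.μ from f)

theorem int_fn (f : W.EE A) : Integrable (W.fn f) := W.memLp_integrable (memLp_fn f)

noncomputable instance : Mul (W.EE A) := ⟨fun f g => W.mkE _ (W.memLp_cv (memLp_fn f) (memLp_fn g))⟩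

theorem fn_mul (f g : W.EE A) : W.fn (f * g) =ᵐ[volume] cv (W.fn f) (W.fn g) := fn_mk _ _

noncomputable instance : NonUnitalNormedRing (W.EE A) :=
  { (inferInstance : NormedAddCommGroup (W.EE A)), (inferInstance : Mul (W.EE A)) with
    left_distrib := by
      intro a b c
      apply EE_ext
      refine (fn_mul _ _).trans ?_
      rw [cv_congr (EventuallyEq.refl _ _) (fn_add b c)]
      refine (cv_add (int_fn a) (int_fn b) (int_fn c)).trans ?_
      refine EventuallyEq.trans ?_ (fn_add _ _).symm
      exact ((fn_mul a b).symm.add (fn_mul a c).symm)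
    right_distrib := by
      intro a b c
      apply EE_ext
      refine (fn_mul _ _).trans ?_
      rw [cv_congr (fn_add a b) (EventuallyEq.refl _ _)]
      refine (add_cv (int_fn a) (int_fn b) (int_fn c)).trans ?_
      refine EventuallyEq.trans ?_ (fn_add _ _).symm
      exact ((fn_mul a c).symm.add (fn_mul b c).symm)
    zero_mul := by
      intro a
      apply EE_ext
      refine (fn_mul _ _).trans ?_
      rw [cv_congr fn_zero (EventuallyEq.refl _ _)]
      refine EventuallyEq.trans ?_ fn_zero.symm
      simp [cv]
    mul_zero := by
      intro a
      apply EE_ext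
      refine (fn_mul _ _).trans ?_
      rw [cv_congr (EventuallyEq.refl _ _) fn_zero]
      refine EventuallyEq.trans ?_ fn_zero.symm
      simp [cv]
    mul_assoc := by
      intro a b c
      apply EE_ext
      refine (fn_mul _ _).trans ?_
      refine EventuallyEq.trans ?_ (fn_mul _ _).symm
      rw [cv_congr (fn_mul a b) (EventuallyEq.refl _ _),
        cv_congr (EventuallyEq.refl _ _) (fn_mul b c)]
      exact cv_assoc (int_fn a) (int_fn b) (int_fn c)
    norm_mul_le := by
      intro a b
      change ‖a * b‖ ≤ ‖a‖ * ‖b‖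
      rw [norm_def', norm_def', norm_def', ← ENNReal.toReal_mul]
      apply ENNReal.toReal_mono (ENNReal.mul_ne_top (memLp_fn a).2.ne (memLp_fn b).2.ne)
      rw [eLpNorm_congr_ae (W.ac1.ae_le (fn_mul a b))]
      exact W.eLpNorm_cv_le (memLp_fn a) (memLp_fn b) }

instance : IsScalarTower ℂ (W.EE A) (W.EE A) := ⟨by
  intro c a b
  apply EE_ext
  refine (fn_mul _ _).trans ?_
  refine EventuallyEq.trans ?_ (fn_smul _ _).symm
  rw [cv_congr (fn_smul c a) (EventuallyEq.refl _ _), smul_cv]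
  exact (fn_mul a b).symm.const_smul c⟩

instance : SMulCommClass ℂ (W.EE A) (W.EE A) := ⟨by
  intro c a b
  apply EE_ext
  refine (fn_smul _ _).trans ?_
  refine EventuallyEq.trans ?_ (fn_mul _ _).symm
  rw [cv_congr (EventuallyEq.refl _ _) (fn_smul c b), cv_smul]
  exact (fn_mul a b).const_smul c⟩

end
end WD
end

section
open MeasureTheory
open Filter Topology
set_option linter.unusedSectionVars false
open scoped ENNReal Convolution

namespace WD
variable {W : WD}

/-- scalar exponential kernels -/
noncomputable def er (k : ℂ) (x : ℝ) : ℂ :=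
  if k.re < 0 then (Set.Ioi (0 : ℝ)).indicator (fun x : ℝ => Complex.exp (k * x)) x
  else - (Set.Iio (0 : ℝ)).indicator (fun x : ℝ => Complex.exp (k * x)) x

theorem er_meas (k : ℂ) : Measurable (er k) := by
  unfold er
  have : Measurable (fun x : ℝ => Complex.exp (k * x)) := by fun_prop
  split_ifs
  · exact this.indicator measurableSet_Ioi
  · exact (this.indicator measurableSet_Iio).neg

theorem er_bound (k : ℂ) (x : ℝ) : ‖er k x‖ ≤ Real.exp (-|k.re| * |x|) := by
  unfold er
  split_ifs with h
  · rw [Set.indicator_apply]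
    split_ifs with hx
    · rw [Complex.norm_exp, abs_of_neg h, abs_of_pos hx]
      simp
    · simp; positivity
  · rw [norm_neg, Set.indicator_apply]
    split_ifs with hx
    · rw [Complex.norm_exp, abs_of_nonneg (not_lt.mp h), abs_of_neg hx]
      simp
    · simp; positivity

theorem er_conv (k : ℂ) (hk : k.re ≠ 0) (x : ℝ) (hx : x ≠ 0) :
    (k + 1) * ∫ t, er k t * er (-1) (x - t) = er k x - er (-1) x := by
  by_cases hk1 : k = -1
  · simp [hk1]
  have hk1' : k + 1 ≠ 0 := fun h => hk1 (eq_neg_of_add_eq_zero_left h)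
  have hz : ∀ y : ℝ, er (-1) y = (Set.Ioi (0 : ℝ)).indicator (fun x : ℝ => Complex.exp (-x)) y := by
    intro y; simp [er]
  have hee : ∀ t : ℝ, Complex.exp (k * t) * Complex.exp (-(x - t : ℝ)) =
      Complex.exp (-x) * Complex.exp ((k + 1) * t) := by
    intro t
    rw [← Complex.exp_add, ← Complex.exp_add]
    congr 1; push_cast; ring
  rcases lt_or_gt_of_ne hk with h | h
  · have he : ∀ y : ℝ, er k y = (Set.Ioi (0 : ℝ)).indicator (fun x : ℝ => Complex.exp (k * x)) y := by
      intro y; simp [er, h]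
    rcases lt_or_gt_of_ne hx with hx | hx
    · have : ∀ t, er k t * er (-1) (x - t) = 0 := by
        intro t
        rw [he, hz, Set.indicator_apply, Set.indicator_apply]
        split_ifs with h1 h2 <;> simp_all
        linarith
      simp only [this]
      rw [he, hz]
      simp [Set.indicator_apply, not_lt.mpr hx.le]
    · have : ∀ t, er k t * er (-1) (x - t) =
          (Set.Ioo 0 x).indicator (fun t : ℝ => Complex.exp (-x) * Complex.exp ((k + 1) * t)) t := by
        intro t
        rw [he, hz, Set.indicator_apply, Set.indicator_apply, Set.indicator_apply, ← hee]
        simp only [Set.mem_Ioi, Set.mem_Ioo, sub_pos]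
        split_ifs <;> simp_all
      simp only [this]
      rw [integral_indicator measurableSet_Ioo, ← integral_Ioc_eq_integral_Ioo,
        ← intervalIntegral.integral_of_le hx.le, intervalIntegral.integral_const_mul,
        integral_exp_mul_complex hk1', he, hz, Set.indicator_of_mem (by exact hx),
        Set.indicator_of_mem (by exact hx)]
      field_simp
      have := hee x
      simp at this
      simp [mul_sub, this]
  · have he : ∀ y : ℝ, er k y = -(Set.Iio (0 : ℝ)).indicator (fun x : ℝ => Complex.exp (k * x)) y := by
      intro y; simp [er, not_lt.mpr h.le]
    have : ∀ t, er k t * er (-1) (x - t) =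
        (Set.Iio (min 0 x)).indicator (fun t : ℝ => -Complex.exp (-x) * Complex.exp ((k + 1) * t)) t := by
      intro t
      rw [he, hz, Set.indicator_apply, Set.indicator_apply, Set.indicator_apply, neg_mul,
        neg_mul, ← hee]
      simp only [Set.mem_Ioi, Set.mem_Iio, sub_pos, lt_min_iff]
      split_ifs <;> simp_all
    simp only [this]
    rw [integral_indicator measurableSet_Iio, ← integral_Iic_eq_integral_Iio,
      integral_const_mul, integral_exp_mul_complex_Iic (by simp; linarith), he, hz,
      Set.indicator_apply, Set.indicator_apply]
    simp only [Set.mem_Ioi, Set.mem_Iio]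
    rcases lt_or_gt_of_ne hx with hx | hx
    · rw [min_eq_right hx.le, if_pos hx, if_neg (not_lt.mpr hx.le)]
      field_simp
      have := hee x
      simp at this
      simp [this]
    · rw [min_eq_left hx.le, if_neg (not_lt.mpr hx.le), if_pos hx]
      field_simp
      simp

variable {A : Type*} [NormedRing A] [NormedAlgebra ℂ A] [CompleteSpace A]

theorem integrable_exp_neg_abs {c : ℝ} (hc : 0 < c) :
    Integrable (fun x : ℝ => Real.exp (-c * |x|)) := by
  have h1 : IntegrableOn (fun x : ℝ => Real.exp (-c * |x|)) (Set.Ioi 0) := by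
    refine (exp_neg_integrableOn_Ioi 0 hc).congr_fun ?_ measurableSet_Ioi
    intro x hx
    simp [abs_of_pos (show 0 < x from hx)]
  have h2 : IntegrableOn (fun x : ℝ => Real.exp (-c * |x|)) (Set.Iic 0) := by
    refine (integrableOn_exp_mul_Iic hc 0).congr_fun ?_ measurableSet_Iic
    intro x hx
    simp [abs_of_nonpos (show x ≤ 0 from hx)]
  rw [← integrableOn_univ, ← Set.Iic_union_Ioi (a := (0 : ℝ))]
  exact h2.union h1

theorem memLp_of_bound {f : ℝ → A} (hf : AEStronglyMeasurable f) {D c : ℝ} (hc : 0 < c)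
    (h : ∀ x, ‖f x‖ ≤ D * Real.exp (-c * |x|)) : MemLp f W.P W.μ := by
  refine ⟨W.aesm_iff.mpr hf, ?_⟩
  have hp := W.p_pos
  rw [eLpNorm_eq]
  apply ENNReal.rpow_lt_top_of_nonneg (by positivity)
  obtain ⟨C, hC⟩ := W.subexp (c / 2) (by positivity)
  have hi : Integrable (fun x : ℝ => (D * C) ^ W.p * Real.exp (-(W.p * c / 2) * |x|)) :=
    (integrable_exp_neg_abs (by positivity)).const_mul _
  have hD : 0 ≤ D := by
    have := (norm_nonneg _).trans (h 0); simpa using this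
  have hC0 : 0 ≤ C := by
    have := (zero_le_one.trans (W.one_le 0)).trans (hC 0); simpa using this
  refine (lt_of_le_of_lt (lintegral_mono fun x => ?_) hi.lintegral_lt_top).ne
  have e1 : ‖f x‖ₑ * W.w x = ENNReal.ofReal (‖f x‖ * W.ω x) := by
    rw [ENNReal.ofReal_mul (norm_nonneg _), ofReal_norm, w]
  have h0 : 0 ≤ W.ω x := zero_le_one.trans (W.one_le x)
  dsimp only
  rw [e1, ENNReal.ofReal_rpow_of_nonneg (by positivity) hp.le]
  apply ENNReal.ofReal_le_ofReal
  calc (‖f x‖ * W.ω x) ^ W.p ≤ (D * C * Real.exp (-(c / 2) * |x|)) ^ W.p := by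
        apply Real.rpow_le_rpow (by positivity) _ hp.le
        calc ‖f x‖ * W.ω x ≤ (D * Real.exp (-c * |x|)) * (C * Real.exp (c / 2 * |x|)) := by
              gcongr
              · exact h x
              · exact hC x
          _ = D * C * (Real.exp (-c * |x|) * Real.exp (c / 2 * |x|)) := by ring
          _ = _ := by rw [← Real.exp_add]; congr 2; ring
    _ = _ := by
        rw [Real.mul_rpow (by positivity) (by positivity), ← Real.exp_mul]
        congr 2; ring

instance : IsFiniteMeasureOnCompacts W.μ := ⟨by
  intro K hK
  obtain ⟨C, hC⟩ := W.subexp 1 one_pos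
  obtain ⟨R, hR⟩ := hK.isBounded.exists_norm_le
  have hp := W.p_pos
  rw [μ, withDensity_apply' ]
  have hC0 : 0 ≤ C := by
    have := (zero_le_one.trans (W.one_le 0)).trans (hC 0); simpa using this
  calc ∫⁻ x in K, W.w x ^ W.p ≤ ∫⁻ x in K, ENNReal.ofReal (C * Real.exp R) ^ W.p := by
        refine setLIntegral_mono' hK.measurableSet fun x hx => ?_
        gcongr
        rw [w]
        apply ENNReal.ofReal_le_ofReal
        refine (hC x).trans ?_
        gcongr
        rw [one_mul]
        exact hR x hx
    _ < ⊤ := by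
        rw [setLIntegral_const]
        exact ENNReal.mul_lt_top (ENNReal.rpow_lt_top_of_nonneg hp.le ENNReal.ofReal_ne_top)
          hK.measure_lt_top⟩

theorem memLp_cc {f : ℝ → A} (hf : Continuous f) (hc : HasCompactSupport f) : MemLp f W.P W.μ :=
  hf.memLp_of_hasCompactSupport hc

theorem memLp_er {k : ℂ} (hk : k.re ≠ 0) (c : A) : MemLp (fun x => er k x • c) W.P W.μ := by
  refine memLp_of_bound (D := ‖c‖) (c := |k.re|) ?_ (by positivity) ?_
  · exact ((er_meas k).stronglyMeasurable.smul_const c).aestronglyMeasurable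
  · intro x
    rw [norm_smul, mul_comm]
    gcongr
    exact er_bound k x

/-- scalar multiples of the unit commute -/
theorem scalar_cv_comm (r : ℝ → ℂ) (f : ℝ → A) :
    cv (fun x => r x • (1 : A)) f = cv f (fun x => r x • (1 : A)) := by
  ext x
  unfold cv
  rw [convolution_eq_swap, convolution_def]
  simp

theorem er_cv {k : ℂ} (hk : k.re ≠ 0) :
    (k + 1) • cv (fun x => er k x • (1 : A)) (fun x => er (-1) x • (1 : A)) =ᵐ[volume]
      (fun x => er k x • (1 : A)) - (fun x => er (-1) x • (1 : A)) := by
  have : ∀ᵐ x : ℝ, x ≠ 0 := by simp [ae_iff, measure_singleton]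
  filter_upwards [this] with x hx
  simp only [Pi.smul_apply, Pi.sub_apply, cv, convolution_def, ContinuousLinearMap.mul_apply']
  rw [← sub_smul, ← er_conv k hk x hx, ← smul_smul]
  congr 1
  rw [← integral_smul_const]
  congr 1; ext t
  simp [smul_smul, mul_comm]

theorem er_cv_deriv {φ : ℝ → A} (h1 : ContDiff ℝ 1 φ) (h2 : HasCompactSupport φ) :
    cv (fun x => er (-1) x • (1 : A)) (φ + deriv φ) = φ := by
  ext x
  unfold cv
  rw [convolution_eq_swap]
  have e : ∀ t, (ContinuousLinearMap.mul ℝ A) (er (-1) (x - t) • (1 : A)) ((φ + deriv φ) t) =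
      (Set.Iio x).indicator (fun t => deriv (fun t => Real.exp (t - x) • φ t) t) t := by
    intro t
    have hd : HasDerivAt (fun t => Real.exp (t - x) • φ t)
        (Real.exp (t - x) • deriv φ t + Real.exp (t - x) • φ t) t := by
      have a1 : HasDerivAt (fun t => Real.exp (t - x)) (Real.exp (t - x)) t := by
        simpa using ((hasDerivAt_id t).sub_const x).exp
      exact a1.smul (h1.differentiable one_ne_zero t).hasDerivAt
    rw [Set.indicator_apply, hd.deriv]
    simp only [ContinuousLinearMap.mul_apply', er, Set.indicator_apply, Set.mem_Ioi, Set.mem_Iio,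
      sub_pos]
    simp only [Complex.neg_re, Complex.one_re, Left.neg_neg_iff, zero_lt_one, if_true]
    split_ifs
    · have : Complex.exp (-1 * ((x - t : ℝ) : ℂ)) = ((Real.exp (t - x) : ℝ) : ℂ) := by
        push_cast; congr 1; ring
      rw [this, Complex.coe_smul]
      simp [add_comm]
    · simp
  simp only [e]
  rw [integral_indicator measurableSet_Iio, ← integral_Iic_eq_integral_Iio,
    HasCompactSupport.integral_Iic_deriv_eq]
  · simp
  · have : ContDiff ℝ 1 (fun t => Real.exp (t - x)) := by fun_prop
    exact this.smul h1
  · exact h2.smul_left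

end WD
end

section
open MeasureTheory
open Filter Topology
set_option linter.unusedSectionVars false
open scoped ENNReal Convolution

namespace WD
section
variable {W : WD} {A : Type*} [NormedRing A] [NormedAlgebra ℂ A] [CompleteSpace A]

abbrev BB (W : WD) (A : Type*) [NormedRing A] [NormedAlgebra ℂ A] [CompleteSpace A] : Type _ :=
  WithLp 1 (Unitization ℂ (W.EE A))

noncomputable def ii (f : ℝ → A) (hf : MemLp f W.P W.μ) : BB W A :=
  WithLp.toLp 1 (Unitization.inr (W.mkE f hf))

theorem ii_congr {f g : ℝ → A} (hf : MemLp f W.P W.μ) (hg : MemLp g W.P W.μ)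
    (h : f =ᵐ[volume] g) : ii f hf = ii g hg := by
  unfold ii
  congr 2
  apply EE_ext
  exact (fn_mk f hf).trans (h.trans (fn_mk g hg).symm)

theorem ii_add {f g : ℝ → A} (hf : MemLp f W.P W.μ) (hg : MemLp g W.P W.μ) :
    ii f hf + ii g hg = ii (f + g) (hf.add hg) := by
  unfold ii
  rw [← WithLp.toLp_add, ← Unitization.inr_add]
  congr 2

theorem ii_sub {f g : ℝ → A} (hf : MemLp f W.P W.μ) (hg : MemLp g W.P W.μ) :
    ii f hf - ii g hg = ii (f - g) (hf.sub hg) := by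
  unfold ii
  rw [← WithLp.toLp_sub, ← Unitization.inr_sub]
  congr 2

theorem ii_smul (c : ℂ) {f : ℝ → A} (hf : MemLp f W.P W.μ) :
    c • ii f hf = ii (c • f) (hf.const_smul c) := by
  unfold ii
  rw [← WithLp.toLp_smul, ← Unitization.inr_smul]
  congr 2

theorem ii_mul {f g : ℝ → A} (hf : MemLp f W.P W.μ) (hg : MemLp g W.P W.μ) :
    ii f hf * ii g hg = ii (cv f g) (W.memLp_cv hf hg) := by
  have : W.mkE f hf * W.mkE g hg = W.mkE (cv f g) (W.memLp_cv hf hg) := by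
    apply EE_ext
    refine (fn_mul _ _).trans ?_
    rw [cv_congr (fn_mk f hf) (fn_mk g hg)]
    exact (fn_mk _ _).symm
  unfold ii
  rw [← this]
  apply (WithLp.unitizationAlgEquiv (𝕜 := ℂ) (A := W.EE A) ℂ).injective
  rw [map_mul]
  simp [Unitization.inr_mul]

theorem ii_norm {f : ℝ → A} (hf : MemLp f W.P W.μ) :
    ‖ii f hf‖ = (eLpNorm f W.P W.μ).toReal := by
  unfold ii
  rw [WithLp.unitization_norm_inr, norm_def', eLpNorm_congr_ae (W.ac1.ae_eq (fn_mk f hf))]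

theorem BB_eq (x : BB W A) : ∃ (c : ℂ) (g : ℝ → A) (hg : MemLp g W.P W.μ), StronglyMeasurable g ∧
    x = algebraMap ℂ _ c + ii g hg := by
  refine ⟨x.ofLp.fst, W.fn x.ofLp.snd, memLp_fn _, Lp.stronglyMeasurable _, ?_⟩
  have : W.mkE (W.fn x.ofLp.snd) (memLp_fn _) = x.ofLp.snd := EE_ext (fn_mk _ _)
  unfold ii
  rw [this]
  apply (WithLp.unitizationAlgEquiv (𝕜 := ℂ) (A := W.EE A) ℂ).injective
  rw [map_add, AlgEquiv.commutes]
  exact (Unitization.inl_fst_add_inr_snd_eq _).symm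

theorem BB_inj {c d : ℂ} {f g : ℝ → A} (hf : MemLp f W.P W.μ) (hg : MemLp g W.P W.μ)
    (h : algebraMap ℂ (BB W A) c + ii f hf = algebraMap ℂ _ d + ii g hg) :
    c = d ∧ f =ᵐ[volume] g := by
  have h' := congrArg (WithLp.unitizationAlgEquiv (𝕜 := ℂ) (A := W.EE A) ℂ) h
  rw [map_add, map_add, AlgEquiv.commutes, AlgEquiv.commutes] at h'
  have h1 := congrArg (fun u : Unitization ℂ (W.EE A) => u.fst) h'
  have h2 := congrArg (fun u : Unitization ℂ (W.EE A) => u.snd) h'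
  simp [ii, Unitization.algebraMap_eq_inl] at h1 h2
  refine ⟨h1, ?_⟩
  exact (fn_mk f hf).symm.trans (h2 ▸ fn_mk g hg)

theorem memz : MemLp (fun x => er (-1) x • (1 : A)) W.P W.μ := memLp_er (by simp) 1

noncomputable def zz (W : WD) (A : Type*) [NormedRing A] [NormedAlgebra ℂ A] [CompleteSpace A] : BB W A := ii (fun x => er (-1) x • (1 : A)) memz

theorem zz_comm (x : BB W A) : zz W A * x = x * zz W A := by
  obtain ⟨c, g, hg, -, rfl⟩ := BB_eq x
  rw [mul_add, add_mul, Algebra.commutes, zz, ii_mul, ii_mul]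
  congr 1
  refine ii_congr _ _ ?_
  rw [scalar_cv_comm]

theorem zz_unit (l : ℂ) (hl : l ≠ 0) (hk : (1 / l - 1).re ≠ 0) :
    IsUnit (algebraMap ℂ (BB W A) l - zz W A) := by
  set k := 1 / l - 1 with hkd
  have hr : MemLp (fun x => er k x • (1 : A)) W.P W.μ := memLp_er hk 1
  set r : BB W A := ii _ hr with hrd
  have e : (k + 1) • (r * zz W A) = r - zz W A := by
    rw [zz, hrd, ii_mul, ii_smul, ii_sub]
    exact ii_congr _ _ (er_cv hk)
  have hk1 : k + 1 = l⁻¹ := by rw [hkd]; simp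
  have e2 : (algebraMap ℂ (BB W A) l - zz W A) * (l⁻¹ • (1 + l⁻¹ • r)) = 1 := by
    rw [hk1] at e
    rw [Algebra.algebraMap_eq_smul_one]
    simp only [sub_mul, smul_mul_assoc, one_mul, mul_smul_comm, mul_add, mul_one, smul_add, smul_smul]
    rw [zz_comm r, mul_smul, smul_sub (l⁻¹) (l • r), e]
    simp only [smul_sub, smul_smul, inv_mul_cancel₀ hl, one_smul]
    abel
  refine ⟨⟨_, _, e2, ?_⟩, rfl⟩
  refine Eq.trans ?_ e2
  rw [mul_sub, sub_mul, zz_comm, Algebra.commutes]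

theorem zz_dense : Dense {l : ℂ | IsUnit (algebraMap ℂ (BB W A) l - zz W A)} := by
  have h1 : Dense (Metric.sphere (1 / 2 : ℂ) (1 / 2))ᶜ := by
    rw [← interior_eq_empty_iff_dense_compl]
    exact interior_sphere _ (by norm_num)
  refine h1.mono ?_
  intro l hl
  have hl' : l.re ≠ Complex.normSq l := by
    intro h
    apply hl
    rw [mem_sphere_iff_norm, ← sq_eq_sq₀ (norm_nonneg _) (by norm_num), ← Complex.normSq_eq_norm_sq]
    rw [Complex.normSq_apply] at h ⊢
    simp
    nlinarith
  have hl0 : l ≠ 0 := by rintro rfl; simp at hl'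
  apply zz_unit l hl0
  have := Complex.normSq_pos.mpr hl0
  simp
  rw [sub_eq_zero, div_eq_one_iff_eq this.ne']
  exact hl'
end
end WD
end

section
open MeasureTheory
open Filter Topology
set_option linter.unusedSectionVars false
open scoped ENNReal Convolution ContDiff

namespace WD
section
variable {W : WD} {A : Type*} [NormedRing A] [NormedAlgebra ℂ A] [CompleteSpace A]

noncomputable def bb : ℝ → ℝ := (default : ContDiffBump (0 : ℝ)).normed volume

theorem bb_smooth : ContDiff ℝ ∞ bb := ContDiffBump.contDiff_normed _
theorem bb_cs : HasCompactSupport bb := ContDiffBump.hasCompactSupport_normed _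
theorem bb_int : ∫ x, bb x = 1 := ContDiffBump.integral_normed _

theorem bb_memLp (W : WD) : MemLp bb W.P W.μ :=
  (bb_smooth.continuous).memLp_of_hasCompactSupport bb_cs

theorem density0 {H : ℝ → A} (hH : MemLp H W.P W.μ) (h0 : ∫ x, H x = 0) {ε : ℝ} (hε : 0 < ε) :
    ∃ Φ : ℝ → A, ContDiff ℝ 1 Φ ∧ HasCompactSupport Φ ∧
      eLpNorm (H - deriv Φ) W.P W.μ ≤ ENNReal.ofReal ε := by
  set N : ℝ := (eLpNorm bb W.P W.μ).toReal with hN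
  have hNe : eLpNorm bb W.P W.μ = ENNReal.ofReal N :=
    (ENNReal.ofReal_toReal (bb_memLp W).eLpNorm_ne_top).symm
  set M : ℝ := W.cH.toReal with hM
  have hMe : W.cH = ENNReal.ofReal M := (ENNReal.ofReal_toReal W.cH_ne_top).symm
  have hN0 : 0 ≤ N := ENNReal.toReal_nonneg
  have hM0 : 0 ≤ M := ENNReal.toReal_nonneg
  set δ := ε / (1 + M * N) with hδ
  have hδ0 : 0 < δ := by positivity
  obtain ⟨H₁, hc1, hs1, hb1⟩ := hH.exist_eLpNorm_sub_le W.P_ne_top W.fact_P.out hδ0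
  have hm1 : MemLp H₁ W.P W.μ := memLp_cc hs1.continuous hc1
  set c : A := ∫ x, H₁ x with hcd
  have hcn : ‖c‖ₑ ≤ ENNReal.ofReal (δ * M) := by
    have : c = ∫ x, (H₁ - H) x := by
      simp only [Pi.sub_apply]
      rw [integral_sub (W.memLp_integrable hm1) (W.memLp_integrable hH), h0, sub_zero]
    rw [this]
    refine (enorm_integral_le_lintegral_enorm _).trans ?_
    refine (W.lintegral_enorm_le (hm1.sub hH)).trans ?_
    rw [ENNReal.ofReal_mul hδ0.le, hMe, eLpNorm_sub_comm]
    gcongr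
  set H₂ : ℝ → A := fun x => H₁ x - bb x • c with hH2
  have hs2 : ContDiff ℝ ∞ H₂ := hs1.sub (bb_smooth.smul contDiff_const)
  have hc2 : HasCompactSupport H₂ := hc1.sub (bb_cs.smul_right)
  have hi2 : ∫ x, H₂ x = 0 := by
    rw [integral_sub (W.memLp_integrable hm1)
      ((bb_smooth.continuous.integrable_of_hasCompactSupport bb_cs).smul_const c),
      integral_smul_const, bb_int, one_smul, hcd, sub_self]
  obtain ⟨R, hR⟩ := hc2.isCompact.isBounded.exists_norm_le
  have hsupp : ∀ x, R < |x| → H₂ x = 0 := by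
    intro x hx
    by_contra hne
    exact absurd (hR x (subset_tsupport _ hne)) (not_le.mpr hx)
  set Φ : ℝ → A := fun x => ∫ t in (-R - 1)..x, H₂ t with hΦ
  have hd : ∀ x, HasDerivAt Φ (H₂ x) x := fun x => by
    exact intervalIntegral.integral_hasDerivAt_right (hs2.continuous.intervalIntegrable _ _)
      (hs2.continuous.stronglyMeasurableAtFilter _ _) hs2.continuous.continuousAt
  have hdd : deriv Φ = H₂ := funext fun x => (hd x).deriv
  refine ⟨Φ, ?_, ?_, ?_⟩
  · rw [contDiff_one_iff_deriv, hdd]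
    exact ⟨fun x => (hd x).differentiableAt, hs2.continuous⟩
  · refine HasCompactSupport.intro (isCompact_Icc (a := -R - 1) (b := R + 1)) ?_
    intro x hx
    rw [Set.mem_Icc, not_and_or, not_le, not_le] at hx
    rcases hx with hx | hx
    · rw [hΦ]
      have : Set.EqOn H₂ 0 (Set.uIcc (-R - 1) x) := by
        intro t ht
        rw [Set.uIcc_of_ge hx.le, Set.mem_Icc] at ht
        apply hsupp
        rw [lt_abs]; right; linarith
      simp only
      rw [intervalIntegral.integral_congr this]
      simp
    · rw [hΦ]
      simp only
      rw [intervalIntegral.integral_eq_integral_of_support_subset, hi2]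
      intro t ht
      have : ¬ R < |t| := fun h => ht (hsupp t h)
      rw [not_lt, abs_le] at this
      constructor <;> linarith
  · rw [hdd]
    have e : H - H₂ = (H - H₁) + fun x => bb x • c := by
      ext x; simp [hH2]; abel
    rw [e]
    have hb : MemLp (fun x => bb x • c) W.P W.μ :=
      memLp_cc (bb_smooth.continuous.smul continuous_const) bb_cs.smul_right
    refine (eLpNorm_add_le (hH.1.sub hm1.1) hb.1 W.fact_P.out).trans ?_
    have h3 : eLpNorm (fun x => bb x • c) W.P W.μ ≤ ENNReal.ofReal (δ * M) * ENNReal.ofReal N := by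
      rw [← hNe]
      have hcn' : ‖c‖ ≤ δ * M := by
        rw [← ofReal_norm] at hcn
        exact (ENNReal.ofReal_le_ofReal_iff (by positivity)).mp hcn
      refine eLpNorm_le_mul_eLpNorm_of_ae_le_mul (ae_of_all _ fun x => ?_) _
      rw [norm_smul, mul_comm]
      gcongr
    calc _ ≤ ENNReal.ofReal δ + ENNReal.ofReal (δ * M) * ENNReal.ofReal N := by gcongr
      _ = ENNReal.ofReal ε := by
          rw [← ENNReal.ofReal_mul (by positivity), ← ENNReal.ofReal_add (by positivity) (by positivity)]
          congr 1
          rw [hδ]; field_simp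

noncomputable def ee (t : ℝ) (x : ℝ) : ℂ := Complex.exp (Complex.I * (t : ℂ) * (x : ℂ))

theorem ee_norm (t x : ℝ) : ‖ee t x‖ = 1 := by
  unfold ee
  rw [Complex.norm_exp]; simp

theorem ee_inv (t x : ℝ) : ee (-t) x * ee t x = 1 := by
  unfold ee
  rw [← Complex.exp_add, ← Complex.exp_zero]; congr 1; push_cast; ring

theorem ee_smooth (t : ℝ) : ContDiff ℝ ∞ (ee t) := by
  unfold ee
  have : ContDiff ℝ ∞ (fun x : ℝ => (x : ℂ)) := Complex.ofRealCLM.contDiff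
  fun_prop

theorem ee_deriv (t x : ℝ) : HasDerivAt (ee t) (Complex.I * t * ee t x) x := by
  unfold ee
  have h := ((hasDerivAt_id (x : ℂ)).const_mul (Complex.I * (t : ℂ))).cexp.comp_ofReal
  simp at h
  convert h using 1
  ring

theorem ee_memLp (t : ℝ) {h : ℝ → A} (hh : MemLp h W.P W.μ) :
    MemLp (fun x => ee t x • h x) W.P W.μ := by
  refine hh.congr_norm ((ee_smooth t).continuous.aestronglyMeasurable.smul hh.1) (ae_of_all _ fun x => ?_)
  rw [norm_smul, ee_norm, one_mul]

theorem ee_hd (t x : ℝ) {Φ : ℝ → A} {Φ' : A} (h : HasDerivAt Φ Φ' x) :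
    HasDerivAt (fun x => ee (-t) x • Φ x) (ee (-t) x • Φ' +
      (Complex.I * (-t : ℝ) * ee (-t) x) • Φ x) x :=
  (ee_deriv (-t) x).smul h

theorem ee_alg (t x : ℝ) (a b c : A) :
    a - (ee (-t) x • b + (Complex.I * (-t : ℝ) * ee (-t) x) • c +
      (Complex.I * t) • ee (-t) x • c) = ee (-t) x • (ee t x • a - b) := by
  rw [smul_sub, smul_smul, smul_smul, ee_inv, one_smul]
  push_cast
  have e : Complex.I * -(t : ℂ) * ee (-t) x = - (Complex.I * (t : ℂ) * ee (-t) x) := by ring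
  rw [e, neg_smul]
  abel

theorem ee_norm_eq (t x : ℝ) {h Φ : ℝ → A} (h1 : Differentiable ℝ Φ) :
    ‖(h - (deriv (fun x => ee (-t) x • Φ x) + (Complex.I * (t : ℂ)) • (fun x => ee (-t) x • Φ x))) x‖
    = ‖((fun x => ee t x • h x) - deriv Φ) x‖ := by
  simp only [Pi.sub_apply, Pi.add_apply, Pi.smul_apply]
  rw [(ee_hd t x (h1 x).hasDerivAt).deriv, ee_alg, norm_smul, ee_norm, one_mul]

theorem ee_cd (t : ℝ) {Φ : ℝ → A} (h : ContDiff ℝ 1 Φ) : ContDiff ℝ 1 (fun x => ee (-t) x • Φ x) := by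
  have k1 : ContDiff ℝ 1 (ee (-t)) := (ee_smooth (-t)).of_le (by exact_mod_cast le_top)
  exact k1.smul h

theorem density (t : ℝ) {h : ℝ → A} (hh : MemLp h W.P W.μ) (h0 : ∫ x, ee t x • h x = 0) {ε : ℝ}
    (hε : 0 < ε) : ∃ φ : ℝ → A, ContDiff ℝ 1 φ ∧ HasCompactSupport φ ∧
      eLpNorm (h - (deriv φ + (Complex.I * (t : ℂ)) • φ)) W.P W.μ ≤ ENNReal.ofReal ε := by
  obtain ⟨Φ, h1, h2, h3⟩ := density0 (ee_memLp t hh) h0 hε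
  have k3 : HasCompactSupport (fun x => ee (-t) x • Φ x) := by
    have : (fun x => ee (-t) x • Φ x) = (ee (-t)) • Φ := rfl
    rw [this]
    exact h2.smul_left
  have k4 : ∀ᵐ x ∂W.μ, ‖(h - (deriv (fun x => ee (-t) x • Φ x) +
      (Complex.I * (t : ℂ)) • (fun x => ee (-t) x • Φ x))) x‖
    = ‖((fun x => ee t x • h x) - deriv Φ) x‖ :=
    ae_of_all _ fun x => ee_norm_eq t x (h1.differentiable one_ne_zero)
  have k5 := eLpNorm_congr_norm_ae (p := W.P) k4
  rw [← k5] at h3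
  exact ⟨_, ee_cd t h1, k3, h3⟩

theorem ee_cv (t : ℝ) (f g : ℝ → A) :
    (fun x => ee t x • cv f g x) = cv (fun x => ee t x • f x) (fun x => ee t x • g x) := by
  ext x
  simp only [cv, convolution_def]
  rw [← integral_smul]
  congr 1; ext s
  simp only [ContinuousLinearMap.mul_apply', smul_mul_smul_comm]
  congr 1
  unfold ee
  rw [← Complex.exp_add]; congr 1; push_cast; ring

theorem ee_int_cv (t : ℝ) {f g : ℝ → A} (hf : MemLp f W.P W.μ) (hg : MemLp g W.P W.μ) :
    ∫ x, ee t x • cv f g x = (∫ x, ee t x • f x) * ∫ x, ee t x • g x := by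
  rw [ee_cv]
  exact integral_convolution (ContinuousLinearMap.mul ℝ A)
    (W.memLp_integrable (ee_memLp t hf)) (W.memLp_integrable (ee_memLp t hg))

end
end WD
end

section
open MeasureTheory
open Filter Topology
set_option linter.unusedSectionVars false
open scoped ENNReal Convolution ContDiff

theorem solve_approx {B : Type*} [NormedRing B] [CompleteSpace B] {b c u v : B}
    (h : ‖u * b + v * c - 1‖ < 1) : ∃ u v, u * b + v * c = 1 := by
  rw [norm_sub_rev] at h
  set s := Units.oneSub _ h with hs
  have : (s : B) = u * b + v * c := by rw [hs]; simp
  refine ⟨s⁻¹ * u, s⁻¹ * v, ?_⟩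
  rw [mul_assoc, mul_assoc, ← mul_add, ← this]
  simp

namespace WD
section
variable {W : WD} {A : Type*} [NormedRing A] [NormedAlgebra ℂ A] [CompleteSpace A]

theorem memLp_phi {φ : ℝ → A} (h1 : ContDiff ℝ 1 φ) (h2 : HasCompactSupport φ) :
    MemLp φ W.P W.μ ∧ MemLp (deriv φ) W.P W.μ :=
  ⟨memLp_cc h1.continuous h2, memLp_cc (h1.continuous_deriv le_rfl) h2.deriv⟩

theorem zz_mul_phi {φ : ℝ → A} (h1 : ContDiff ℝ 1 φ) (h2 : HasCompactSupport φ)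
    (h3 : MemLp (φ + deriv φ) W.P W.μ) (h4 : MemLp φ W.P W.μ) :
    ii (φ + deriv φ) h3 * zz W A = ii φ h4 := by
  rw [← zz_comm, zz, ii_mul]
  exact ii_congr _ _ (by rw [er_cv_deriv h1 h2])

theorem loc_zero {f : ℝ → A} (hf : MemLp f W.P W.μ) :
    ∃ u v : BB W A, u * (1 + ii f hf) + v * (algebraMap ℂ (BB W A) 0 - zz W A) = 1 := by
  obtain ⟨φ, hc, hs, hb⟩ := hf.exist_eLpNorm_sub_le W.P_ne_top W.fact_P.out
    (show (0 : ℝ) < 1 / 2 by norm_num)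
  have h1 : ContDiff ℝ 1 φ := hs.of_le (by exact_mod_cast le_top)
  obtain ⟨m1, m2⟩ := memLp_phi (W := W) h1 hc
  apply solve_approx (u := 1) (v := ii (φ + deriv φ) (m1.add m2))
  have : 1 * (1 + ii f hf) + ii (φ + deriv φ) (m1.add m2) * (algebraMap ℂ (BB W A) 0 - zz W A) - 1
      = ii (f - φ) (hf.sub m1) := by
    rw [map_zero, zero_sub, mul_neg, zz_mul_phi h1 hc _ m1, ← ii_sub hf m1]
    simp; abel
  rw [this, ii_norm]
  refine lt_of_le_of_lt (ENNReal.toReal_mono ENNReal.ofReal_ne_top hb) ?_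
  rw [ENNReal.toReal_ofReal (by norm_num)]; norm_num

theorem loc_circle {f : ℝ → A} (hf : MemLp f W.P W.μ) (l : ℂ) (hl : l ≠ 0) (t : ℝ)
    (hlt : l⁻¹ = 1 - Complex.I * t) (u₀ : A) (hu : u₀ * (1 + ∫ x, ee t x • f x) = 1) :
    ∃ u v : BB W A, u * (1 + ii f hf) + v * (algebraMap ℂ (BB W A) l - zz W A) = 1 := by
  set ρ : ℝ → A := fun x => ee (-t) x • (bb x • (u₀ - 1)) with hρ
  have hb : MemLp (fun x => bb x • (u₀ - 1)) W.P W.μ :=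
    memLp_cc (bb_smooth.continuous.smul continuous_const) bb_cs.smul_right
  have hρm : MemLp ρ W.P W.μ := ee_memLp _ hb
  have hρi : ∫ x, ee t x • ρ x = u₀ - 1 := by
    have : ∀ x, ee t x • ρ x = bb x • (u₀ - 1) := by
      intro x
      rw [hρ]
      simp only
      rw [smul_smul, mul_comm, ee_inv, one_smul]
    simp only [this]
    rw [integral_smul_const, bb_int, one_smul]
  have hcm : MemLp (cv ρ f) W.P W.μ := W.memLp_cv hρm hf
  have hhm : MemLp (f + (ρ + cv ρ f)) W.P W.μ := hf.add (hρm.add hcm)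
  have h0 : ∫ x, ee t x • (f + (ρ + cv ρ f)) x = 0 := by
    simp only [Pi.add_apply, smul_add]
    have i1 := W.memLp_integrable (ee_memLp t hf)
    have i2 := W.memLp_integrable (ee_memLp t hρm)
    have i3 := W.memLp_integrable (ee_memLp t hcm)
    have i4 : Integrable (fun x => ee t x • ρ x + ee t x • cv ρ f x) := i2.add i3
    rw [integral_add i1 i4, integral_add i2 i3, ee_int_cv t hρm hf, hρi]
    have : u₀ * (1 + ∫ x, ee t x • f x) - 1 = 0 := by rw [hu, sub_self]
    rw [← this, mul_add, sub_mul]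
    simp; abel
  obtain ⟨φ, h1, h2, h3⟩ := density t hhm h0 (show (0 : ℝ) < 1 / 2 by norm_num)
  obtain ⟨m1, m2⟩ := memLp_phi (W := W) h1 h2
  have m3 : MemLp (deriv φ + (Complex.I * (t : ℂ)) • φ) W.P W.μ := m2.add (m1.const_smul _)
  apply solve_approx (u := 1 + ii ρ hρm) (v := - l⁻¹ • ii (φ + deriv φ) (m1.add m2))
  have e1 : (1 + ii ρ hρm) * (1 + ii f hf) = 1 + ii _ hhm := by
    rw [← ii_add hf (hρm.add hcm), ← ii_add hρm hcm, ← ii_mul hρm hf]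
    noncomm_ring
  have e2 : (- l⁻¹ • ii (φ + deriv φ) (m1.add m2)) * (algebraMap ℂ (BB W A) l - zz W A) =
      - ii _ m3 := by
    rw [mul_sub, smul_mul_assoc, smul_mul_assoc, zz_mul_phi h1 h2 _ m1, ← Algebra.commutes, ← Algebra.smul_def,
      smul_smul, neg_mul, inv_mul_cancel₀ hl, hlt, ← ii_add m1 m2, ← ii_add m2 (m1.const_smul _),
      ← ii_smul _ m1]
    simp only [neg_smul, sub_smul, one_smul]
    abel
  rw [e1, e2]
  have : 1 + ii _ hhm + - ii _ m3 - 1 = ii _ (hhm.sub m3) := by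
    rw [← ii_sub hhm m3]; abel
  rw [this, ii_norm]
  refine lt_of_le_of_lt (ENNReal.toReal_mono ENNReal.ofReal_ne_top h3) ?_
  rw [ENNReal.toReal_ofReal (by norm_num)]; norm_num

theorem BB_left_inv {f : ℝ → A} (hf : MemLp f W.P W.μ)
    (hinv : ∀ t : ℝ, ∃ u : A, u * (1 + ∫ x, ee t x • f x) = 1) :
    ∃ u : BB W A, u * (1 + ii f hf) = 1 := by
  apply left_inv_of_local (zz W A) _ zz_comm zz_dense
  intro l
  by_cases hl : l = 0
  · subst hl
    exact loc_zero hf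
  by_cases hk : (1 / l - 1).re = 0
  · obtain ⟨u₀, hu⟩ := hinv (-(l⁻¹).im)
    refine loc_circle hf l hl _ ?_ u₀ hu
    rw [one_div, Complex.sub_re, Complex.one_re, sub_eq_zero] at hk
    apply Complex.ext
    · rw [hk]; simp
    · simp
  · obtain ⟨w, hw⟩ := zz_unit (W := W) (A := A) l hl hk
    refine ⟨0, (w⁻¹ : (BB W A)ˣ), ?_⟩
    rw [← hw]; simp

theorem core {f : ℝ → A} (hf : MemLp f W.P W.μ)
    (hinv : ∀ t : ℝ, ∃ u : A, u * (1 + ∫ x, ee t x • f x) = 1) :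
    ∃ g : ℝ → A, StronglyMeasurable g ∧ MemLp g W.P W.μ ∧
      ∀ᵐ x : ℝ, f x + g x + (∫ t : ℝ, g (x - t) * f t) = 0 := by
  obtain ⟨u, hu⟩ := BB_left_inv hf hinv
  obtain ⟨c, g, hg, hgm, rfl⟩ := BB_eq u
  have hcm := W.memLp_cv hg hf
  have e : algebraMap ℂ (BB W A) c + ii _ ((hf.const_smul c).add (hg.add hcm)) =
      algebraMap ℂ (BB W A) 1 + ii (0 : ℝ → A) MemLp.zero := by
    have z : ii (W := W) (0 : ℝ → A) MemLp.zero = 0 := by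
      have := ii_sub (W := W) (MemLp.zero (ε := A)) (MemLp.zero (ε := A))
      rw [sub_self] at this
      rw [this]
      exact ii_congr _ _ (by simp)
    rw [z, map_one, add_zero, ← hu, ← ii_add (hf.const_smul c) (hg.add hcm), ← ii_add hg hcm,
      ← ii_smul c hf, ← ii_mul hg hf, Algebra.smul_def]
    noncomm_ring
  obtain ⟨rfl, h2⟩ := BB_inj _ _ e
  refine ⟨g, hgm, hg, ?_⟩
  filter_upwards [h2] with x hx
  simp only [Pi.add_apply, one_smul, Pi.zero_apply] at hx
  rw [← hx, add_assoc]
  congr 2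
  rw [cv, convolution_eq_swap]
  rfl

end
end WD
end

section
open MeasureTheory
open Filter Topology
set_option linter.unusedSectionVars false
open scoped ENNReal Convolution

theorem conv_integrable {q : ℝ} {ω : ℝ → ℝ} (hq : 0 < q) (hm : Measurable ω) (h1 : ∀ x, 1 ≤ ω x)
    (hi : Integrable fun x : ℝ => ω x ^ (-q)) (x : ℝ) :
    Integrable (fun t => ω t ^ (-q) * ω (x - t) ^ (-q)) := by
  refine hi.mono' ?_ (ae_of_all _ fun t => ?_)
  · have : Measurable (fun t => ω t ^ (-q) * ω (x - t) ^ (-q)) := by fun_prop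
    exact this.aestronglyMeasurable
  · have a1 : 0 ≤ ω t ^ (-q) := Real.rpow_nonneg (zero_le_one.trans (h1 t)) _
    have a2 : 0 ≤ ω (x - t) ^ (-q) := Real.rpow_nonneg (zero_le_one.trans (h1 _)) _
    have a3 : ω (x - t) ^ (-q) ≤ 1 := Real.rpow_le_one_of_one_le_of_nonpos (h1 _) (by linarith)
    rw [Real.norm_of_nonneg (by positivity)]
    nlinarith

theorem conv_lintegral {q : ℝ} {ω : ℝ → ℝ} (hq : 0 < q) (hω : IsAMAWR q ω) (x : ℝ) :
    ∫⁻ t, ENNReal.ofReal (ω t ^ (-q)) * ENNReal.ofReal (ω (x - t) ^ (-q)) ≤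
      ENNReal.ofReal (ω x ^ (-q)) := by
  obtain ⟨⟨hm, h1, -⟩, hc, hi, -, -⟩ := hω
  have hp : ∀ t, 0 ≤ ω t ^ (-q) := fun t => Real.rpow_nonneg (zero_le_one.trans (h1 t)) _
  have e := ofReal_integral_eq_lintegral_ofReal (conv_integrable hq hm h1 hi x)
    (ae_of_all _ fun t => mul_nonneg (hp t) (hp _))
  calc _ = ∫⁻ t, ENNReal.ofReal (ω t ^ (-q) * ω (x - t) ^ (-q)) := by
        congr 1; ext t; rw [ENNReal.ofReal_mul (hp t)]
    _ ≤ _ := by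
        rw [← e]
        exact ENNReal.ofReal_le_ofReal (hc x)

/-- package an almost monotone algebra weight of subexponential growth -/
noncomputable def mkWD {p q : ℝ} (hpq : p.HolderConjugate q) {ω : ℝ → ℝ} (hω : IsAMAWR q ω)
    (hs : ∀ ε > 0, ∃ C, ∀ x, ω x ≤ C * Real.exp (ε * |x|)) : WD where
  p := p
  q := q
  ω := ω
  hpq := hpq
  meas := hω.1.1
  one_le := hω.1.2.1
  conv := by
    intro x
    have := conv_lintegral hpq.symm.pos hω x
    have h0 : ∀ x, 0 < ω x := fun x => zero_lt_one.trans_le (hω.1.2.1 x)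
    simpa only [ENNReal.ofReal_rpow_of_pos (h0 _)] using this
  int := by
    have := hω.2.2.1.lintegral_lt_top
    have h0 : ∀ x, 0 < ω x := fun x => zero_lt_one.trans_le (hω.1.2.1 x)
    simp only [ENNReal.ofReal_rpow_of_pos (h0 _)]
    exact this.ne
  subexp := hs

theorem WD.memLp_iff {W : WD} {A : Type*} [NormedRing A] [NormedAlgebra ℂ A] [CompleteSpace A]
    {f : ℝ → A} (hf : StronglyMeasurable f) :
    MemLp f W.P W.μ ↔ Integrable fun x => ‖f x‖ ^ W.p * W.ω x ^ W.p := by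
  have hp := W.p_pos
  have h0 : ∀ x, 0 ≤ W.ω x := fun x => zero_le_one.trans (W.one_le x)
  have hm : Measurable fun x => ‖f x‖ ^ W.p * W.ω x ^ W.p :=
    (hf.norm.measurable.pow_const _).mul (W.meas.pow_const _)
  have e : ∀ x, (‖f x‖ₑ * W.w x) ^ W.p = ENNReal.ofReal (‖f x‖ ^ W.p * W.ω x ^ W.p) := by
    intro x
    rw [← Real.mul_rpow (norm_nonneg _) (h0 x), WD.w, ← ofReal_norm,
      ← ENNReal.ofReal_mul (norm_nonneg _),
      ENNReal.ofReal_rpow_of_nonneg (mul_nonneg (norm_nonneg _) (h0 x)) hp.le]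
  rw [MemLp, W.aesm_iff, WD.eLpNorm_eq]
  simp only [e]
  rw [← lintegral_ofReal_ne_top_iff_integrable hm.aestronglyMeasurable
    (ae_of_all _ fun x => mul_nonneg (Real.rpow_nonneg (norm_nonneg _) _) (Real.rpow_nonneg (h0 x) _)),
    ENNReal.rpow_lt_top_iff_of_pos (by positivity), lt_top_iff_ne_top]
  simp [hf.aestronglyMeasurable]

theorem final_of_weight {A : Type*} [NormedRing A] [NormedAlgebra ℂ A] [CompleteSpace A]
    {p q : ℝ} (hpq : p.HolderConjugate q) {ω : ℝ → ℝ} (hω : IsAMAWR q ω)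
    (hs : ∀ ε > 0, ∃ C, ∀ x, ω x ≤ C * Real.exp (ε * |x|))
    (f : ℝ → A) (hfm : StronglyMeasurable f)
    (hfi : Integrable fun x => ‖f x‖ ^ p * ω x ^ p)
    (hinv : ∀ t : ℝ, ∃ u : A,
      u * (1 + ∫ x : ℝ, Complex.exp (Complex.I * (t : ℂ) * (x : ℂ)) • f x) = 1) :
    ∃ g : ℝ → A, StronglyMeasurable g ∧
        (Integrable fun x => ‖g x‖ ^ p * ω x ^ p) ∧
        ∀ᵐ x : ℝ, f x + g x + (∫ t : ℝ, g (x - t) * f t) = 0 := by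
  have hf : MemLp f (mkWD hpq hω hs).P (mkWD hpq hω hs).μ := (WD.memLp_iff hfm).mpr hfi
  obtain ⟨g, h1, h2, h3⟩ := WD.core hf hinv
  exact ⟨g, h1, (WD.memLp_iff h1).mp h2, h3⟩

/-- subexponential growth on the right half line -/
theorem subexp_right {ω : ℝ → ℝ} (h1 : ∀ x, 1 ≤ ω x) (hsub : ∀ x y, ω (x + y) ≤ ω x * ω y)
    (h2 : rho2R ω = 0) {K : ℝ} (hK : 0 < K)
    (hmono : ∀ x y : ℝ, 0 ≤ x → 0 ≤ y → ω x ≤ K * ω (x + y)) :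
    ∀ ε > 0, ∃ C, ∀ x ≥ 0, ω x ≤ C * Real.exp (ε * x) := by
  intro ε hε
  have hne : {r : ℝ | ∃ x : ℝ, 0 < x ∧ r = Real.log (ω x) / x}.Nonempty := ⟨_, 1, one_pos, rfl⟩
  obtain ⟨r, ⟨x₀, hx₀, rfl⟩, hr⟩ := exists_lt_of_csInf_lt hne (show rho2R ω < ε by rw [h2]; exact hε)
  have h0 : 0 < ω x₀ := zero_lt_one.trans_le (h1 _)
  have hlt : ω x₀ ≤ Real.exp (ε * x₀) := by
    rw [div_lt_iff₀ hx₀] at hr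
    exact ((Real.log_lt_iff_lt_exp h0).mp hr).le
  have hpow : ∀ n : ℕ, ω ((n + 1 : ℕ) * x₀) ≤ Real.exp (ε * x₀) ^ (n + 1) := by
    intro n
    induction n with
    | zero => simpa using hlt
    | succ n ih =>
      have : ((n + 1 + 1 : ℕ) : ℝ) * x₀ = (n + 1 : ℕ) * x₀ + x₀ := by push_cast; ring
      rw [this, pow_succ]
      refine (hsub _ _).trans ?_
      have := zero_le_one.trans (h1 ((n + 1 : ℕ) * x₀))
      gcongr
  refine ⟨K * Real.exp (ε * x₀), fun x hx => ?_⟩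
  set n := ⌊x / x₀⌋₊ with hn
  have a1 : x < (n + 1) * x₀ := by
    have := Nat.lt_floor_add_one (x / x₀)
    rwa [div_lt_iff₀ hx₀] at this
  have a2 : n * x₀ ≤ x := by
    have := Nat.floor_le (div_nonneg hx hx₀.le)
    rwa [le_div_iff₀ hx₀] at this
  have a3 := hmono x ((n + 1) * x₀ - x) hx (by linarith)
  rw [add_sub_cancel] at a3
  have a4 := hpow n
  push_cast at a4
  calc ω x ≤ K * ω ((n + 1) * x₀) := a3
    _ ≤ K * Real.exp (ε * x₀) ^ (n + 1) := by gcongr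
    _ = K * Real.exp (ε * x₀) * Real.exp (ε * (n * x₀)) := by
        rw [← Real.exp_nat_mul, mul_assoc, ← Real.exp_add]; congr 2; push_cast; ring
    _ ≤ _ := by gcongr

theorem rho2R_neg (ω : ℝ → ℝ) : rho2R (fun x => ω (-x)) = - rho1R ω := by
  unfold rho1R rho2R
  rw [Real.sInf_def]
  congr 2
  ext r
  simp only [Set.mem_neg, Set.mem_ofPred_eq]
  constructor
  · rintro ⟨x, hx, h⟩
    refine ⟨-x, by linarith, ?_⟩
    rw [div_neg, ← h, neg_neg]
  · rintro ⟨x, hx, h⟩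
    refine ⟨-x, by linarith, ?_⟩
    rw [neg_neg, div_neg, h]

theorem rho1R_neg (ω : ℝ → ℝ) : rho1R (fun x => ω (-x)) = - rho2R ω := by
  have := rho2R_neg (fun x => ω (-x))
  simp only [neg_neg] at this
  rw [this, neg_neg]

theorem IsAMAWR.reflect {q : ℝ} {ω : ℝ → ℝ} (hω : IsAMAWR q ω) : IsAMAWR q (fun x => ω (-x)) := by
  obtain ⟨⟨hm, h1, h2⟩, hc, hi, h3, h4⟩ := hω
  refine ⟨⟨hm.comp measurable_neg, fun x => h1 _, fun x y => ?_⟩, ?_, hi.comp_neg, ?_, ?_⟩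
  · simp only [neg_add]; exact h2 _ _
  · intro x
    have := hc (-x)
    rw [← integral_neg_eq_self] at this
    have e : ∀ t, -(x - t) = -x - -t := fun t => by ring
    simp only [e]
    exact this
  · intro h
    rw [rho1R_neg, neg_eq_zero] at h
    obtain ⟨K, hK, hh⟩ := h4 h
    refine ⟨K, hK, fun x y hx hy => ?_⟩
    simp only [neg_add]
    exact hh _ _ (by linarith) (by linarith)
  · intro h
    rw [rho2R_neg, neg_eq_zero] at h
    obtain ⟨K, hK, hh⟩ := h3 h
    refine ⟨K, hK, fun x y hx hy => ?_⟩
    simp only [neg_add]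
    exact hh _ _ (by linarith) (by linarith)

theorem subexp_adm {q : ℝ} {ω : ℝ → ℝ} (hω : IsAMAWR q ω) (h : IsAdmissibleR ω) :
    ∀ ε > 0, ∃ C, ∀ x, ω x ≤ C * Real.exp (ε * |x|) := by
  intro ε hε
  have hr : ∀ ω : ℝ → ℝ, IsAMAWR q ω → rho2R ω = 0 → ∃ C, ∀ x ≥ 0, ω x ≤ C * Real.exp (ε * x) := by
    intro ω hω h
    obtain ⟨K, hK, hm⟩ := hω.2.2.2.2 h
    exact subexp_right hω.1.2.1 hω.1.2.2 h hK hm ε hε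
  obtain ⟨C1, h1⟩ := hr ω hω h.2
  obtain ⟨C2, h2⟩ := hr _ hω.reflect (by rw [rho2R_neg, h.1, neg_zero])
  refine ⟨max C1 C2, fun x => ?_⟩
  rcases le_total 0 x with hx | hx
  · refine (h1 x hx).trans ?_
    rw [abs_of_nonneg hx]
    gcongr
    exact le_max_left _ _
  · have := h2 (-x) (by linarith)
    simp only [neg_neg] at this
    refine this.trans ?_
    rw [abs_of_nonpos hx]
    gcongr
    exact le_max_right _ _
end

section
open MeasureTheory
open Filter Topology
set_option linter.unusedSectionVars false
open scoped ENNReal Convolution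

structure HW (q K : ℝ) (m : ℝ → ℝ) : Prop where
  meas : Measurable m
  one_le : ∀ x, 1 ≤ m x
  mono : ∀ x y, 0 ≤ x → 0 ≤ y → m x ≤ K * m (x + y)
  sub : ∀ x y, 0 ≤ x → 0 ≤ y → m (x + y) ≤ K * (m x * m y)
  conv : ∀ x, 0 ≤ x → ∫⁻ t in Set.Ioo 0 x, ENNReal.ofReal (m t ^ (-q)) *
    ENNReal.ofReal (m (x - t) ^ (-q)) ≤ ENNReal.ofReal K * ENNReal.ofReal (m x ^ (-q))
  int : ∫⁻ t in Set.Ioi 0, ENNReal.ofReal (m t ^ (-q)) ≤ ENNReal.ofReal K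
  subexp : ∀ ε > 0, ∃ C, ∀ x ≥ 0, m x ≤ C * Real.exp (ε * x)

theorem HW.le {q K K' : ℝ} {m : ℝ → ℝ} (h : HW q K m) (hK : K ≤ K') : HW q K' m where
  meas := h.meas
  one_le := h.one_le
  mono x y hx hy := (h.mono x y hx hy).trans (by
    have := zero_le_one.trans (h.one_le (x + y)); gcongr)
  sub x y hx hy := (h.sub x y hx hy).trans (by
    have := zero_le_one.trans (h.one_le x)
    have := zero_le_one.trans (h.one_le y); gcongr)
  conv x hx := (h.conv x hx).trans (by gcongr)
  int := h.int.trans (by gcongr)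
  subexp := h.subexp

theorem poly_le_exp {ε : ℝ} (hε : 0 < ε) :
    ∃ C : ℝ, ∀ x ≥ 0, (1 + |x|) ^ 2 ≤ C * Real.exp (ε * x) := by
  set D := max 1 (2 / ε) with hD
  have h1 : 1 ≤ D := le_max_left _ _
  have h2 : 2 / ε ≤ D := le_max_right _ _
  refine ⟨D ^ 2, fun x hx => ?_⟩
  rw [abs_of_nonneg hx]
  have a : 1 + x ≤ D * Real.exp (ε / 2 * x) := by
    have b := Real.add_one_le_exp (ε / 2 * x)
    have c : 1 ≤ D * (ε / 2) := by
      calc (1 : ℝ) = 2 / ε * (ε / 2) := by field_simp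
        _ ≤ _ := by gcongr
    calc 1 + x ≤ D * (ε / 2 * x + 1) := by nlinarith
      _ ≤ _ := by gcongr
  calc (1 + x) ^ 2 ≤ (D * Real.exp (ε / 2 * x)) ^ 2 := by gcongr
    _ = _ := by rw [mul_pow, ← Real.exp_nat_mul]; congr 2; push_cast; ring

theorem HW_poly {q : ℝ} (hq : 1 < q) : ∃ K, HW q K (fun x => (1 + |x|) ^ 2) := by
  set m : ℝ → ℝ := fun x => (1 + |x|) ^ 2 with hm
  have hmeas : Measurable m := by fun_prop
  have h1 : ∀ x, 1 ≤ m x := fun x => by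
    have := abs_nonneg x; simp only [hm]; nlinarith
  have hi : Integrable (fun x => m x ^ (-q)) := by
    have := integrable_one_add_norm (E := ℝ) (μ := volume) (r := 2 * q) (by simp; linarith)
    refine this.congr (ae_of_all _ fun x => ?_)
    simp only [hm]
    rw [← Real.rpow_natCast, ← Real.rpow_mul (by positivity), Real.norm_eq_abs]
    congr 1; push_cast; ring
  set J := ∫⁻ t, ENNReal.ofReal (m t ^ (-q)) with hJ
  have hJt : J ≠ ⊤ := hi.lintegral_lt_top.ne
  set K := max (max 1 J.toReal) (4 ^ q * (2 * J.toReal)) with hK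
  have k1 : 1 ≤ K := (le_max_left _ _).trans (le_max_left _ _)
  have k2 : J ≤ ENNReal.ofReal K := by
    rw [← ENNReal.ofReal_toReal hJt]
    exact ENNReal.ofReal_le_ofReal ((le_max_right _ _).trans (le_max_left _ _))
  have k3 : ENNReal.ofReal (4 ^ q) * (2 * J) ≤ ENNReal.ofReal K := by
    have : ENNReal.ofReal (4 ^ q) * (2 * J) = ENNReal.ofReal (4 ^ q * (2 * J.toReal)) := by
      rw [ENNReal.ofReal_mul (by positivity), ENNReal.ofReal_mul (by norm_num),
        ENNReal.ofReal_toReal hJt]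
      simp
    rw [this]
    exact ENNReal.ofReal_le_ofReal (le_max_right _ _)
  refine ⟨K, hmeas, h1, ?_, ?_, ?_, ?_, ?_⟩
  · intro x y hx hy
    have : m x ≤ m (x + y) := by
      simp only [hm]
      rw [abs_of_nonneg hx, abs_of_nonneg (by positivity)]
      gcongr; linarith
    have := h1 (x + y)
    nlinarith
  · intro x y hx hy
    have : m (x + y) ≤ m x * m y := by
      simp only [hm]
      rw [← mul_pow, abs_of_nonneg hx, abs_of_nonneg hy, abs_of_nonneg (by positivity)]
      gcongr
      nlinarith
    have := h1 x
    have := h1 y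
    have : 0 ≤ m x * m y := by positivity
    nlinarith
  · intro x hx
    have hp : ∀ t, 0 ≤ m t ^ (-q) := fun t => Real.rpow_nonneg (zero_le_one.trans (h1 t)) _
    have hle1 : ∀ t, m t ^ (-q) ≤ 1 := fun t =>
      Real.rpow_le_one_of_one_le_of_nonpos (h1 t) (by linarith)
    have key : ∀ t, x / 2 ≤ |t| → m t ^ (-q) ≤ 4 ^ q * m x ^ (-q) := by
      intro t ht
      have hx4 : 0 < m x := zero_lt_one.trans_le (h1 x)
      have : m x / 4 ≤ m t := by
        simp only [hm]
        rw [abs_of_nonneg hx]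
        have : (1 + x) ^ 2 / 4 = ((1 + x) / 2) ^ 2 := by ring
        rw [this]
        gcongr
        linarith
      calc m t ^ (-q) ≤ (m x / 4) ^ (-q) :=
            Real.rpow_le_rpow_of_nonpos (by positivity) this (by linarith)
        _ = _ := by
            rw [Real.div_rpow hx4.le (by norm_num), Real.rpow_neg (by norm_num : (0 : ℝ) ≤ 4)]
            field_simp
    have hpt : ∀ t ∈ Set.Ioo 0 x, ENNReal.ofReal (m t ^ (-q)) * ENNReal.ofReal (m (x - t) ^ (-q)) ≤
        ENNReal.ofReal (4 ^ q * m x ^ (-q)) *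
          (ENNReal.ofReal (m t ^ (-q)) + ENNReal.ofReal (m (x - t) ^ (-q))) := by
      intro t ht
      have h4 : 0 ≤ (4 : ℝ) ^ q * m x ^ (-q) := mul_nonneg (by positivity) (hp x)
      rw [← ENNReal.ofReal_add (hp _) (hp _), ← ENNReal.ofReal_mul (hp _), ← ENNReal.ofReal_mul h4]
      apply ENNReal.ofReal_le_ofReal
      have p1 := hp t
      have p2 := hp (x - t)
      rcases le_total (x / 2) t with h | h
      · have := key t (by rwa [abs_of_pos ht.1])
        nlinarith
      · have := key (x - t) (by rw [abs_of_pos (sub_pos.mpr ht.2)]; linarith)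
        nlinarith
    calc _ ≤ ∫⁻ t in Set.Ioo 0 x, ENNReal.ofReal (4 ^ q * m x ^ (-q)) *
          (ENNReal.ofReal (m t ^ (-q)) + ENNReal.ofReal (m (x - t) ^ (-q))) :=
          setLIntegral_mono' measurableSet_Ioo hpt
      _ ≤ ∫⁻ t, ENNReal.ofReal (4 ^ q * m x ^ (-q)) *
          (ENNReal.ofReal (m t ^ (-q)) + ENNReal.ofReal (m (x - t) ^ (-q))) :=
          setLIntegral_le_lintegral _ _
      _ = ENNReal.ofReal (4 ^ q * m x ^ (-q)) * (J + J) := by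
          rw [lintegral_const_mul _ (by fun_prop), lintegral_add_left (by fun_prop),
            lintegral_sub_left_eq_self (fun t => ENNReal.ofReal (m t ^ (-q))) x]
      _ = ENNReal.ofReal (4 ^ q) * (2 * J) * ENNReal.ofReal (m x ^ (-q)) := by
          rw [ENNReal.ofReal_mul (by positivity)]; ring
      _ ≤ _ := by gcongr
  · exact (setLIntegral_le_lintegral _ _).trans k2
  · intro ε hε
    exact poly_le_exp hε

theorem half {q : ℝ} (hq : 1 < q) {ω : ℝ → ℝ} (hω : IsAMAWR q ω) :
    ∃ K m, HW q K m ∧ ∃ D, ∀ x ≥ 0, m x ≤ D * ω x := by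
  obtain ⟨⟨hm, h1, h2⟩, hc, hi, h3, h4⟩ := id hω
  by_cases h : rho2R ω = 0
  · obtain ⟨K, hK, hmono⟩ := h4 h
    set J := ∫⁻ t, ENNReal.ofReal (ω t ^ (-q)) with hJ
    have hJt : J ≠ ⊤ := hi.lintegral_lt_top.ne
    set K' := max (max K 1) J.toReal with hK'
    have k1 : K ≤ K' := (le_max_left _ _).trans (le_max_left _ _)
    have k2 : 1 ≤ K' := (le_max_right _ _).trans (le_max_left _ _)
    refine ⟨K', ω, ⟨hm, h1, ?_, ?_, ?_, ?_, ?_⟩, 1, fun x _ => by simp⟩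
    · intro x y hx hy
      refine (hmono x y hx hy).trans ?_
      have := zero_le_one.trans (h1 (x + y))
      gcongr
    · intro x y hx hy
      refine (h2 x y).trans ?_
      have := zero_le_one.trans (h1 x)
      have := zero_le_one.trans (h1 y)
      exact le_mul_of_one_le_left (by positivity) k2
    · intro x hx
      refine ((setLIntegral_le_lintegral _ _).trans (conv_lintegral (by linarith) hω x)).trans ?_
      refine le_mul_of_one_le_left (by simp) ?_
      rwa [ENNReal.one_le_ofReal]
    · refine (setLIntegral_le_lintegral _ _).trans ?_
      rw [← hJ, ← ENNReal.ofReal_toReal hJt]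
      exact ENNReal.ofReal_le_ofReal (le_max_right _ _)
    · exact subexp_right h1 h2 h hK hmono
  · obtain ⟨K, hK⟩ := HW_poly hq
    refine ⟨K, _, hK, ?_⟩
    have hnn : ∀ r ∈ {r : ℝ | ∃ x : ℝ, 0 < x ∧ r = Real.log (ω x) / x}, 0 ≤ r := by
      rintro r ⟨x, hx, rfl⟩
      exact div_nonneg (Real.log_nonneg (h1 x)) hx.le
    have hpos : 0 < rho2R ω := lt_of_le_of_ne (Real.sInf_nonneg hnn) (Ne.symm h)
    obtain ⟨C, hC⟩ := poly_le_exp hpos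
    refine ⟨max C 1, fun x hx => ?_⟩
    rcases hx.lt_or_eq with hx' | rfl
    · have h0 : 0 < ω x := zero_lt_one.trans_le (h1 x)
      have : rho2R ω ≤ Real.log (ω x) / x := csInf_le ⟨0, hnn⟩ ⟨x, hx', rfl⟩
      rw [le_div_iff₀ hx', Real.le_log_iff_exp_le h0] at this
      calc _ ≤ C * Real.exp (rho2R ω * x) := hC x hx
        _ ≤ max C 1 * Real.exp (rho2R ω * x) := by gcongr; exact le_max_left _ _
        _ ≤ _ := by gcongr
    · simp only [abs_zero, add_zero, one_pow]
      have a := le_max_right C 1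
      have b := h1 0
      nlinarith
end

section
open MeasureTheory
open Filter Topology
set_option linter.unusedSectionVars false
open scoped ENNReal Convolution

theorem rpow_neg_comp {q K a b : ℝ} (hq : 0 < q) (hK : 0 < K) (ha : 1 ≤ a) (hb : 1 ≤ b)
    (h : a ≤ K * b) : b ^ (-q) ≤ K ^ q * a ^ (-q) := by
  have hb0 : 0 < b := by linarith
  have ha0 : 0 < a := by linarith
  calc b ^ (-q) ≤ (a / K) ^ (-q) :=
        Real.rpow_le_rpow_of_nonpos (by positivity) (by rw [div_le_iff₀ hK]; linarith) (by linarith)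
    _ = _ := by
        rw [Real.div_rpow ha0.le hK.le, Real.rpow_neg hK.le]
        field_simp

theorem glue_conv {q K : ℝ} (hq : 0 < q) (hK : 0 < K) {N : ℝ → ℝ} (hm : Measurable N)
    (h1 : ∀ x, 1 ≤ N x) {x : ℝ} (hx : 0 ≤ x) (hmono : ∀ y ≥ x, N x ≤ K * N y)
    (hc : ∫⁻ t in Set.Ioo 0 x, ENNReal.ofReal (N t ^ (-q)) *
      ENNReal.ofReal (N (x - t) ^ (-q)) ≤ ENNReal.ofReal K * ENNReal.ofReal (N x ^ (-q)))
    (hJ : ∫⁻ t, ENNReal.ofReal (N t ^ (-q)) ≤ ENNReal.ofReal (2 * K)) :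
    ∫⁻ t, ENNReal.ofReal (N t ^ (-q)) * ENNReal.ofReal (N (x - t) ^ (-q)) ≤
      ENNReal.ofReal (4 * K ^ q * K + K) * ENNReal.ofReal (N x ^ (-q)) := by
  set a : ℝ → ℝ≥0∞ := fun t => ENNReal.ofReal (N t ^ (-q)) with ha
  have ham : Measurable a := by fun_prop
  have hcomp : ∀ y ≥ x, a y ≤ ENNReal.ofReal (K ^ q) * a x := by
    intro y hy
    simp only [ha]
    rw [← ENNReal.ofReal_mul (by positivity)]
    exact ENNReal.ofReal_le_ofReal (rpow_neg_comp hq hK (h1 x) (h1 y) (hmono y hy))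
  have i1 : ∫⁻ t in Set.Iic 0, a t * a (x - t) ≤
      ENNReal.ofReal (K ^ q) * a x * ENNReal.ofReal (2 * K) := by
    calc _ ≤ ∫⁻ t in Set.Iic 0, ENNReal.ofReal (K ^ q) * a x * a t := by
          refine setLIntegral_mono' measurableSet_Iic fun t ht => ?_
          rw [mul_comm]
          gcongr
          exact hcomp _ (by have : t ≤ 0 := ht; linarith)
      _ ≤ ∫⁻ t, ENNReal.ofReal (K ^ q) * a x * a t := setLIntegral_le_lintegral _ _
      _ = ENNReal.ofReal (K ^ q) * a x * ∫⁻ t, a t := lintegral_const_mul _ ham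
      _ ≤ _ := by gcongr
  have i2 : ∫⁻ t in Set.Ici x, a t * a (x - t) ≤
      ENNReal.ofReal (K ^ q) * a x * ENNReal.ofReal (2 * K) := by
    calc _ ≤ ∫⁻ t in Set.Ici x, ENNReal.ofReal (K ^ q) * a x * a (x - t) := by
          refine setLIntegral_mono' measurableSet_Ici fun t ht => ?_
          gcongr
          exact hcomp _ ht
      _ ≤ ∫⁻ t, ENNReal.ofReal (K ^ q) * a x * a (x - t) := setLIntegral_le_lintegral _ _
      _ = ENNReal.ofReal (K ^ q) * a x * ∫⁻ t, a (x - t) := lintegral_const_mul _ (by fun_prop)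
      _ = ENNReal.ofReal (K ^ q) * a x * ∫⁻ t, a t := by rw [lintegral_sub_left_eq_self a x]
      _ ≤ _ := by gcongr
  have hun : (Set.univ : Set ℝ) ⊆ (Set.Iic 0 ∪ Set.Ioo 0 x) ∪ Set.Ici x := by
    intro t _
    rcases le_or_gt t 0 with h | h
    · exact Or.inl (Or.inl h)
    · rcases lt_or_ge t x with h' | h'
      · exact Or.inl (Or.inr ⟨h, h'⟩)
      · exact Or.inr h'
  calc ∫⁻ t, a t * a (x - t) = ∫⁻ t in Set.univ, a t * a (x - t) := by rw [setLIntegral_univ]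
    _ ≤ ∫⁻ t in (Set.Iic 0 ∪ Set.Ioo 0 x) ∪ Set.Ici x, a t * a (x - t) := lintegral_mono_set hun
    _ ≤ (∫⁻ t in Set.Iic 0, a t * a (x - t)) + (∫⁻ t in Set.Ioo 0 x, a t * a (x - t)) +
        ∫⁻ t in Set.Ici x, a t * a (x - t) := by
        refine (lintegral_union_le _ _ _).trans ?_
        gcongr
        exact lintegral_union_le _ _ _
    _ ≤ ENNReal.ofReal (K ^ q) * a x * ENNReal.ofReal (2 * K) + ENNReal.ofReal K * a x +
        ENNReal.ofReal (K ^ q) * a x * ENNReal.ofReal (2 * K) := by gcongr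
    _ = _ := by
        rw [ENNReal.ofReal_add (by positivity) hK.le, ENNReal.ofReal_mul (by positivity),
          ENNReal.ofReal_mul (by positivity), ENNReal.ofReal_mul (by positivity)]
        have e4 : ENNReal.ofReal 4 = 2 * ENNReal.ofReal 2 := by
          rw [show (4 : ℝ) = 2 * 2 by norm_num, ENNReal.ofReal_mul (by norm_num)]; simp
        rw [e4]
        ring

noncomputable def glw (m₁ m₂ : ℝ → ℝ) (x : ℝ) : ℝ := if 0 ≤ x then m₁ x else m₂ (-x)

theorem glw_pos (m₁ m₂ : ℝ → ℝ) {x : ℝ} (hx : 0 ≤ x) : glw m₁ m₂ x = m₁ x := if_pos hx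
theorem glw_neg (m₁ m₂ : ℝ → ℝ) {x : ℝ} (hx : x < 0) : glw m₁ m₂ x = m₂ (-x) :=
  if_neg (not_le.mpr hx)

theorem glw_meas {m₁ m₂ : ℝ → ℝ} (h₁ : Measurable m₁) (h₂ : Measurable m₂) :
    Measurable (glw m₁ m₂) :=
  Measurable.ite measurableSet_Ici h₁ (h₂.comp measurable_neg)

theorem glw_int {q K : ℝ} (hK : 0 < K) {m₁ m₂ : ℝ → ℝ} (h₁ : HW q K m₁) (h₂ : HW q K m₂) :
    ∫⁻ t, ENNReal.ofReal (glw m₁ m₂ t ^ (-q)) ≤ ENNReal.ofReal (2 * K) := by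
  set a : ℝ → ℝ≥0∞ := fun t => ENNReal.ofReal (glw m₁ m₂ t ^ (-q)) with ha
  have i1 : ∫⁻ t in Set.Ioi 0, a t ≤ ENNReal.ofReal K := by
    refine le_trans (le_of_eq ?_) h₁.int
    refine setLIntegral_congr_fun measurableSet_Ioi fun t ht => ?_
    simp only [ha]
    rw [glw_pos _ _ (show 0 ≤ t from le_of_lt ht)]
  have i2 : ∫⁻ t in Set.Iio 0, a t ≤ ENNReal.ofReal K := by
    have e : ∫⁻ t in Set.Iio 0, a t = ∫⁻ t in Set.Ioi 0, ENNReal.ofReal (m₂ t ^ (-q)) := by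
      rw [← lintegral_indicator measurableSet_Iio, ← lintegral_indicator measurableSet_Ioi,
        ← lintegral_neg_eq_self]
      congr 1
      ext t
      simp only [Set.indicator_apply, Set.mem_Iio, Set.mem_Ioi, Left.neg_neg_iff]
      split_ifs with h
      · simp only [ha]
        rw [glw_neg _ _ (by linarith), neg_neg]
      · rfl
    rw [e]
    exact h₂.int
  have hae : (Set.univ : Set ℝ) ⊆ Set.Iio 0 ∪ Set.Ioi 0 ∪ {0} := by
    intro t _
    rcases lt_trichotomy t 0 with h | h | h
    · exact Or.inl (Or.inl h)
    · exact Or.inr h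
    · exact Or.inl (Or.inr h)
  calc ∫⁻ t, a t = ∫⁻ t in Set.univ, a t := by rw [setLIntegral_univ]
    _ ≤ ∫⁻ t in Set.Iio 0 ∪ Set.Ioi 0 ∪ {0}, a t := lintegral_mono_set hae
    _ ≤ (∫⁻ t in Set.Iio 0, a t) + (∫⁻ t in Set.Ioi 0, a t) + ∫⁻ t in {0}, a t := by
        refine (lintegral_union_le _ _ _).trans ?_
        gcongr
        exact lintegral_union_le _ _ _
    _ ≤ ENNReal.ofReal K + ENNReal.ofReal K + 0 := by
        gcongr
        simp
    _ = _ := by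
        rw [add_zero, ← ENNReal.ofReal_add hK.le hK.le]; congr 1; ring

theorem glw_conv {q K : ℝ} (hq : 0 < q) (hK : 1 ≤ K) {m₁ m₂ : ℝ → ℝ} (h₁ : HW q K m₁)
    (h₂ : HW q K m₂) (x : ℝ) :
    ∫⁻ t, ENNReal.ofReal (glw m₁ m₂ t ^ (-q)) * ENNReal.ofReal (glw m₁ m₂ (x - t) ^ (-q)) ≤
      ENNReal.ofReal (4 * K ^ q * K + K) * ENNReal.ofReal (glw m₁ m₂ x ^ (-q)) := by
  have hK0 : 0 < K := by linarith
  have hm := glw_meas h₁.meas h₂.meas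
  have h1 : ∀ x, 1 ≤ glw m₁ m₂ x := by
    intro x; unfold glw; split_ifs
    · exact h₁.one_le _
    · exact h₂.one_le _
  have hint := glw_int hK0 h₁ h₂
  rcases le_or_gt 0 x with hx | hx
  · apply glue_conv hq hK0 hm h1 hx
    · intro y hy
      rw [glw_pos _ _ hx, glw_pos _ _ (hx.trans hy)]
      have := h₁.mono x (y - x) hx (by linarith)
      rwa [add_sub_cancel] at this
    · rw [glw_pos _ _ hx]
      refine le_trans (le_of_eq ?_) (h₁.conv x hx)
      refine setLIntegral_congr_fun measurableSet_Ioo fun t ht => ?_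
      rw [glw_pos _ _ ht.1.le, glw_pos _ _ (by linarith [ht.2])]
    · exact hint
  · have key := glue_conv (N := fun t => glw m₁ m₂ (-t)) hq hK0 (hm.comp measurable_neg)
      (fun x => h1 _) (x := -x) (by linarith) ?_ ?_ ?_
    · rw [← lintegral_neg_eq_self] at key
      have e : ∀ t, -(-x - -t) = x - t := fun t => by ring
      simpa only [neg_neg, e] using key
    · intro y hy
      simp only [neg_neg]
      rw [glw_neg _ _ hx, glw_neg _ _ (by linarith), neg_neg]
      have := h₂.mono (-x) (y - (-x)) (by linarith) (by linarith)
      rwa [add_sub_cancel] at this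
    · simp only [neg_neg]
      rw [glw_neg _ _ hx]
      refine le_trans (le_of_eq ?_) (h₂.conv (-x) (by linarith))
      refine setLIntegral_congr_fun measurableSet_Ioo fun t ht => ?_
      rw [glw_neg _ _ (by linarith [ht.1]), glw_neg _ _ (by linarith [ht.2]), neg_neg, neg_neg]
    · rw [lintegral_neg_eq_self (fun t => ENNReal.ofReal (glw m₁ m₂ t ^ (-q)))]
      exact hint

theorem glw_weight {q K : ℝ} (hq : 1 < q) (hK : 1 ≤ K) {m₁ m₂ : ℝ → ℝ} (h₁ : HW q K m₁)
    (h₂ : HW q K m₂) :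
    ∃ c ≥ 1, IsAMAWR q (fun x => c * glw m₁ m₂ x) ∧
      ∀ ε > 0, ∃ C, ∀ x, c * glw m₁ m₂ x ≤ C * Real.exp (ε * |x|) := by
  have hK0 : 0 < K := by linarith
  have hq0 : 0 < q := by linarith
  set c := 4 * K ^ q * K + K with hc
  have hKq : 0 < K ^ q := by positivity
  have hcK : K ≤ c := by rw [hc]; nlinarith
  have hc1 : 1 ≤ c := hK.trans hcK
  have hc0 : 0 < c := by linarith
  have hm := glw_meas h₁.meas h₂.meas
  have h1 : ∀ x, 1 ≤ glw m₁ m₂ x := by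
    intro x; unfold glw; split_ifs
    · exact h₁.one_le _
    · exact h₂.one_le _
  have h1c : ∀ x, 1 ≤ c * glw m₁ m₂ x := fun x => one_le_mul_of_one_le_of_one_le hc1 (h1 x)
  have hpos : ∀ x, 0 ≤ glw m₁ m₂ x := fun x => zero_le_one.trans (h1 x)
  have hpp : ∀ x, 0 ≤ glw m₁ m₂ x ^ (-q) := fun x => Real.rpow_nonneg (hpos x) _
  have hsub : ∀ x y, glw m₁ m₂ (x + y) ≤ K * (glw m₁ m₂ x * glw m₁ m₂ y) := by
    have mixed : ∀ x y, 0 ≤ x → y < 0 → glw m₁ m₂ (x + y) ≤ K * (glw m₁ m₂ x * glw m₁ m₂ y) := by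
      intro x y hx hy
      rw [glw_pos _ _ hx, glw_neg _ _ hy]
      have a1 := h₁.one_le x
      have a2 := h₂.one_le (-y)
      rcases le_or_gt 0 (x + y) with h | h
      · rw [glw_pos _ _ h]
        have := h₁.mono (x + y) (-y) h (by linarith)
        rw [add_neg_cancel_right] at this
        refine this.trans ?_
        gcongr
        exact le_mul_of_one_le_right (by linarith) a2
      · rw [glw_neg _ _ h]
        have := h₂.mono (-(x + y)) x (by linarith) hx
        rw [show -(x + y) + x = -y by ring] at this
        refine this.trans ?_
        gcongr
        exact le_mul_of_one_le_left (by linarith) a1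
    intro x y
    rcases le_or_gt 0 x with hx | hx <;> rcases le_or_gt 0 y with hy | hy
    · rw [glw_pos _ _ hx, glw_pos _ _ hy, glw_pos _ _ (by linarith)]
      exact h₁.sub x y hx hy
    · exact mixed x y hx hy
    · rw [add_comm x y, mul_comm (glw m₁ m₂ x)]
      exact mixed y x hy hx
    · rw [glw_neg _ _ hx, glw_neg _ _ hy, glw_neg _ _ (by linarith), neg_add]
      exact h₂.sub _ _ (by linarith) (by linarith)
  have hmr : ∀ x, (c * glw m₁ m₂ x) ^ (-q) = c ^ (-q) * glw m₁ m₂ x ^ (-q) := fun x =>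
    Real.mul_rpow hc0.le (hpos x)
  have hii : Integrable fun x => glw m₁ m₂ x ^ (-q) := by
    rw [← lintegral_ofReal_ne_top_iff_integrable (hm.pow_const _).aestronglyMeasurable
      (ae_of_all _ hpp)]
    exact ne_top_of_le_ne_top ENNReal.ofReal_ne_top (glw_int hK0 h₁ h₂)
  refine ⟨c, hc1, ⟨⟨hm.const_mul c, h1c, ?_⟩, ?_, ?_, ?_, ?_⟩, ?_⟩
  · intro x y
    have := hsub x y
    have p1 := mul_nonneg (hpos x) (hpos y)
    calc c * glw m₁ m₂ (x + y) ≤ c * (K * (glw m₁ m₂ x * glw m₁ m₂ y)) := by gcongr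
      _ ≤ c * (c * (glw m₁ m₂ x * glw m₁ m₂ y)) := by gcongr
      _ = _ := by ring
  · intro x
    simp only [hmr]
    have e : ∀ t, c ^ (-q) * glw m₁ m₂ t ^ (-q) * (c ^ (-q) * glw m₁ m₂ (x - t) ^ (-q)) =
        (c ^ (-q) * c ^ (-q)) * (glw m₁ m₂ t ^ (-q) * glw m₁ m₂ (x - t) ^ (-q)) := fun t => by ring
    simp only [e]
    rw [integral_const_mul, mul_assoc]
    have hcq : 0 < c ^ (-q) := by positivity
    refine mul_le_mul_of_nonneg_left ?_ hcq.le
    have h2 : ∫ t, glw m₁ m₂ t ^ (-q) * glw m₁ m₂ (x - t) ^ (-q) ≤ c * glw m₁ m₂ x ^ (-q) := by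
      have hci := conv_integrable hq0 hm h1 hii x
      have := glw_conv hq0 hK h₁ h₂ x
      rw [← hc, ← ENNReal.ofReal_mul hc0.le] at this
      simp only [← ENNReal.ofReal_mul (hpp _)] at this
      rw [← ofReal_integral_eq_lintegral_ofReal hci
        (ae_of_all _ fun t => mul_nonneg (hpp t) (hpp _))] at this
      exact (ENNReal.ofReal_le_ofReal_iff (mul_nonneg hc0.le (hpp x))).mp this
    have h3 : c ^ (-q) * c ≤ 1 := by
      have : c ^ (-q) ≤ c ^ (-1 : ℝ) := Real.rpow_le_rpow_of_exponent_le hc1 (by linarith)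
      rw [Real.rpow_neg_one] at this
      calc c ^ (-q) * c ≤ c⁻¹ * c := by gcongr
        _ = 1 := inv_mul_cancel₀ hc0.ne'
    calc _ ≤ c ^ (-q) * (c * glw m₁ m₂ x ^ (-q)) := by gcongr
      _ = (c ^ (-q) * c) * glw m₁ m₂ x ^ (-q) := by ring
      _ ≤ _ := mul_le_of_le_one_left (hpp x) h3
  · simp only [hmr]
    exact hii.const_mul _
  · intro _
    have b0 := h₁.one_le 0
    refine ⟨K * m₁ 0, by positivity, fun x y hx hy => ?_⟩
    have key : glw m₁ m₂ x ≤ K * m₁ 0 * glw m₁ m₂ (x + y) := by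
      rcases hx.lt_or_eq with hx | rfl
      · rw [glw_neg _ _ hx, glw_neg _ _ (by linarith), neg_add]
        have := h₂.mono (-x) (-y) (by linarith) (by linarith)
        refine this.trans ?_
        have := h₂.one_le (-x + -y)
        gcongr
        exact le_mul_of_one_le_right hK0.le b0
      · rw [glw_pos _ _ le_rfl]
        have := h1 (0 + y)
        have : m₁ 0 ≤ K * m₁ 0 := le_mul_of_one_le_left (by linarith) hK
        refine this.trans ?_
        exact le_mul_of_one_le_right (by positivity) (h1 _)
    calc c * glw m₁ m₂ x ≤ c * (K * m₁ 0 * glw m₁ m₂ (x + y)) := by gcongr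
      _ = _ := by ring
  · intro _
    refine ⟨K, hK0, fun x y hx hy => ?_⟩
    have key : glw m₁ m₂ x ≤ K * glw m₁ m₂ (x + y) := by
      rw [glw_pos _ _ hx, glw_pos _ _ (by linarith)]
      exact h₁.mono x y hx hy
    calc c * glw m₁ m₂ x ≤ c * (K * glw m₁ m₂ (x + y)) := by gcongr
      _ = _ := by ring
  · intro ε hε
    obtain ⟨C1, hC1⟩ := h₁.subexp ε hε
    obtain ⟨C2, hC2⟩ := h₂.subexp ε hε
    refine ⟨c * max C1 C2, fun x => ?_⟩
    rw [mul_assoc]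
    gcongr
    rcases le_or_gt 0 x with hx | hx
    · rw [glw_pos _ _ hx, abs_of_nonneg hx]
      refine (hC1 x hx).trans ?_
      gcongr
      exact le_max_left _ _
    · rw [glw_neg _ _ hx, abs_of_neg hx]
      refine (hC2 (-x) (by linarith)).trans ?_
      gcongr
      exact le_max_right _ _

theorem exists_nu {q : ℝ} (hq : 1 < q) {ω : ℝ → ℝ} (hω : IsAMAWR q ω) :
    ∃ ν : ℝ → ℝ, IsAMAWR q ν ∧ (∃ K > (0 : ℝ), ∀ x, 1 ≤ ν x ∧ ν x ≤ K * ω x) ∧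
      ∀ ε > 0, ∃ C, ∀ x, ν x ≤ C * Real.exp (ε * |x|) := by
  obtain ⟨K1, m₁, h₁, D1, hD1⟩ := half hq hω
  obtain ⟨K2, m₂, h₂, D2, hD2⟩ := half hq hω.reflect
  set K := max (max K1 K2) 1 with hK
  obtain ⟨c, hc, hν, hs⟩ := glw_weight hq (le_max_right _ _ : 1 ≤ K)
    (h₁.le ((le_max_left _ _).trans (le_max_left _ _)))
    (h₂.le ((le_max_right _ _).trans (le_max_left _ _)))
  refine ⟨_, hν, ⟨c * max (max D1 D2) 1, by positivity, fun x => ⟨hν.1.2.1 x, ?_⟩⟩, hs⟩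
  rw [mul_assoc]
  have h0 := zero_le_one.trans (hω.1.2.1 x)
  gcongr
  rcases le_or_gt 0 x with hx | hx
  · rw [glw_pos _ _ hx]
    refine (hD1 x hx).trans ?_
    gcongr
    exact (le_max_left _ _).trans (le_max_left _ _)
  · rw [glw_neg _ _ hx]
    have := hD2 (-x) (by linarith)
    simp only [neg_neg] at this
    refine this.trans ?_
    gcongr
    exact (le_max_right _ _).trans (le_max_left _ _)
end

/-- **Theorem 4 (Bochner–Phillips type, weighted `L^p(ℝ,A)`, `1 < p < ∞`).** -/
theorem stmt3 {A : Type*} [NormedRing A] [NormedAlgebra ℂ A] [CompleteSpace A] [NormOneClass A]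
    (p q : ℝ) (hp : 1 < p) (hpq : 1 / p + 1 / q = 1)
    (ω : ℝ → ℝ) (hω : IsAMAWR q ω)
    (f : ℝ → A) (hfm : StronglyMeasurable f)
    (hfi : Integrable fun x => ‖f x‖ ^ p * ω x ^ p)
    (hinv : ∀ t : ℝ, ∃ u : A,
      u * (1 + ∫ x : ℝ, Complex.exp (Complex.I * (t : ℂ) * (x : ℂ)) • f x) = 1) :
    (∃ (ν : ℝ → ℝ) (g : ℝ → A), IsAMAWR q ν ∧
        (∃ K > (0 : ℝ), ∀ x, 1 ≤ ν x ∧ ν x ≤ K * ω x) ∧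
        StronglyMeasurable g ∧
        (Integrable fun x => ‖g x‖ ^ p * ν x ^ p) ∧
        ∀ᵐ x : ℝ, f x + g x + (∫ t : ℝ, g (x - t) * f t) = 0) ∧
      (IsAdmissibleR ω → ∃ g : ℝ → A,
        StronglyMeasurable g ∧
        (Integrable fun x => ‖g x‖ ^ p * ω x ^ p) ∧
        ∀ᵐ x : ℝ, f x + g x + (∫ t : ℝ, g (x - t) * f t) = 0) := by
  have hp0 : 0 < p := by linarith
  have hpq' : p.HolderConjugate q := by
    rw [Real.holderConjugate_iff]
    exact ⟨hp, by simpa only [one_div] using hpq⟩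
  have hq : 1 < q := hpq'.symm.lt
  constructor
  · obtain ⟨ν, hν, ⟨K, hK, hKν⟩, hs⟩ := exists_nu hq hω
    have hfν : Integrable fun x => ‖f x‖ ^ p * ν x ^ p := by
      refine (hfi.const_mul (K ^ p)).mono'
        ((hfm.norm.measurable.pow_const _).mul (hν.1.1.pow_const _)).aestronglyMeasurable
        (ae_of_all _ fun x => ?_)
      have h1 : 0 ≤ ν x := zero_le_one.trans (hKν x).1
      have h2 : 0 ≤ ω x := zero_le_one.trans (hω.1.2.1 x)
      have h3 : 0 ≤ ‖f x‖ ^ p := Real.rpow_nonneg (norm_nonneg _) _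
      rw [Real.norm_of_nonneg (mul_nonneg h3 (Real.rpow_nonneg h1 _))]
      have h4 : ν x ^ p ≤ K ^ p * ω x ^ p := by
        rw [← Real.mul_rpow hK.le h2]
        exact Real.rpow_le_rpow h1 (hKν x).2 hp0.le
      calc ‖f x‖ ^ p * ν x ^ p ≤ ‖f x‖ ^ p * (K ^ p * ω x ^ p) := by gcongr
        _ = _ := by ring
    obtain ⟨g, h1, h2, h3⟩ := final_of_weight hpq' hν hs f hfm hfν hinv
    exact ⟨ν, g, hν, ⟨K, hK, hKν⟩, h1, h2, h3⟩
  · intro ha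
    exact final_of_weight hpq' hω (subexp_adm hω ha) f hfm hfi hinv
end

section
/- Let 1 < p < ∞ with conjugate index q, and let ω be an almost monotone algebra weight on ℤ with ρ₂(ω) = 1. Define ω̃ : ℤ → [1,∞) by ω̃(n) = max{ω(k) : 0 ≤ k ≤ n} for n ∈ ℕ₀ and ω̃(n) = ω(n) for n < 0. Then ω̃ is an almost monotone algebra weight on ℤ and there is a constant K > 0 such that ω̃(n) ≤ K ω(n) for all n ∈ ℤ. -/
open scoped BigOperators

/-- A weight on `ℤ`: `ω : ℤ → [1,∞)` with `ω(m+n) ≤ ω(m)ω(n)`. -/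
def IsWeight (ω : ℤ → ℝ) : Prop :=
  (∀ n, 1 ≤ ω n) ∧ ∀ m n, ω (m + n) ≤ ω m * ω n

/-- `ρ₁(ω) = sup{ω(-n)^{-1/n} : n ∈ ℕ, n ≥ 1}`. -/
noncomputable def rho1 (ω : ℤ → ℝ) : ℝ :=
  sSup {x : ℝ | ∃ n : ℕ, 0 < n ∧ x = ω (-(n : ℤ)) ^ (-(1 : ℝ) / (n : ℝ))}

/-- `ρ₂(ω) = inf{ω(n)^{1/n} : n ∈ ℕ, n ≥ 1}`. -/
noncomputable def rho2 (ω : ℤ → ℝ) : ℝ :=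
  sInf {x : ℝ | ∃ n : ℕ, 0 < n ∧ x = ω (n : ℤ) ^ ((1 : ℝ) / (n : ℝ))}

/-- A weight is admissible if `ρ₁(ω) = ρ₂(ω) = 1`. -/
def IsAdmissible (ω : ℤ → ℝ) : Prop := rho1 ω = 1 ∧ rho2 ω = 1
/-- An almost monotone algebra weight on `ℤ` (for conjugate index `q`). -/
def IsAMAW (q : ℝ) (ω : ℤ → ℝ) : Prop :=
  IsWeight ω ∧
  (∀ n : ℤ, (∑' k : ℤ, ω k ^ (-q) * ω (n - k) ^ (-q)) ≤ ω n ^ (-q)) ∧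
  (Summable fun n : ℤ => ω n ^ (-q)) ∧
  (rho1 ω = 1 → ∃ K > (0 : ℝ), ∀ n k : ℤ, n ≤ -1 → k ≤ -1 → ω n ≤ K * ω (n + k)) ∧
  (rho2 ω = 1 → ∃ K > (0 : ℝ), ∀ n k : ℤ, 0 ≤ n → 0 ≤ k → ω n ≤ K * ω (n + k))


/-- Convolution on `ℤ`. -/
noncomputable def cnv (f g : ℤ → ℝ) (n : ℤ) : ℝ := ∑' k : ℤ, f k * g (n - k)

/-- The shear equivalence `(n,k) ↦ (k, n-k)`. -/
def shearE : ℤ × ℤ ≃ ℤ × ℤ where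
  toFun x := (x.2, x.1 - x.2)
  invFun y := (y.1 + y.2, y.1)
  left_inv x := by ext <;> simp
  right_inv y := by ext <;> simp

lemma cnv_aux {f g : ℤ → ℝ} (hf : ∀ n, 0 ≤ f n) (hg : ∀ n, 0 ≤ g n)
    (sf : Summable f) (sg : Summable g) :
    Summable (fun x : ℤ × ℤ => f x.2 * g (x.1 - x.2)) := by
  have h := Summable.mul_of_nonneg sf sg hf hg
  exact (shearE.summable_iff (f := fun x : ℤ × ℤ => f x.1 * g x.2)).2 h

lemma cnv_summable {f g : ℤ → ℝ} (hf : ∀ n, 0 ≤ f n) (hg : ∀ n, 0 ≤ g n)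
    (sf : Summable f) (sg : Summable g) (n : ℤ) :
    Summable (fun k : ℤ => f k * g (n - k)) :=
  (cnv_aux hf hg sf sg).prod_factor n

lemma cnv_summable_out {f g : ℤ → ℝ} (hf : ∀ n, 0 ≤ f n) (hg : ∀ n, 0 ≤ g n)
    (sf : Summable f) (sg : Summable g) : Summable (cnv f g) :=
  (cnv_aux hf hg sf sg).prod

lemma cnv_tsum {f g : ℤ → ℝ} (hf : ∀ n, 0 ≤ f n) (hg : ∀ n, 0 ≤ g n)
    (sf : Summable f) (sg : Summable g) : ∑' n, cnv f g n = (∑' n, f n) * ∑' n, g n := by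
  have h1 := (cnv_aux hf hg sf sg).tsum_prod
  have h := Summable.mul_of_nonneg sf sg hf hg
  have h2 := sf.tsum_mul_tsum sg h
  have h3 := shearE.tsum_eq (fun x : ℤ × ℤ => f x.1 * g x.2)
  rw [h2, ← h3]
  exact h1.symm

lemma cnv_nonneg {f g : ℤ → ℝ} (hf : ∀ n, 0 ≤ f n) (hg : ∀ n, 0 ≤ g n) (n : ℤ) :
    0 ≤ cnv f g n := tsum_nonneg fun k => mul_nonneg (hf _) (hg _)

lemma cnv_comm (f g : ℤ → ℝ) (n : ℤ) : cnv f g n = cnv g f n := by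
  unfold cnv
  rw [← (Equiv.subLeft n).tsum_eq (fun k => f k * g (n - k))]
  refine tsum_congr fun k => ?_
  simp [mul_comm]

lemma cnv_mono {f g f' g' : ℤ → ℝ} (hf : ∀ n, 0 ≤ f n) (hg : ∀ n, 0 ≤ g n)
    (sf : Summable f') (sg : Summable g') (h1 : ∀ n, f n ≤ f' n) (h2 : ∀ n, g n ≤ g' n)
    (n : ℤ) : cnv f g n ≤ cnv f' g' n := by
  have hf' : ∀ n, 0 ≤ f' n := fun n => (hf n).trans (h1 n)
  have hg' : ∀ n, 0 ≤ g' n := fun n => (hg n).trans (h2 n)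
  exact Summable.tsum_le_tsum (fun k => mul_le_mul (h1 _) (h2 _) (hg _) (hf' _))
    (cnv_summable hf hg (sf.of_nonneg_of_le hf h1) (sg.of_nonneg_of_le hg h2) n)
    (cnv_summable hf' hg' sf sg n)

/-- Maximum principle. -/
lemma max_principle {d μ : ℤ → ℝ} (hd : ∀ n, 0 ≤ d n) (hμ : ∀ n, 0 < μ n)
    (sd : Summable d) (sμ : Summable μ) (h1 : ∑' n, μ n = 1)
    (hh : ∀ n, d n = cnv μ d n) : ∀ n, d n = 0 := by
  by_contra! hne
  obtain ⟨n1, hn1⟩ := hne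
  have hp : 0 < d n1 := lt_of_le_of_ne (hd _) (Ne.symm hn1)
  have hfin : {n | d n1 ≤ d n}.Finite := by
    have ht := sd.tendsto_cofinite_zero.eventually_lt_const hp
    have := Filter.eventually_cofinite.1 ht
    simpa using this
  obtain ⟨n0, hn0, hmax⟩ := hfin.exists_maximalFor d _ ⟨n1, le_refl (d n1)⟩
  have hmx : ∀ n, d n ≤ d n0 := by
    intro n
    by_contra! hlt
    have : d n1 ≤ d n := le_trans hn0 hlt.le
    exact absurd (hmax this hlt.le) (not_le.2 hlt)
  have s1 : Summable fun k => μ k * d (n0 - k) :=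
    cnv_summable (fun n => (hμ n).le) hd sμ sd n0
  have s2 : Summable fun k => μ k * d n0 := sμ.mul_right _
  have hz : ∑' k, (μ k * d n0 - μ k * d (n0 - k)) = 0 := by
    rw [s2.tsum_sub s1, tsum_mul_right, h1]
    have := hh n0
    unfold cnv at this
    linarith
  have hnn : ∀ k, 0 ≤ μ k * d n0 - μ k * d (n0 - k) := fun k => by
    have := mul_le_mul_of_nonneg_left (hmx (n0 - k)) (hμ k).le
    linarith
  have hz' := ((s2.sub s1).hasSum_iff.2 hz)
  have hz2 := (hasSum_zero_iff_of_nonneg hnn).1 hz'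
  have hc : ∀ n, d n = d n0 := by
    intro n
    have := congrFun hz2 (n0 - n)
    simp only [Pi.zero_apply, sub_sub_cancel] at this
    have h3 : μ (n0 - n) * (d n0 - d n) = 0 := by linarith
    rcases mul_eq_zero.1 h3 with h | h
    · exact absurd h (hμ _).ne'
    · linarith
  have hs : Summable fun _ : ℤ => d n0 := by
    refine sd.congr fun n => ?_
    rw [hc n]
  have h0 := (summable_const_iff _).1 hs
  have : d n1 ≤ d n0 := hmx n1
  linarith

/-- Iterates. -/
noncomputable def itw (E : ℤ → ℝ) : ℕ → ℤ → ℝ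
  | 0 => fun _ => 0
  | m + 1 => fun n => E n + cnv (itw E m) (itw E m) n

lemma half_bound {v : ℤ → ℝ} (hv : ∀ n, 0 < v n) (sv : Summable v)
    (hc : ∀ n, cnv v v n ≤ v n) : ∑' n, v n ≤ 1 / 2 := by
  have hv0 : ∀ n, 0 ≤ v n := fun n => (hv n).le
  set S := ∑' n, v n with hS
  set E : ℤ → ℝ := fun n => v n - cnv v v n with hE
  have hE0 : ∀ n, 0 ≤ E n := fun n => sub_nonneg.2 (hc n)
  have svv := cnv_summable_out hv0 hv0 sv sv
  have sE : Summable E := sv.sub svv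
  have eE : ∑' n, E n = S - S * S := by
    rw [hE, sv.tsum_sub svv, cnv_tsum hv0 hv0 sv sv]
  have hw0 : ∀ m n, 0 ≤ itw E m n := by
    intro m
    induction m with
    | zero => intro n; simp [itw]
    | succ m ih => intro n; exact add_nonneg (hE0 n) (cnv_nonneg ih ih n)
  have hwv : ∀ m n, itw E m n ≤ v n := by
    intro m
    induction m with
    | zero => intro n; simpa [itw] using hv0 n
    | succ m ih =>
      intro n
      have := cnv_mono (hw0 m) (hw0 m) sv sv ih ih n
      simp only [itw, hE]
      linarith
  have sw : ∀ m, Summable (itw E m) := fun m => sv.of_nonneg_of_le (hw0 m) (hwv m)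
  have hmono : ∀ m n, itw E m n ≤ itw E (m + 1) n := by
    intro m
    induction m with
    | zero => intro n; simpa [itw] using hw0 1 n
    | succ m ih =>
      intro n
      have := cnv_mono (hw0 m) (hw0 m) (sw (m+1)) (sw (m+1)) ih ih n
      change E n + cnv (itw E m) (itw E m) n ≤ E n + cnv (itw E (m+1)) (itw E (m+1)) n
      linarith
  have hwS : ∀ m, ∑' n, itw E m n ≤ 1 / 2 := by
    intro m
    induction m with
    | zero => simp [itw]
    | succ m ih =>
      have h1 : ∑' n, itw E (m+1) n = (S - S * S) + (∑' n, itw E m n) * (∑' n, itw E m n) := by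
        rw [← eE, ← cnv_tsum (hw0 m) (hw0 m) (sw m) (sw m)]
        exact sE.tsum_add (cnv_summable_out (hw0 m) (hw0 m) (sw m) (sw m))
      have h2 : 0 ≤ ∑' n, itw E m n := tsum_nonneg (hw0 m)
      rw [h1]
      nlinarith [sq_nonneg (S - 1/2)]
  have hex : ∀ n, ∃ l, Filter.Tendsto (fun m => itw E m n) Filter.atTop (nhds l) := by
    intro n
    refine ⟨_, tendsto_atTop_ciSup (monotone_nat_of_le_succ fun m => hmono m n) ?_⟩
    exact ⟨v n, by rintro _ ⟨m, rfl⟩; exact hwv m n⟩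
  choose w hw using hex
  have w0 : ∀ n, 0 ≤ w n := fun n => ge_of_tendsto' (hw n) fun m => hw0 m n
  have wv : ∀ n, w n ≤ v n := fun n => le_of_tendsto' (hw n) fun m => hwv m n
  have sww : Summable w := sv.of_nonneg_of_le w0 wv
  have hW : ∑' n, w n ≤ 1 / 2 := by
    refine le_of_tendsto' (tendsto_tsum_of_dominated_convergence sv hw ?_) hwS
    refine Filter.Eventually.of_forall fun m n => ?_
    rw [Real.norm_of_nonneg (hw0 m n)]
    exact hwv m n
  have hfix : ∀ n, w n = E n + cnv w w n := by
    intro n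
    have h1 : Filter.Tendsto (fun m => cnv (itw E m) (itw E m) n) Filter.atTop
        (nhds (cnv w w n)) := by
      refine tendsto_tsum_of_dominated_convergence (cnv_summable hv0 hv0 sv sv n)
        (fun k => (hw k).mul (hw (n - k))) ?_
      refine Filter.Eventually.of_forall fun m k => ?_
      rw [Real.norm_of_nonneg (mul_nonneg (hw0 m _) (hw0 m _))]
      exact mul_le_mul (hwv m _) (hwv m _) (hw0 m _) (hv0 _)
    have h2 := (hw n).comp (Filter.tendsto_add_atTop_nat 1)
    exact tendsto_nhds_unique h2 (h1.const_add (E n))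
  set d : ℤ → ℝ := fun n => v n - w n with hd
  have d0 : ∀ n, 0 ≤ d n := fun n => sub_nonneg.2 (wv n)
  have sd : Summable d := sv.sub sww
  set μ : ℤ → ℝ := fun n => v n + w n with hμd
  have sμ : Summable μ := sv.add sww
  have μpos : ∀ n, 0 < μ n := fun n => add_pos_of_pos_of_nonneg (hv n) (w0 n)
  have hharm : ∀ n, d n = cnv μ d n := by
    intro n
    have s1 := cnv_summable hv0 hv0 sv sv n
    have s2 := cnv_summable w0 hv0 sww sv n
    have s3 := cnv_summable hv0 w0 sv sww n
    have s4 := cnv_summable w0 w0 sww sww n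
    have h1 : cnv μ d n = cnv v v n + cnv w v n - (cnv v w n + cnv w w n) := by
      unfold cnv
      rw [← s1.tsum_add s2, ← s3.tsum_add s4, ← (s1.add s2).tsum_sub (s3.add s4)]
      refine tsum_congr fun k => ?_
      simp only [hμd, hd]
      ring
    have := hfix n
    rw [h1, cnv_comm v w]
    simp only [hd, hE] at this ⊢
    linarith
  have hD : ∑' n, d n = S - ∑' n, w n := sv.tsum_sub sww
  have hM : ∑' n, μ n = S + ∑' n, w n := sv.tsum_add sww
  by_cases hS1 : ∑' n, μ n = 1
  · have hz := max_principle d0 μpos sd sμ hS1 hharm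
    have : ∑' n, d n = 0 := by simp [hz]
    linarith
  · have h1 : ∑' n, d n = (∑' n, μ n) * ∑' n, d n := by
      rw [← cnv_tsum (fun n => (μpos n).le) d0 sμ sd]
      exact tsum_congr hharm
    have h2 : (∑' n, μ n - 1) * ∑' n, d n = 0 := by linarith
    rcases mul_eq_zero.1 h2 with h | h
    · exact absurd (by linarith) hS1
    · linarith

/-- Middle-part comparison for nonneg sequence vanishing from `j` to `n`. -/
lemma middle_g (g : ℕ → ℝ) (e r d : ℕ) (c : ℝ)
    (hg : ∀ k, k ≤ d + e + r + d → 0 ≤ g k)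
    (hmono : ∀ a b, a ≤ b → b ≤ d + e + r + d → g b ≤ g a)
    (hz : ∀ k, d + e + r ≤ k → k ≤ d + e + r + d → g k = 0)
    (hc : c ≤ g (d + e) * g (r + d)) :
    ∑ k ∈ Finset.range (d + e + r + d + 1), g k * g (d + e + r + d - k) + d * c ≤
      ∑ k ∈ Finset.range (d + e + r + 1), g k * g (d + e + r - k) := by
  have e1 : d + e + r + d + 1 = d + (e + (1 + (r + d))) := by ring
  have e2 : d + e + r + 1 = e + ((d + 1) + r) := by ring
  rw [e1, e2]
  simp only [Finset.sum_range_add]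
  have z1 : ∑ k ∈ Finset.range d, g k * g (d + e + r + d - k) = 0 := by
    refine Finset.sum_eq_zero fun k hk => ?_
    have := Finset.mem_range.1 hk
    rw [hz (d + e + r + d - k) (by omega) (by omega), mul_zero]
  have z2 : ∑ k ∈ Finset.range d, g (d + (e + (1 + (r + k)))) *
      g (d + e + r + d - (d + (e + (1 + (r + k))))) = 0 := by
    refine Finset.sum_eq_zero fun k hk => ?_
    have := Finset.mem_range.1 hk
    rw [hz (d + (e + (1 + (r + k)))) (by omega) (by omega), zero_mul]
  have i1 : ∑ k ∈ Finset.range e, g (d + k) * g (d + e + r + d - (d + k)) ≤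
      ∑ k ∈ Finset.range e, g k * g (d + e + r - k) := by
    refine Finset.sum_le_sum fun k hk => ?_
    have := Finset.mem_range.1 hk
    exact mul_le_mul (hmono _ _ (by omega) (by omega)) (hmono _ _ (by omega) (by omega))
      (hg _ (by omega)) (hg _ (by omega))
  have i3 : ∑ k ∈ Finset.range r, g (d + (e + (1 + k))) *
      g (d + e + r + d - (d + (e + (1 + k)))) ≤
      ∑ k ∈ Finset.range r, g (e + (d + 1 + k)) * g (d + e + r - (e + (d + 1 + k))) := by
    refine Finset.sum_le_sum fun k hk => ?_
    have := Finset.mem_range.1 hk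
    exact mul_le_mul (hmono _ _ (by omega) (by omega)) (hmono _ _ (by omega) (by omega))
      (hg _ (by omega)) (hg _ (by omega))
  have key : ∀ k ∈ Finset.range (d + 1), g (d + e) * g (r + d) ≤
      g (e + k) * g (d + e + r - (e + k)) := by
    intro k hk
    have := Finset.mem_range.1 hk
    exact mul_le_mul (hmono _ _ (by omega) (by omega)) (hmono _ _ (by omega) (by omega))
      (hg _ (by omega)) (hg _ (by omega))
  have i2 := Finset.card_nsmul_le_sum _ _ _ key
  rw [Finset.card_range, nsmul_eq_mul] at i2
  push_cast at i2
  have e3 : d + e + r + d - (d + (e + 0)) = r + d := by omega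
  have i4 : (d : ℝ) * c ≤ d * (g (d + e) * g (r + d)) :=
    mul_le_mul_of_nonneg_left hc (Nat.cast_nonneg _)
  simp only [Finset.sum_range_add, Finset.sum_range_one] at i2 ⊢
  simp only [e3, z1, z2]
  simp only [add_zero] at i2 ⊢
  linarith

lemma middle_u (u : ℕ → ℝ) (j d a : ℕ) (c : ℝ) (hc0 : 0 < c)
    (hmono : ∀ a b, a ≤ b → b ≤ j + d → u b ≤ u a)
    (hz : ∀ k, j ≤ k → k ≤ j + d → u k = c)
    (ha : a ≤ j + d) (hgt : c * (u a + u (j + d - a)) < u a * u (j + d - a)) :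
    ∑ k ∈ Finset.range (j + d + 1), u k * u (j + d - k) ≤
      ∑ k ∈ Finset.range (j + 1), u k * u (j - k) := by
  have hge : ∀ k, k ≤ j + d → c ≤ u k := fun k hk => by
    rw [← hz (j + d) (by omega) le_rfl]; exact hmono _ _ hk le_rfl
  have haj : a < j := by
    by_contra! h
    rw [hz a h ha] at hgt
    nlinarith
  have had : d < a := by
    by_contra! h
    rw [hz (j + d - a) (by omega) (by omega)] at hgt
    nlinarith
  obtain ⟨e, rfl⟩ := Nat.exists_eq_add_of_lt had
  obtain ⟨r, rfl⟩ := Nat.exists_eq_add_of_lt haj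
  have hm := middle_g (fun k => u k - c) (e + 1) (r + 1) d (c * c)
    (fun k hk => sub_nonneg.2 (hge k (by omega)))
    (fun a b h1 h2 => sub_le_sub_right (hmono a b h1 (by omega)) c)
    (fun k h1 h2 => sub_eq_zero.2 (hz k (by omega) (by omega)))
    (by
      have e1 : d + e + 1 + r + 1 + d - (d + e + 1) = r + 1 + d := by omega
      rw [e1] at hgt
      have e2 : d + (e + 1) = d + e + 1 := by omega
      simp only [e2]
      nlinarith)
  have e4 : d + (e + 1) + (r + 1) = d + e + 1 + r + 1 := by omega
  rw [e4] at hm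
  generalize hj : d + e + 1 + r + 1 = j at *
  have expand : ∀ N, ∑ k ∈ Finset.range (N + 1), (u k - c) * (u (N - k) - c) =
      ∑ k ∈ Finset.range (N + 1), u k * u (N - k) -
        2 * c * ∑ k ∈ Finset.range (N + 1), (u k - c) - (N + 1) * (c * c) := by
    intro N
    have r1 : ∑ k ∈ Finset.range (N + 1), u (N - k) = ∑ k ∈ Finset.range (N + 1), u k := by
      have := Finset.sum_range_reflect u (N + 1)
      simpa using this
    have : ∀ k, (u k - c) * (u (N - k) - c) = u k * u (N - k) - c * u k - c * u (N - k) + c * c :=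
      fun k => by ring
    simp only [this, Finset.sum_add_distrib, Finset.sum_sub_distrib, ← Finset.mul_sum, r1,
      Finset.sum_const, Finset.card_range, nsmul_eq_mul]
    push_cast
    ring
  rw [expand, expand] at hm
  have hsum : ∑ k ∈ Finset.range (j + d + 1), (u k - c) = ∑ k ∈ Finset.range (j + 1), (u k - c) := by
    have e5 : j + d + 1 = (j + 1) + d := by ring
    rw [e5, Finset.sum_range_add]
    have : ∑ k ∈ Finset.range d, (u (j + 1 + k) - c) = 0 := by
      refine Finset.sum_eq_zero fun k hk => ?_
      have := Finset.mem_range.1 hk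
      rw [hz _ (by omega) (by omega), sub_self]
    rw [this, add_zero]
  rw [hsum] at hm
  push_cast at hm
  linarith

/-- Splitting a convolution at nonnegative `N`. -/
lemma cnv_split {u : ℤ → ℝ} (hu : ∀ n, 0 ≤ u n) (su : Summable u) (N : ℕ) :
    cnv u u N = ∑ k ∈ Finset.range (N + 1), u k * u ((N - k : ℕ) : ℤ) +
      2 * ∑' k : ℕ, u (-((k : ℤ) + 1)) * u (N + (k + 1)) := by
  have s := cnv_summable hu hu su su N
  have h1 : Summable fun k : ℕ => u (k : ℤ) * u (N - k) := s.comp_injective Nat.cast_injective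
  have h2 : Summable fun k : ℕ => u (-((k : ℤ) + 1)) * u (N - (-((k : ℤ) + 1))) :=
    s.comp_injective (i := fun k : ℕ => -((k : ℤ) + 1)) (fun a b h => by simpa using h)
  unfold cnv
  have k1 := tsum_of_nat_of_neg_add_one (f := fun k : ℤ => u k * u (N - k)) h1 h2
  have k2 := h1.sum_add_tsum_nat_add (N + 1)
  rw [k1, ← k2]
  clear k1 k2
  have h3 : ∑ i ∈ Finset.range (N + 1), u (i : ℤ) * u (N - i) =
      ∑ k ∈ Finset.range (N + 1), u k * u ((N - k : ℕ) : ℤ) := by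
    refine Finset.sum_congr rfl fun k hk => ?_
    have := Finset.mem_range.1 hk
    rw [Nat.cast_sub (by omega)]
  have h4 : ∑' i : ℕ, u ((i + (N + 1) : ℕ) : ℤ) * u (N - ((i + (N + 1) : ℕ) : ℤ)) =
      ∑' k : ℕ, u (-((k : ℤ) + 1)) * u (N + (k + 1)) := by
    refine tsum_congr fun k => ?_
    rw [mul_comm]
    have a1 : (N : ℤ) - ((k + (N + 1) : ℕ) : ℤ) = -((k : ℤ) + 1) := by push_cast; ring
    have a2 : ((k + (N + 1) : ℕ) : ℤ) = (N : ℤ) + (k + 1) := by push_cast; ring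
    rw [a1, a2]
  have h5 : ∑' k : ℕ, u (-((k : ℤ) + 1)) * u (N - (-((k : ℤ) + 1))) =
      ∑' k : ℕ, u (-((k : ℤ) + 1)) * u (N + (k + 1)) := by
    refine tsum_congr fun k => ?_
    have a1 : (N : ℤ) - (-((k : ℤ) + 1)) = (N : ℤ) + (k + 1) := by ring
    rw [a1]
  rw [h3, h4, h5, two_mul, add_assoc]

lemma conv_min {u v : ℤ → ℝ} (hu : ∀ n, 0 < u n) (huv : ∀ n, u n ≤ v n) (sv : Summable v)
    (hc : ∀ n, cnv v v n ≤ v n) (hneg : ∀ n < 0, u n = v n)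
    (hmono : ∀ a b : ℤ, 0 ≤ a → a ≤ b → u b ≤ u a)
    (hatt : ∀ n : ℤ, 0 ≤ n → ∃ j, 0 ≤ j ∧ j ≤ n ∧ u n = v j) (n : ℤ) :
    cnv u u n ≤ u n := by
  have hu0 : ∀ n, 0 ≤ u n := fun n => (hu n).le
  have su : Summable u := sv.of_nonneg_of_le hu0 huv
  have huvc : ∀ n, cnv u u n ≤ v n := fun n =>
    (cnv_mono hu0 hu0 sv sv huv huv n).trans (hc n)
  rcases lt_or_ge n 0 with hn | hn
  · rw [hneg n hn]; exact huvc n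
  have hS : ∑' n, u n ≤ 1 / 2 :=
    (su.tsum_le_tsum huv sv).trans
      (half_bound (fun n => (hu n).trans_le (huv n)) sv hc)
  by_cases hA : ∀ k : ℤ, 0 ≤ k → k ≤ n → u k * u (n - k) ≤ u n * (u k + u (n - k))
  · have hB : ∀ k : ℤ, u k * u (n - k) ≤ u n * (u k + u (n - k)) := by
      intro k
      rcases lt_or_ge k 0 with h | h
      · have := hmono n (n - k) hn (by omega)
        nlinarith [hu k, hu n, hu (n - k), mul_pos (hu n) (hu (n - k)),
          mul_le_mul_of_nonneg_left this (hu0 k)]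
      rcases le_or_gt k n with h' | h'
      · exact hA k h h'
      · have := hmono n k hn (by omega)
        nlinarith [hu k, hu n, hu (n - k), mul_pos (hu n) (hu k),
          mul_le_mul_of_nonneg_right this (hu0 (n - k))]
    have sr : Summable fun k => u (n - k) := (Equiv.subLeft n).summable_iff.2 su
    have tr : ∑' k, u (n - k) = ∑' k, u k := (Equiv.subLeft n).tsum_eq u
    calc cnv u u n ≤ ∑' k, u n * (u k + u (n - k)) :=
          (cnv_summable hu0 hu0 su su n).tsum_le_tsum hB ((su.add sr).mul_left _)
      _ = u n * (∑' k, u k + ∑' k, u k) := by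
          rw [tsum_mul_left, su.tsum_add sr, tr]
      _ ≤ u n := by nlinarith [hu n]
  · push Not at hA
    obtain ⟨a, ha0, han, hgt⟩ := hA
    obtain ⟨j, hj0, hjn, hj⟩ := hatt n hn
    rw [hj]
    refine le_trans ?_ (huvc j)
    lift j to ℕ using hj0
    lift a to ℕ using ha0
    obtain ⟨d, hd⟩ := Int.le.dest hjn
    have hnd : n = ((j + d : ℕ) : ℤ) := by push_cast; exact hd.symm
    subst hnd
    have hm := middle_u (fun k : ℕ => u k) j d a (u ((j + d : ℕ) : ℤ)) (hu _)
      (fun a b h1 _ => hmono a b (by omega) (by omega))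
      (fun k h1 h2 => le_antisymm
        (by
          have h3 := hmono j k (by omega) (by omega)
          have h4 := huv j
          rw [hj]; linarith)
        (hmono k _ (by omega) (by omega)))
      (by omega) (by
        have : ((j + d - a : ℕ) : ℤ) = ((j + d : ℕ) : ℤ) - a := by
          rw [Nat.cast_sub (by omega)]
        simp only [this]; exact hgt)
    rw [cnv_split hu0 su, cnv_split hu0 su]
    refine add_le_add hm (mul_le_mul_of_nonneg_left ?_ (by norm_num))
    have st : ∀ N : ℕ, Summable fun k : ℕ => u (-((k : ℤ) + 1)) * u (N + (k + 1)) := by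
      intro N
      have := (cnv_summable hu0 hu0 su su N).comp_injective
        (i := fun k : ℕ => -((k : ℤ) + 1)) (fun a b h => by simpa using h)
      refine this.congr fun k => ?_
      simp only [Function.comp]
      congr 2
    exact (st _).tsum_le_tsum (fun k => mul_le_mul_of_nonneg_left
      (hmono _ _ (by omega) (by push_cast; omega)) (hu0 _)) (st _)

/-- **Lemma 3.6 ([Da, Lemma 2]).** Let `ω` be an almost monotone algebra weight on `ℤ`
with `ρ₂(ω) = 1`, and let `ω̃(n) = max{ω(k) : 0 ≤ k ≤ n}` for `n ∈ ℕ₀` and `ω̃(n) = ω(n)`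
for `n < 0`.  Then `ω̃` is an almost monotone algebra weight and there is `K > 0` with
`ω̃(n) ≤ K ω(n)` for all `n ∈ ℤ`. -/
theorem stmt9 (p q : ℝ) (hp : 1 < p) (hpq : 1 / p + 1 / q = 1)
    (ω : ℤ → ℝ) (hω : IsAMAW q ω) (hρ : rho2 ω = 1)
    (ωt : ℤ → ℝ)
    (hdef1 : ∀ n : ℤ, 0 ≤ n →
      IsGreatest {x : ℝ | ∃ k : ℤ, 0 ≤ k ∧ k ≤ n ∧ x = ω k} (ωt n))
    (hdef2 : ∀ n : ℤ, n < 0 → ωt n = ω n) :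
    IsAMAW q ωt ∧ ∃ K > (0 : ℝ), ∀ n : ℤ, ωt n ≤ K * ω n := by
  obtain ⟨⟨hone, hsub⟩, hconv, hsum, h1, h2⟩ := hω
  have hp0 : 0 < p := by linarith
  have hq : 0 < q := by
    have h3 : 1 / p < 1 := by rw [div_lt_one hp0]; exact hp
    have h4 : 0 < 1 / q := by linarith
    exact one_div_pos.1 h4
  have hle : ∀ n, ω n ≤ ωt n := by
    intro n
    rcases lt_or_ge n 0 with h | h
    · rw [hdef2 n h]
    · exact (hdef1 n h).2 ⟨n, h, le_rfl, rfl⟩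
  have honet : ∀ n, 1 ≤ ωt n := fun n => (hone n).trans (hle n)
  have hatt : ∀ n : ℤ, 0 ≤ n → ∃ j, 0 ≤ j ∧ j ≤ n ∧ ωt n = ω j := fun n h => (hdef1 n h).1
  have hub : ∀ n k : ℤ, 0 ≤ k → k ≤ n → ω k ≤ ωt n := fun n k h0 hk =>
    (hdef1 n (h0.trans hk)).2 ⟨k, h0, hk, rfl⟩
  have hmono : ∀ a b : ℤ, 0 ≤ a → a ≤ b → ωt a ≤ ωt b := by
    intro a b h0 hab
    obtain ⟨j, hj0, hja, hj⟩ := hatt a h0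
    rw [hj]; exact hub b j hj0 (hja.trans hab)
  have hanti : ∀ x y : ℝ, 1 ≤ x → x ≤ y → y ^ (-q) ≤ x ^ (-q) := fun x y hx hxy =>
    Real.rpow_le_rpow_of_nonpos (by linarith) hxy (by linarith)
  have hpos : ∀ n, 0 < ωt n ^ (-q) := fun n => Real.rpow_pos_of_pos (by linarith [honet n]) _
  have huv : ∀ n, ωt n ^ (-q) ≤ ω n ^ (-q) := fun n => hanti _ _ (hone n) (hle n)
  refine ⟨⟨⟨honet, ?_⟩, ?_, ?_, ?_, ?_⟩, ?_⟩
  · have main : ∀ m n : ℤ, n < 0 → ωt (m + n) ≤ ωt m * ωt n := by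
      intro m n hn
      rcases lt_or_ge (m + n) 0 with h | h
      · rw [hdef2 _ h]
        exact (hsub m n).trans (mul_le_mul (hle m) (hle n) (by linarith [hone n])
          (by linarith [honet m]))
      · have := hmono (m + n) m h (by omega)
        nlinarith [honet m, honet n]
    intro m n
    rcases lt_or_ge n 0 with hn | hn
    · exact main m n hn
    rcases lt_or_ge m 0 with hm | hm
    · rw [add_comm, mul_comm]; exact main n m hm
    obtain ⟨j, hj0, hjn, hj⟩ := hatt (m + n) (by omega)
    rw [hj]
    have e : j = min j m + (j - min j m) := by ring
    rw [e]
    exact (hsub _ _).trans (mul_le_mul (hub _ _ (by omega) (by omega))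
      (hub _ _ (by omega) (by omega)) (by linarith [hone (j - min j m)]) (by linarith [honet m]))
  · intro n
    refine conv_min (u := fun n => ωt n ^ (-q)) (v := fun n => ω n ^ (-q)) hpos huv hsum hconv
      (fun n hn => by simp only [hdef2 n hn])
      (fun a b h0 hab => hanti _ _ (honet a) (hmono a b h0 hab)) ?_ n
    intro n hn
    obtain ⟨j, hj0, hjn, hj⟩ := hatt n hn
    exact ⟨j, hj0, hjn, by simp only [hj]⟩
  · exact hsum.of_nonneg_of_le (fun n => (hpos n).le) huv
  · intro hr
    have : rho1 ωt = rho1 ω := by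
      unfold rho1
      congr 1
      ext x
      constructor
      · rintro ⟨n, hn, rfl⟩
        exact ⟨n, hn, by rw [hdef2 _ (by omega)]⟩
      · rintro ⟨n, hn, rfl⟩
        exact ⟨n, hn, by rw [hdef2 _ (by omega)]⟩
    obtain ⟨K, hK, h⟩ := h1 (this ▸ hr)
    refine ⟨K, hK, fun n k hn hk => ?_⟩
    rw [hdef2 n (by omega), hdef2 (n + k) (by omega)]
    exact h n k hn hk
  · intro _
    exact ⟨1, one_pos, fun n k hn hk => by rw [one_mul]; exact hmono _ _ hn (by omega)⟩
  · obtain ⟨K, hK, h⟩ := h2 hρ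
    refine ⟨max K 1, by positivity, fun n => ?_⟩
    have hn1 := hone n
    rcases lt_or_ge n 0 with hn | hn
    · rw [hdef2 n hn]
      nlinarith [le_max_right K 1]
    · obtain ⟨j, hj0, hjn, hj⟩ := hatt n hn
      have := h j (n - j) hj0 (by omega)
      rw [add_sub_cancel] at this
      rw [hj]
      nlinarith [le_max_left K 1]
end
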